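/- Let M be a topological surface (a Hausdorff topological space in which every point has an open neighbourhood homeomorphic to an open subset of ℝ²), let f : M → M be a homeomorphism, and let (K, j, h) be a weak Denjoy sub-system for f. Then there exists a continuous injective map γ : 𝕋 → M such that γ(x) = j(x) for all x ∈ K; in particular (K, γ, h) is a C⁰ Denjoy sub-system extending (K, j, h). -/

import Mathlib

open Filter Topology Set

noncomputable section

/-- A Denjoy example: an orientation-preserving circle homeomorphism with
irrational rotation number together with its minimal invariant Cantor set. -/
structure DenjoySystem where
  /-- the circle homeomorphism -/
  h : UnitAddCircle ≃ₜ UnitAddCircle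
  /-- the minimal set -/
  K : Set UnitAddCircle
  /-- a lift of `h` to `ℝ` -/
  lift : ℝ → ℝ
  lift_mono : StrictMono lift
  lift_cont : Continuous lift
  lift_bij : Function.Bijective lift
  lift_add : ∀ x : ℝ, lift (x + 1) = lift x + 1
  lift_proj : ∀ x : ℝ, ((lift x : ℝ) : UnitAddCircle) = h (x : UnitAddCircle)
  /-- a representative of the rotation number -/
  rot : ℝ
  rot_lim : Filter.Tendsto (fun n : ℕ => lift^[n] 0 / (n : ℝ)) Filter.atTop (nhds rot)
  rot_irr : Irrational rot
  K_ne : K.Nonempty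
  K_cpt : IsCompact K
  K_proper : K ≠ Set.univ
  K_inv : h '' K = K
  K_perf : Perfect K
  K_td : IsTotallyDisconnected K
  K_min : ∀ x ∈ K, ∀ y ∈ K, y ∈ closure {z | ∃ n : ℤ, (h.toEquiv ^ n) x = z}

/-- A weak Denjoy sub-system (WDS) for a map `f : M → M`. -/
structure WDS (M : Type*) [TopologicalSpace M] (f : M → M) extends DenjoySystem where
  /-- the embedding of the minimal set into `M` -/
  j : K → M
  j_emb : Topology.IsEmbedding j
  range_inv : f '' Set.range j = Set.range j
  equivar : ∀ x y : K, h (x : UnitAddCircle) = (y : UnitAddCircle) → j y = f (j x)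

/-- Weak cyclic order on the circle. -/
def CircBtw (a b c : UnitAddCircle) : Prop :=
  ∃ x y z : ℝ, (x : UnitAddCircle) = a ∧ (y : UnitAddCircle) = b ∧ (z : UnitAddCircle) = c ∧
    x ≤ y ∧ y ≤ z ∧ z ≤ x + 1

/-- The order graph of a WDS. -/
def WDS.orderGraph {M : Type*} [TopologicalSpace M] {f : M → M} (W : WDS M f) :
    Set (M × M × M) :=
  {p | ∃ a b c : W.K, CircBtw (a : UnitAddCircle) (b : UnitAddCircle) (c : UnitAddCircle) ∧ p = (W.j a, W.j b, W.j c)}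

/-- The reverse of the order graph of a WDS. -/
def WDS.revGraph {M : Type*} [TopologicalSpace M] {f : M → M} (W : WDS M f) :
    Set (M × M × M) :=
  {p | (p.2.2, p.2.1, p.1) ∈ W.orderGraph}


section
namespace WDSAux

/-- selector for totally disconnected compact spaces -/
theorem td_selector {Y : Type*} [TopologicalSpace Y] [CompactSpace Y] [T2Space Y]
    [TotallyDisconnectedSpace Y] {ι : Type*} (U : ι → Set Y) (hU : ∀ i, IsOpen (U i))
    (hc : ∀ y, ∃ i, y ∈ U i) :
    ∃ s : Y → ι, IsLocallyConstant s ∧ ∀ y, y ∈ U (s y) := by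
  classical
  have h1 : ∀ y : Y, ∃ V : Set Y, IsClopen V ∧ y ∈ V ∧ ∃ i, V ⊆ U i := by
    intro y
    obtain ⟨i, hi⟩ := hc y
    obtain ⟨V, hV, hyV, hVU⟩ := compact_exists_isClopen_in_isOpen (hU i) hi
    exact ⟨V, hV, hyV, i, hVU⟩
  choose V hV hyV f hf using h1
  obtain ⟨t, ht⟩ := isCompact_univ.elim_finite_subcover V (fun y => (hV y).isOpen)
    (fun y _ => mem_iUnion.2 ⟨y, hyV y⟩)
  -- induct on the finite set
  have key : ∀ t : Finset Y, ∃ s : Y → Option ι, IsLocallyConstant s ∧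
      ∀ y, (∀ i, s y = some i → y ∈ U i) ∧ ((∃ x ∈ t, y ∈ V x) → s y ≠ none) := by
    intro t
    induction t using Finset.induction_on with
    | empty => exact ⟨fun _ => none, IsLocallyConstant.const _, by simp⟩
    | insert a t _ ih =>
      obtain ⟨s, hs, hsy⟩ := ih
      refine ⟨fun y => if y ∈ V a then some (f a) else s y, ?_, ?_⟩
      · rw [IsLocallyConstant.iff_eventually_eq] at hs ⊢
        intro x
        by_cases hx : x ∈ V a
        · filter_upwards [(hV a).isOpen.mem_nhds hx] with y hy
          simp [hx, hy]
        · filter_upwards [(hV a).compl.isOpen.mem_nhds hx, hs x] with y hy h2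
          have : y ∉ V a := hy
          simp [hx, this, h2]
      · intro y
        by_cases hy : y ∈ V a
        · simp only [hy, if_true]
          refine ⟨fun i hi => ?_, fun _ => by simp⟩
          simp at hi; subst hi; exact hf a hy
        · simp only [hy, if_false]
          refine ⟨(hsy y).1, ?_⟩
          rintro ⟨x, hx, hyx⟩
          rcases Finset.mem_insert.1 hx with rfl | hx
          · exact absurd hyx hy
          · exact (hsy y).2 ⟨x, hx, hyx⟩
  obtain ⟨s, hs, hsy⟩ := key t
  have hne : ∀ y, s y ≠ none := fun y => (hsy y).2 (by
    have := ht (mem_univ y)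
    simpa using this)
  by_cases hY : Nonempty Y
  · obtain ⟨y0⟩ := hY
    refine ⟨fun y => (s y).getD (f y0), hs.comp (fun o : Option ι => o.getD (f y0)), fun y => ?_⟩
    obtain ⟨i, hi⟩ := Option.ne_none_iff_exists'.1 (hne y)
    simp only [hi, Option.getD_some]
    exact (hsy y).1 i hi
  · refine ⟨fun y => (hY ⟨y⟩).elim, ?_, fun y => (hY ⟨y⟩).elim⟩
    rw [IsLocallyConstant.iff_eventually_eq]
    exact fun y => (hY ⟨y⟩).elim

/-- id plus contraction, as a homeomorphism -/
theorem contraction_homeo (g : ℂ → ℂ) (c : NNReal) (hc : c < 1) (hg : LipschitzWith c g) :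
    ∃ ψ : ℂ ≃ₜ ℂ, ∀ z, ψ z = z + g z := by
  have hs : ApproximatesLinearOn (fun z => z + g z)
      ((ContinuousLinearEquiv.refl ℝ ℂ : ℂ ≃L[ℝ] ℂ) : ℂ →L[ℝ] ℂ) univ c := by
    intro x _ y _
    have := hg.dist_le_mul x y
    rw [dist_eq_norm, dist_eq_norm] at this
    have h2 : x + g x - (y + g y) - (x - y) = g x - g y := by ring
    change ‖x + g x - (y + g y) - (x - y)‖ ≤ _
    rw [h2]; exact this
  have hc' : c < ‖(((ContinuousLinearEquiv.refl ℝ ℂ : ℂ ≃L[ℝ] ℂ).symm : ℂ →L[ℝ] ℂ))‖₊⁻¹ := by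
    have h1 : ‖(((ContinuousLinearEquiv.refl ℝ ℂ : ℂ ≃L[ℝ] ℂ).symm : ℂ →L[ℝ] ℂ))‖₊ = 1 := by
      have : (((ContinuousLinearEquiv.refl ℝ ℂ : ℂ ≃L[ℝ] ℂ).symm : ℂ →L[ℝ] ℂ))
        = ContinuousLinearMap.id ℝ ℂ := by ext <;> simp
      rw [this]
      ext
      exact ContinuousLinearMap.norm_id
    rw [h1]; simpa using hc
  refine ⟨hs.toHomeomorph _ (Or.inr hc'), fun z => ?_⟩
  rfl

theorem homeo_iterate {X : Type*} [TopologicalSpace X] (ψ : X ≃ₜ X) (n : ℕ) :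
    ∃ φ : X ≃ₜ X, ∀ z, φ z = ψ^[n] z := by
  induction n with
  | zero => exact ⟨Homeomorph.refl _, fun _ => rfl⟩
  | succ n ih =>
    obtain ⟨φ, h⟩ := ih
    exact ⟨ψ.trans φ, fun z => by simp [h, Function.iterate_succ_apply]⟩


/-- squeezing homeomorphism -/
theorem squeeze (R ρ : ℝ) (hR : 0 < R) (hρ : 0 < ρ) :
    ∃ ψ : ℂ ≃ₜ ℂ, (∀ z : ℂ, 2 * R ≤ ‖z‖ → ψ z = z) ∧ ∀ z : ℂ, ‖z‖ ≤ R → ‖ψ z‖ < ρ := by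
  set χ : ℂ → ℝ := fun z => max 0 (min 1 (2 - ‖z‖ / R)) with hχ
  have hχ0 : ∀ z, 0 ≤ χ z := fun z => le_max_left _ _
  have hχ1 : ∀ z, χ z ≤ 1 := fun z => max_le (by norm_num) (min_le_left _ _)
  have hχb : ∀ z : ℂ, 2 * R ≤ ‖z‖ → χ z = 0 := by
    intro z hz
    have : 2 ≤ ‖z‖ / R := by rw [le_div_iff₀ hR]; exact hz
    simp only [hχ]
    apply max_eq_left
    exact (min_le_right _ _).trans (by linarith)
  have hχs : ∀ z : ℂ, ‖z‖ ≤ R → χ z = 1 := by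
    intro z hz
    have : ‖z‖ / R ≤ 1 := by rw [div_le_one hR]; exact hz
    simp only [hχ]
    rw [min_eq_left (by linarith)]; norm_num
  have hχl : ∀ z w, |χ z - χ w| ≤ ‖z - w‖ / R := by
    intro z w
    have h1 : |χ z - χ w| ≤ |(min 1 (2 - ‖z‖ / R)) - (min 1 (2 - ‖w‖ / R))| := by
      simp only [hχ]
      have := abs_max_sub_max_le_max 0 (min 1 (2 - ‖z‖ / R)) 0 (min 1 (2 - ‖w‖ / R))
      simpa using this
    have h2 : |(min 1 (2 - ‖z‖ / R)) - (min 1 (2 - ‖w‖ / R))| ≤ |(2 - ‖z‖ / R) - (2 - ‖w‖ / R)| := by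
      have := abs_min_sub_min_le_max 1 (2 - ‖z‖ / R) 1 (2 - ‖w‖ / R)
      simpa using this
    have h3 : |(2 - ‖z‖ / R) - (2 - ‖w‖ / R)| = |‖w‖ - ‖z‖| / R := by
      rw [show (2 - ‖z‖ / R) - (2 - ‖w‖ / R) = (‖w‖ - ‖z‖) / R by ring, abs_div, abs_of_pos hR]
    have h4 : |‖w‖ - ‖z‖| / R ≤ ‖z - w‖ / R := by
      gcongr
      rw [norm_sub_rev]; exact abs_norm_sub_norm_le w z
    linarith
  have hl : ∀ z w : ℂ, ‖z‖ ≤ 2 * R → ‖(χ z : ℂ) * z - χ w * w‖ ≤ 3 * ‖z - w‖ := by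
    intro z w hz
    have : (χ z : ℂ) * z - χ w * w = χ w * (z - w) + ((χ z - χ w : ℝ) : ℂ) * z := by
      push_cast; ring
    rw [this]
    refine (norm_add_le _ _).trans ?_
    rw [norm_mul, norm_mul, Complex.norm_real, Complex.norm_real, Real.norm_of_nonneg (hχ0 w),
      Real.norm_eq_abs]
    have a1 : χ w * ‖z - w‖ ≤ 1 * ‖z - w‖ := by gcongr; exact hχ1 w
    have a2 : |χ z - χ w| * ‖z‖ ≤ ‖z - w‖ / R * (2 * R) := by
      gcongr; exact hχl z w
    have a3 : ‖z - w‖ / R * (2 * R) = 2 * ‖z - w‖ := by field_simp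
    linarith
  have hl2 : ∀ z w : ℂ, ‖(χ z : ℂ) * z - χ w * w‖ ≤ 3 * ‖z - w‖ := by
    intro z w
    by_cases hz : ‖z‖ ≤ 2 * R
    · exact hl z w hz
    by_cases hw : ‖w‖ ≤ 2 * R
    · rw [norm_sub_rev, norm_sub_rev z w]; exact hl w z hw
    · push Not at hz hw
      rw [hχb z hz.le, hχb w hw.le]
      simp
  obtain ⟨ψ, hψ⟩ := contraction_homeo (fun z => -(1/4 : ℂ) * ((χ z : ℂ) * z)) (3/4)
    (by rw [div_lt_one (by norm_num)]; norm_num) (by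
      apply LipschitzWith.of_dist_le_mul
      intro z w
      rw [dist_eq_norm, dist_eq_norm, ← mul_sub, norm_mul]
      have := hl2 z w
      norm_num
      linarith)
  obtain ⟨n, hn⟩ : ∃ n : ℕ, (3/4 : ℝ)^n * R < ρ := by
    obtain ⟨n, hn⟩ := exists_pow_lt_of_lt_one (div_pos hρ hR) (show (3/4 : ℝ) < 1 by norm_num)
    exact ⟨n, by rwa [lt_div_iff₀ hR] at hn⟩
  obtain ⟨φ, hφ⟩ := homeo_iterate ψ n
  refine ⟨φ, fun z hz => ?_, fun z hz => ?_⟩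
  · rw [hφ]
    have : ψ z = z := by rw [hψ, hχb z hz]; simp
    exact Function.iterate_fixed this n
  · rw [hφ]
    have : ∀ m : ℕ, ‖ψ^[m] z‖ ≤ (3/4 : ℝ)^m * R := by
      intro m
      induction m with
      | zero => simpa using hz
      | succ m ih =>
        rw [Function.iterate_succ_apply', hψ, hχs]
        · rw [show ψ^[m] z + -(1/4 : ℂ) * (((1:ℝ) : ℂ) * ψ^[m] z) = (3/4 : ℂ) * ψ^[m] z by
            push_cast; ring, norm_mul, pow_succ]
          norm_num
          linarith
        · refine ih.trans ?_
          have : (3/4 : ℝ)^m ≤ 1 := pow_le_one₀ (by norm_num) (by norm_num)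
          nlinarith
    exact (this n).trans_lt hn

/-- moving homeomorphism -/
theorem move (r : ℝ) (v : ℂ) (hv : ‖v‖ < r) :
    ∃ ψ : ℂ ≃ₜ ℂ, (∀ z : ℂ, r ≤ ‖z‖ → ψ z = z) ∧ ψ 0 = v := by
  have hr : 0 < r := (norm_nonneg v).trans_lt hv
  set χ : ℂ → ℝ := fun z => max 0 (1 - ‖z‖ / r) with hχ
  have hχl : ∀ z w, |χ z - χ w| ≤ ‖z - w‖ / r := by
    intro z w
    have h1 : |χ z - χ w| ≤ |(1 - ‖z‖ / r) - (1 - ‖w‖ / r)| := by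
      simp only [hχ]
      have := abs_max_sub_max_le_max 0 ((1 - ‖z‖ / r)) 0 ((1 - ‖w‖ / r))
      simpa using this
    have h3 : |(1 - ‖z‖ / r) - (1 - ‖w‖ / r)| = |‖w‖ - ‖z‖| / r := by
      rw [show (1 - ‖z‖ / r) - (1 - ‖w‖ / r) = (‖w‖ - ‖z‖) / r by ring, abs_div, abs_of_pos hr]
    have h4 : |‖w‖ - ‖z‖| / r ≤ ‖z - w‖ / r := by
      gcongr
      rw [norm_sub_rev]; exact abs_norm_sub_norm_le w z
    linarith
  obtain ⟨ψ, hψ⟩ := contraction_homeo (fun z => (χ z : ℂ) * v) (Real.toNNReal (‖v‖ / r))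
    (by
      rw [Real.toNNReal_lt_one, div_lt_one hr]
      exact hv) (by
      apply LipschitzWith.of_dist_le_mul
      intro z w
      rw [dist_eq_norm, dist_eq_norm, ← sub_mul, norm_mul, ← Complex.ofReal_sub, Complex.norm_real,
        Real.norm_eq_abs]
      have := hχl z w
      have h5 : |χ z - χ w| * ‖v‖ ≤ ‖z - w‖ / r * ‖v‖ := by gcongr
      refine h5.trans (le_of_eq ?_)
      rw [Real.coe_toNNReal _ (by positivity)]
      ring)
  refine ⟨ψ, fun z hz => ?_, ?_⟩
  · rw [hψ]
    have : 1 ≤ ‖z‖ / r := by rw [le_div_iff₀ hr]; linarith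
    have : χ z = 0 := max_eq_left (by linarith)
    simp [this]
  · rw [hψ]; simp [hχ]

/-- extension of compactly supported homeomorphisms of a disc -/
theorem ext_homeo {M : Type*} [TopologicalSpace M] [T2Space M] (d : ℂ → M)
    (hd : IsOpenEmbedding d) (ψ : ℂ ≃ₜ ℂ) (R : ℝ) (hψ : ∀ z : ℂ, R ≤ ‖z‖ → ψ z = z) :
    ∃ Φ : M ≃ₜ M, (∀ z, Φ (d z) = d (ψ z)) ∧ ∀ m, m ∉ d '' (Metric.closedBall 0 R) → Φ m = m := by
  classical
  set D : Set M := d '' (Metric.closedBall 0 R) with hD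
  have hDc : IsClosed D := ((isCompact_closedBall (0:ℂ) R).image hd.continuous).isClosed
  have hψ' : ∀ z : ℂ, R ≤ ‖z‖ → ψ.symm z = z := by
    intro z hz
    rw [Homeomorph.symm_apply_eq, hψ z hz]
  -- general construction
  have gen : ∀ ψ : ℂ ≃ₜ ℂ, (∀ z : ℂ, R ≤ ‖z‖ → ψ z = z) → ∃ F : M → M, Continuous F ∧
      (∀ z, F (d z) = d (ψ z)) ∧ ∀ m, m ∉ D → F m = m := by
    intro ψ hψ
    let F : M → M := fun m => if h : m ∈ range d then d (ψ h.choose) else m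
    have hF1 : ∀ z, F (d z) = d (ψ z) := by
      intro z
      have h : d z ∈ range d := ⟨z, rfl⟩
      have : h.choose = z := hd.injective h.choose_spec
      simp only [F, dif_pos h, this]
    have hF2 : ∀ m, m ∉ D → F m = m := by
      intro m hm
      by_cases h : m ∈ range d
      · obtain ⟨z, rfl⟩ := h
        rw [hF1, hψ]
        by_contra hz
        push Not at hz
        exact hm ⟨z, by simpa using hz.le, rfl⟩
      · simp only [F, dif_neg h]
    refine ⟨F, ?_, hF1, hF2⟩
    rw [continuous_iff_continuousAt]
    intro m
    by_cases h : m ∈ range d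
    · obtain ⟨z, rfl⟩ := h
      rw [ContinuousAt, ← hd.map_nhds_eq, tendsto_map'_iff]
      have : F ∘ d = d ∘ ψ := funext hF1
      rw [this, hF1]
      exact (hd.continuous.comp ψ.continuous).continuousAt
    · have hm : m ∈ Dᶜ := fun h' => h (image_subset_range _ _ h')
      have : F =ᶠ[𝓝 m] id := by
        filter_upwards [hDc.isOpen_compl.mem_nhds hm] with x hx using hF2 x hx
      exact continuousAt_id.congr this.symm
  obtain ⟨F, hFc, hF1, hF2⟩ := gen ψ hψ
  obtain ⟨G, hGc, hG1, hG2⟩ := gen ψ.symm hψ'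
  have inv : ∀ (ψ : ℂ ≃ₜ ℂ) (F G : M → M), (∀ z, F (d z) = d (ψ z)) → (∀ z, G (d z) = d (ψ.symm z))
     → (∀ m, m ∉ D → F m = m) → (∀ m, m ∉ D → G m = m) → ∀ m, G (F m) = m := by
    intro ψ F G h1 h2 h3 h4 m
    by_cases h : m ∈ range d
    · obtain ⟨z, rfl⟩ := h
      rw [h1, h2]; simp
    · have hm : m ∉ D := fun h' => h (image_subset_range _ _ h')
      rw [h3 m hm, h4 m hm]
  refine ⟨⟨⟨F, G, inv ψ F G hF1 hG1 hF2 hG2, inv ψ.symm G F hG1 (by simpa using hF1) hG2 hF2⟩, hFc, hGc⟩,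
    hF1, hF2⟩

end WDSAux
end

section
namespace WDSAux

/-- continuous logarithm on a set -/
def HasLogOn (F : ℂ → ℂ) (T : Set ℂ) : Prop :=
  ∃ l : ℂ → ℂ, ContinuousOn l T ∧ ∀ z ∈ T, Complex.exp (l z) = F z

theorem HasLogOn.mono {F : ℂ → ℂ} {S T : Set ℂ} (h : HasLogOn F T) (hs : S ⊆ T) : HasLogOn F S := by
  obtain ⟨l, h1, h2⟩ := h
  exact ⟨l, h1.mono hs, fun z hz => h2 z (hs hz)⟩

theorem HasLogOn.congr {F G : ℂ → ℂ} {T : Set ℂ} (h : HasLogOn F T) (hs : ∀ z ∈ T, F z = G z) :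
    HasLogOn G T := by
  obtain ⟨l, h1, h2⟩ := h
  exact ⟨l, h1, fun z hz => (h2 z hz).trans (hs z hz)⟩

theorem HasLogOn.mul {F G : ℂ → ℂ} {T : Set ℂ} (h : HasLogOn F T) (h' : HasLogOn G T) :
    HasLogOn (fun z => F z * G z) T := by
  obtain ⟨l, h1, h2⟩ := h
  obtain ⟨m, h3, h4⟩ := h'
  exact ⟨fun z => l z + m z, h1.add h3, fun z hz => by rw [Complex.exp_add, h2 z hz, h4 z hz]⟩

theorem HasLogOn.inv {F : ℂ → ℂ} {T : Set ℂ} (h : HasLogOn F T) :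
    HasLogOn (fun z => (F z)⁻¹) T := by
  obtain ⟨l, h1, h2⟩ := h
  exact ⟨fun z => - l z, h1.neg, fun z hz => by rw [Complex.exp_neg, h2 z hz]⟩

theorem HasLogOn.div {F G : ℂ → ℂ} {T : Set ℂ} (h : HasLogOn F T) (h' : HasLogOn G T) :
    HasLogOn (fun z => F z / G z) T := (h.mul h'.inv).congr fun z _ => (div_eq_mul_inv _ _).symm

theorem hasLogOn_slit {F : ℂ → ℂ} {T : Set ℂ} (h : ContinuousOn F T)
    (h' : ∀ z ∈ T, F z ∈ Complex.slitPlane) : HasLogOn F T :=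
  ⟨fun z => Complex.log (F z), h.clog h', fun z hz =>
    Complex.exp_log (Complex.slitPlane_ne_zero (h' z hz))⟩

theorem hasLogOn_const {c : ℂ} {T : Set ℂ} (h : c ≠ 0) : HasLogOn (fun _ => c) T :=
  ⟨fun _ => Complex.log c, continuousOn_const, fun _ _ => Complex.exp_log h⟩

theorem HasLogOn.union {F : ℂ → ℂ} {S T : Set ℂ} (h : HasLogOn F S) (h' : HasLogOn F T)
    (hS : IsClosed S) (hT : IsClosed T) (hd : Disjoint S T) : HasLogOn F (S ∪ T) := by
  classical
  obtain ⟨l, h1, h2⟩ := h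
  obtain ⟨m, h3, h4⟩ := h'
  have hmS : ∀ z ∈ T, z ∉ S := fun z hz hz' => Set.disjoint_left.1 hd hz' hz
  refine ⟨S.piecewise l m, ContinuousOn.union_of_isClosed ?_ ?_ hS hT, ?_⟩
  · exact h1.congr fun z hz => by simp [hz]
  · exact h3.congr fun z hz => by simp [hmS z hz]
  · rintro z (hz | hz)
    · simp [hz, h2 z hz]
    · simp [hmS z hz, h4 z hz]

theorem slit_one_sub {w : ℂ} (h : ‖w‖ < 1) : 1 - w ∈ Complex.slitPlane := by
  left
  have : w.re ≤ ‖w‖ := Complex.re_le_norm w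
  simp; linarith

theorem log_quot {N : Set ℂ} (hN : IsOpen N) (hc : IsPreconnected N) {p q : ℂ} (hp : p ∈ N)
    (hq : q ∈ N) : HasLogOn (fun z => (z - p) / (z - q)) Nᶜ := by
  have hne : ∀ x ∈ N, ∀ z ∈ Nᶜ, z - x ≠ 0 := by
    intro x hx z hz h
    rw [sub_eq_zero] at h; subst h; exact hz hx
  refine hc.induction₂' (fun p q => HasLogOn (fun z => (z - p) / (z - q)) Nᶜ) ?_ ?_ hp hq
  · intro x hx
    obtain ⟨ε, hε, hb⟩ := Metric.isOpen_iff.1 hN x hx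
    have : ∀ᶠ y in 𝓝[N] x, y ∈ Metric.ball x ε :=
      nhdsWithin_le_nhds (Metric.ball_mem_nhds x hε)
    filter_upwards [this, self_mem_nhdsWithin] with y hy hyN
    have key : HasLogOn (fun z => (z - y) / (z - x)) Nᶜ := by
      apply hasLogOn_slit
      · exact ContinuousOn.div (by fun_prop) (by fun_prop) (fun z hz => hne x hx z hz)
      · intro z hz
        have h0 := hne x hx z hz
        have : (z - y) / (z - x) = 1 - (y - x) / (z - x) := by field_simp; ring
        rw [this]
        apply slit_one_sub
        rw [norm_div, div_lt_one (norm_pos_iff.2 h0)]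
        have h1 : ‖y - x‖ < ε := by rwa [← dist_eq_norm]
        have h2 : ε ≤ ‖z - x‖ := by
          by_contra h3
          push Not at h3
          exact hz (hb (by rwa [Metric.mem_ball, dist_eq_norm]))
        linarith
    exact ⟨key.inv.congr fun z _ => inv_div _ _, key⟩
  · intro x y z hx hy hz h1 h2
    refine (h1.mul h2).congr fun w hw => ?_
    exact div_mul_div_cancel₀ (hne y hy w hw)

theorem log_far {T : Set ℂ} {R : ℝ} (hT : T ⊆ Metric.ball 0 R) {q : ℂ} (hq : R ≤ ‖q‖) (hR : 0 < R) :
    HasLogOn (fun z => z - q) T := by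
  have hq0 : q ≠ 0 := by
    rintro rfl
    simp at hq; linarith
  have : HasLogOn (fun z => 1 - z / q) T := by
    apply hasLogOn_slit (by fun_prop)
    intro z hz
    apply slit_one_sub
    rw [norm_div, div_lt_one (norm_pos_iff.2 hq0)]
    have := hT hz
    rw [mem_ball_zero_iff] at this
    linarith
  refine ((hasLogOn_const (neg_ne_zero.2 hq0)).mul this).congr fun z _ => ?_
  field_simp; ring

theorem exp_one_const {X : Type*} [TopologicalSpace X] {S : Set X} (hS : IsPreconnected S)
    {f : X → ℂ} (hf : ContinuousOn f S)
    (h1 : ∀ x ∈ S, Complex.exp (f x) = 1) {x y : X} (hx : x ∈ S) (hy : y ∈ S) : f x = f y := by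
  refine hS.induction₂' (fun p q => f p = f q) ?_ ?_ hx hy
  · intro x hx
    have := (hf x hx) (Metric.ball_mem_nhds (f x) one_pos)
    filter_upwards [this, self_mem_nhdsWithin] with y hy hyS
    suffices f x = f y from ⟨this, this.symm⟩
    obtain ⟨n, hn⟩ := Complex.exp_eq_exp_iff_exists_int.1 ((h1 y hyS).trans (h1 x hx).symm)
    have h2 : ‖f y - f x‖ < 1 := by simpa [dist_eq_norm] using hy
    rw [hn] at h2 ⊢
    have h3 : ‖(n : ℂ) * (2 * Real.pi * Complex.I)‖ = |(n : ℝ)| * (2 * Real.pi) := by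
      simp [abs_of_pos Real.pi_pos]
    rw [show f x + (n : ℂ) * (2 * Real.pi * Complex.I) - f x = (n : ℂ) * (2 * Real.pi * Complex.I) by ring,
      h3] at h2
    have hn0 : n = 0 := by
      by_contra h
      have : (1 : ℝ) ≤ |(n : ℝ)| := by exact_mod_cast Int.one_le_abs h
      nlinarith [Real.pi_gt_three]
    simp [hn0]
  · intro x y z _ _ _ h1 h2
    exact h1.trans h2

theorem no_log_frontier {A : Set ℂ} (hA : IsOpen A) (hb : Bornology.IsBounded A) {p q : ℂ}
    (hp : p ∈ A) (hq : q ∉ closure A)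
    (hl : HasLogOn (fun z => (z - p) / (z - q)) (frontier A)) : False := by
  classical
  obtain ⟨l, hl1, hl2⟩ := hl
  obtain ⟨g, hg⟩ := ContinuousMap.exists_restrict_eq (isClosed_frontier (s := A))
    ⟨(frontier A).domRestrict l, continuousOn_iff_continuous_domRestrict.1 hl1⟩
  have hg' : ∀ z ∈ frontier A, g z = l z := by
    intro z hz
    exact congrArg (fun F => F ⟨z, hz⟩) hg
  set G : ℂ → ℂ := A.piecewise (fun z => Complex.exp (g z) * (z - q)) (fun z => z - p) with hG
  have hGc : Continuous G := by
    apply Continuous.piecewise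
    · intro z hz
      rw [hg' z hz, hl2 z hz]
      apply div_mul_cancel₀
      intro h
      rw [sub_eq_zero] at h; subst h
      exact hq (frontier_subset_closure hz)
    · fun_prop
    · fun_prop
  have hG0 : ∀ z, G z ≠ 0 := by
    intro z
    by_cases hz : z ∈ A
    · simp only [hG, piecewise_eq_of_mem _ _ _ hz]
      refine mul_ne_zero (Complex.exp_ne_zero _) ?_
      intro h
      rw [sub_eq_zero] at h; subst h
      exact hq (subset_closure hz)
    · simp only [hG, piecewise_eq_of_notMem _ _ _ hz]
      intro h
      rw [sub_eq_zero] at h; subst h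
      exact hz hp
  have hsc : IsSimplyConnected (univ : Set ℂ) := by
    have : ContractibleSpace (univ : Set ℂ) := (Homeomorph.Set.univ ℂ).contractibleSpace
    exact (inferInstance : SimplyConnectedSpace (univ : Set ℂ))
  obtain ⟨H, hH1, hH2⟩ := Complex.exists_continuousOn_eqOn_exp_comp hsc isOpen_univ
    hGc.continuousOn (by rintro ⟨z, -, hz⟩; exact hG0 z hz)
  rw [continuousOn_univ] at hH1
  obtain ⟨R, hR⟩ := hb.subset_ball p
  have hR0 : 0 < R := by
    have := hR hp
    simpa using this
  have hθ : ∀ θ : ℝ, Complex.exp (H (p + R * Complex.exp (θ * Complex.I))) =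
      R * Complex.exp (θ * Complex.I) := by
    intro θ
    have h1 := hH2 (mem_univ (p + R * Complex.exp (θ * Complex.I)))
    simp only [Function.comp] at h1
    rw [h1]
    have : p + R * Complex.exp (θ * Complex.I) ∉ A := by
      intro h
      have := hR h
      rw [Metric.mem_ball, dist_eq_norm, add_sub_cancel_left, norm_mul, Complex.norm_exp_ofReal_mul_I,
        Complex.norm_real, Real.norm_of_nonneg hR0.le] at this
      linarith
    rw [hG, piecewise_eq_of_notMem _ _ _ this]
    ring
  have key := exp_one_const (X := ℝ) (S := univ) isPreconnected_univ
    (f := fun θ : ℝ => H (p + R * Complex.exp (θ * Complex.I)) - θ * Complex.I - Real.log R)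
    (by fun_prop) (by
      intro θ _
      rw [Complex.exp_sub, Complex.exp_sub, hθ, ← Complex.ofReal_exp, Real.exp_log hR0]
      have : (R : ℂ) ≠ 0 := by exact_mod_cast hR0.ne'
      have := Complex.exp_ne_zero (θ * Complex.I)
      field_simp) (mem_univ 0) (mem_univ (2 * Real.pi))
  simp only [Complex.ofReal_zero, zero_mul, Complex.exp_zero, Complex.ofReal_mul, Complex.ofReal_ofNat,
    Complex.exp_two_pi_mul_I] at key
  have : (2 * Real.pi * Complex.I : ℂ) = 0 := by linear_combination key
  simp [Real.pi_ne_zero] at this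

theorem td_log {Y : Set ℂ} (hY : IsCompact Y) (htd : IsTotallyDisconnected Y) {F : ℂ → ℂ}
    (hF : ContinuousOn F Y) (h0 : ∀ y ∈ Y, F y ≠ 0) : HasLogOn F Y := by
  classical
  have : CompactSpace Y := isCompact_iff_compactSpace.1 hY
  have : TotallyDisconnectedSpace Y := (totallyDisconnectedSpace_subtype_iff).2 htd
  have hFr : Continuous (fun y : Y => F y) := continuousOn_iff_continuous_domRestrict.1 hF
  obtain ⟨s, hs, hsy⟩ := td_selector (Y := Y) (ι := Y) (fun a => {y | F y / F a ∈ Complex.slitPlane})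
    (fun a => Complex.isOpen_slitPlane.preimage (hFr.div_const _))
    (fun y => ⟨y, by
      change F y / F y ∈ Complex.slitPlane
      rw [div_self (h0 y y.2)]; exact Complex.one_mem_slitPlane⟩)
  have hsc : Continuous (fun y : Y => F (s y)) := hs.continuous.subtype_val |> fun _ =>
    (hs.comp (fun a : Y => F a)).continuous
  have hsl : Continuous (fun y : Y => Complex.log (F (s y))) :=
    (hs.comp (fun a : Y => Complex.log (F a))).continuous
  let L : Y → ℂ := fun y => Complex.log (F (s y)) + Complex.log (F y / F (s y))
  have hL : Continuous L := by
    apply hsl.add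
    exact (hFr.div hsc (fun y => h0 _ (s y).2)).clog (fun y => hsy y)
  refine ⟨fun z => if h : z ∈ Y then L ⟨z, h⟩ else 0, ?_, ?_⟩
  · rw [continuousOn_iff_continuous_domRestrict]
    convert hL using 1
    ext y
    simp
  · intro z hz
    simp only [dif_pos hz, L]
    have h1 := h0 _ (s ⟨z, hz⟩).2
    rw [Complex.exp_add, Complex.exp_log h1, Complex.exp_log (div_ne_zero (h0 z hz) h1),
      mul_div_cancel₀ _ h1]

/-- a closed totally disconnected planar set does not separate the disc -/
theorem ball_diff_preconn {S : Set ℂ} (hS : IsClosed S) (htd : IsTotallyDisconnected S) :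
    IsPreconnected (Metric.ball (0:ℂ) 1 \ S) := by
  classical
  set D := Metric.ball (0:ℂ) 1 \ S with hD
  have hDo : IsOpen D := Metric.isOpen_ball.sdiff hS
  intro u v hu hv huv hDu hDv
  by_contra hne
  obtain ⟨p, hpD, hpu⟩ := hDu
  obtain ⟨q, hqD, hqv⟩ := hDv
  set A := D ∩ u with hA
  set B := D ∩ v with hB
  have hAo : IsOpen A := hDo.inter hu
  have hBo : IsOpen B := hDo.inter hv
  have hAB : Disjoint A B := by
    rw [Set.disjoint_left]
    rintro z ⟨h1, h2⟩ ⟨_, h3⟩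
    exact hne ⟨z, h1, h2, h3⟩
  have hcl : Disjoint (closure A) B := hAB.closure_left hBo
  have hqB : q ∈ B := ⟨hqD, hqv⟩
  have hclb : closure A ⊆ Metric.closedBall 0 1 :=
    closure_minimal (fun z hz => Metric.ball_subset_closedBall hz.1.1) Metric.isClosed_closedBall
  have hp1 : ‖p‖ < 1 := by simpa using hpD.1
  have hq1 : ‖q‖ < 1 := by simpa using hqD.1
  obtain ⟨ρ, hρ1, hρ2⟩ := exists_between (max_lt hp1 hq1)
  obtain ⟨ρ', hρ3, hρ4⟩ := exists_between hρ2
  have hlog1 : HasLogOn (fun z => (z - p) / (z - q)) (Metric.ball 0 ρ)ᶜ :=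
    log_quot Metric.isOpen_ball (convex_ball _ _).isPreconnected
      (by simpa using (le_max_left _ _).trans_lt hρ1) (by simpa using (le_max_right _ _).trans_lt hρ1)
  set Y := S ∩ Metric.closedBall 0 1 with hY
  have hYc : IsCompact Y := (isCompact_closedBall (0:ℂ) 1).inter_left hS
  have hYtd : IsTotallyDisconnected Y := fun t ht => htd t (ht.trans inter_subset_left)
  have : CompactSpace Y := isCompact_iff_compactSpace.1 hYc
  have : TotallyDisconnectedSpace Y := (totallyDisconnectedSpace_subtype_iff).2 hYtd
  obtain ⟨s, hs, hsy⟩ := td_selector (Y := Y) (ι := Bool)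
    (fun b => if b then {y | ρ < ‖(y:ℂ)‖} else {y | ‖(y:ℂ)‖ < ρ'})
    (by
      rintro (_ | _)
      · simpa using isOpen_lt (by fun_prop) continuous_const
      · simpa using isOpen_lt continuous_const (by fun_prop))
    (by
      intro y
      by_cases h : ρ < ‖(y:ℂ)‖
      · exact ⟨true, by simpa using h⟩
      · exact ⟨false, by simp; linarith⟩)
  have hcl' : ∀ b, IsCompact (Subtype.val '' {y : Y | s y = b}) := by
    intro b
    have : IsClosed {y : Y | s y = b} := (hs.isClopen_fiber b).isClosed
    exact this.isCompact.image continuous_subtype_val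
  set Y0 := Subtype.val '' {y : Y | s y = false} with hY0
  set Y1 := Subtype.val '' {y : Y | s y = true} with hY1
  have hY0b : ∀ z ∈ Y0, ‖z‖ < ρ' := by
    rintro _ ⟨y, hy, rfl⟩
    have := hsy y
    rw [mem_ofPred_eq] at hy
    rw [hy] at this
    simpa using this
  have hY1b : ∀ z ∈ Y1, ρ < ‖z‖ := by
    rintro _ ⟨y, hy, rfl⟩
    have := hsy y
    rw [mem_ofPred_eq] at hy
    rw [hy] at this
    simpa using this
  have hY0Y : Y0 ⊆ Y := by rintro _ ⟨y, _, rfl⟩; exact y.2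
  have hYne : ∀ x ∈ D, ∀ z ∈ Y, z - x ≠ 0 := by
    intro x hx z hz h
    rw [sub_eq_zero] at h; subst h
    exact hx.2 hz.1
  have hlog0 : HasLogOn (fun z => (z - p) / (z - q)) Y0 := by
    apply td_log (hcl' false) (fun t ht => hYtd t (ht.trans hY0Y))
    · exact ContinuousOn.div (by fun_prop) (by fun_prop) (fun z hz => hYne q hqD z (hY0Y hz))
    · intro z hz
      exact div_ne_zero (hYne p hpD z (hY0Y hz)) (hYne q hqD z (hY0Y hz))
  have hlog1' : HasLogOn (fun z => (z - p) / (z - q)) ((Metric.ball 0 ρ')ᶜ ∪ Y1) := by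
    apply hlog1.mono
    rintro z (hz | hz)
    · simp at hz ⊢; linarith
    · have := hY1b z hz
      simp; linarith
  have hlog := hlog1'.union hlog0 ((Metric.isOpen_ball.isClosed_compl).union (hcl' true).isClosed)
    (hcl' false).isClosed (by
      rw [Set.disjoint_left]
      rintro z (hz | hz) hz0
      · have := hY0b z hz0
        simp at hz; linarith
      · obtain ⟨y, hy, rfl⟩ := hz
        obtain ⟨y', hy', h⟩ := hz0
        have : y' = y := Subtype.ext h
        subst this
        simp at hy hy'
        rw [hy] at hy'; cases hy')
  refine no_log_frontier hAo (Metric.isBounded_ball.subset (fun z hz => hz.1.1)) ⟨hpD, hpu⟩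
    (fun h => Set.disjoint_left.1 hcl h hqB) (hlog.mono ?_)
  intro z hz
  rw [hAo.frontier_eq] at hz
  by_cases hz1 : ‖z‖ < ρ'
  · have hzS : z ∈ S := by
      by_contra hzS
      have hzD : z ∈ D := ⟨by simp; linarith, hzS⟩
      rcases huv hzD with h | h
      · exact hz.2 ⟨hzD, h⟩
      · exact Set.disjoint_left.1 hcl hz.1 ⟨hzD, h⟩
    have hzY : z ∈ Y := ⟨hzS, by simp; linarith⟩
    cases hsz : s ⟨z, hzY⟩
    · exact Or.inr ⟨⟨z, hzY⟩, hsz, rfl⟩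
    · exact Or.inl (Or.inr ⟨⟨z, hzY⟩, hsz, rfl⟩)
  · left; left
    simpa using hz1

end WDSAux
end

section
namespace WDSAux

/-- surfaces: small open discs around every point -/
def Surf (M : Type*) [TopologicalSpace M] : Prop :=
  ∀ m : M, ∀ W ∈ 𝓝 m, ∃ d : ℂ → M, IsOpenEmbedding d ∧ range d ⊆ W ∧ d 0 = m

/-- a disc inside a ball of the plane -/
theorem disc_ball (c : ℂ) (r : ℝ) (hr : 0 < r) :
    ∃ d : ℂ → ℂ, IsOpenEmbedding d ∧ range d = Metric.ball c r ∧ d 0 = c := by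
  let e := OpenPartialHomeomorph.univBall c r
  refine ⟨e, ?_, ?_, OpenPartialHomeomorph.univBall_apply_zero c r⟩
  · exact e.to_isOpenEmbedding (OpenPartialHomeomorph.univBall_source c r)
  · have h1 : e.source = univ := OpenPartialHomeomorph.univBall_source c r
    have h2 : e.target = Metric.ball c r := OpenPartialHomeomorph.univBall_target c hr
    rw [← image_univ, ← h1, e.image_source_eq_target, h2]

theorem surf_complex : Surf ℂ := by
  intro m W hW
  obtain ⟨r, hr, hb⟩ := Metric.mem_nhds_iff.1 hW
  obtain ⟨d, h1, h2, h3⟩ := disc_ball m r hr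
  exact ⟨d, h1, h2 ▸ hb, h3⟩

theorem Surf.subtype {M : Type*} [TopologicalSpace M] (hM : Surf M) {O : Set M} (hO : IsOpen O) :
    Surf O := by
  intro m W hW
  have h1 : Subtype.val '' W ∈ 𝓝 (m : M) := hO.isOpenEmbedding_subtypeVal.image_mem_nhds.2 hW
  obtain ⟨d, h2, h3, h4⟩ := hM m _ h1
  have h5 : ∀ z, d z ∈ O := by
    intro z
    obtain ⟨y, _, hy⟩ := h3 ⟨z, rfl⟩
    rw [← hy]; exact y.2
  refine ⟨fun z => ⟨d z, h5 z⟩, ?_, ?_, ?_⟩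
  · apply IsOpenEmbedding.of_comp (f := fun z => (⟨d z, h5 z⟩ : O)) (g := Subtype.val) 
    · exact hO.isOpenEmbedding_subtypeVal
    · exact h2
  · rintro _ ⟨z, rfl⟩
    obtain ⟨y, hy, hy2⟩ := h3 ⟨z, rfl⟩
    have : y = ⟨d z, h5 z⟩ := Subtype.ext hy2
    change (⟨d z, h5 z⟩ : O) ∈ W
    rw [← this]; exact hy
  · exact Subtype.ext h4

theorem surf_of_charts {M : Type*} [TopologicalSpace M]
    (h : ∀ m : M, ∃ U : Set M, IsOpen U ∧ m ∈ U ∧ ∃ V : Set (ℝ × ℝ), IsOpen V ∧ Nonempty (U ≃ₜ V)) :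
    Surf M := by
  intro m W hW
  obtain ⟨U, hU, hm, V, hV, ⟨e⟩⟩ := h m
  -- transfer to ℂ
  let c : ℂ ≃ₜ ℝ × ℝ := Complex.equivRealProdCLM.toHomeomorph
  have hV' : IsOpen (c ⁻¹' V) := hV.preimage c.continuous
  let g : (c ⁻¹' V : Set ℂ) → M := fun z => (e.symm ⟨c z, z.2⟩ : U)
  have hg : IsOpenEmbedding g := by
    refine hU.isOpenEmbedding_subtypeVal.comp (e.symm.isOpenEmbedding.comp ?_)
    apply IsOpenEmbedding.of_comp (g := Subtype.val)
    · exact hV.isOpenEmbedding_subtypeVal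
    · exact c.isOpenEmbedding.comp hV'.isOpenEmbedding_subtypeVal
  let z0 : (c ⁻¹' V : Set ℂ) := ⟨c.symm (e ⟨m, hm⟩), by simp⟩
  have hz0 : g z0 = m := by simp [g, z0]
  have h1 : g ⁻¹' W ∈ 𝓝 z0 := hg.continuous.continuousAt (by rwa [hz0])
  obtain ⟨d, h2, h3, h4⟩ := surf_complex.subtype hV' z0 _ h1
  refine ⟨g ∘ d, hg.comp h2, ?_, ?_⟩
  · rintro _ ⟨z, rfl⟩
    exact h3 ⟨z, rfl⟩
  · simp [h4, hz0]

theorem td_preimage {X Y : Type*} [TopologicalSpace X] [TopologicalSpace Y] {d : X → Y}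
    (hd : Continuous d) (hi : Function.Injective d) {S : Set Y} (hS : IsTotallyDisconnected S) :
    IsTotallyDisconnected (d ⁻¹' S) := by
  intro t ht hc x hx y hy
  apply hi
  exact hS (d '' t) (by rintro _ ⟨z, hz, rfl⟩; exact ht hz) (hc.image d hd.continuousOn)
    ⟨x, hx, rfl⟩ ⟨y, hy, rfl⟩

theorem ball_diff_nonempty {S : Set ℂ} (htd : IsTotallyDisconnected S) {r : ℝ} (hr : 0 < r) (c : ℂ) :
    (Metric.ball c r \ S).Nonempty := by
  rw [Set.nonempty_iff_ne_empty]
  intro h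
  rw [sdiff_eq_empty] at h
  have := htd _ h (convex_ball _ _).isPreconnected (Metric.mem_ball_self hr)
    (show c + (r/2 : ℝ) ∈ _ by
      rw [Metric.mem_ball, dist_eq_norm, add_sub_cancel_left, Complex.norm_real,
        Real.norm_of_nonneg (by linarith)]; linarith)
  have h2 : ((r/2 : ℝ) : ℂ) = 0 := by linear_combination -this
  have h3 : r/2 = 0 := by exact_mod_cast h2
  linarith

/-- closed totally disconnected sets in surfaces have dense complement -/
theorem Surf.diff_nonempty {M : Type*} [TopologicalSpace M] (hM : Surf M) {S : Set M}
    (htd : IsTotallyDisconnected S) {O : Set M} (hO : IsOpen O) (hne : O.Nonempty) :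
    (O \ S).Nonempty := by
  obtain ⟨m, hm⟩ := hne
  obtain ⟨d, h1, h2, h3⟩ := hM m O (hO.mem_nhds hm)
  obtain ⟨z, _, hz⟩ := ball_diff_nonempty (td_preimage h1.continuous h1.injective htd) one_pos 0
  exact ⟨d z, h2 ⟨z, rfl⟩, hz⟩

theorem Surf.diff_preconn {M : Type*} [TopologicalSpace M] (hM : Surf M) {S : Set M}
    (hS : IsClosed S) (htd : IsTotallyDisconnected S) {O : Set M} (hO : IsOpen O)
    (hc : IsPreconnected O) : IsPreconnected (O \ S) := by
  have loc : ∀ x ∈ O, ∃ N : Set M, IsOpen N ∧ x ∈ N ∧ N ⊆ O ∧ IsPreconnected (N \ S) := by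
    intro x hx
    obtain ⟨d, h1, h2, h3⟩ := hM x O (hO.mem_nhds hx)
    refine ⟨d '' Metric.ball 0 1, h1.isOpenMap _ Metric.isOpen_ball, ⟨0, by simp, h3⟩,
      (image_subset_range _ _).trans h2, ?_⟩
    have := (ball_diff_preconn (hS.preimage h1.continuous)
      (td_preimage h1.continuous h1.injective htd)).image d h1.continuous.continuousOn
    convert this using 1
    ext m
    constructor
    · rintro ⟨⟨z, hz, rfl⟩, hm⟩
      exact ⟨z, ⟨hz, hm⟩, rfl⟩
    · rintro ⟨z, ⟨hz, hm⟩, rfl⟩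
      exact ⟨⟨z, hz, rfl⟩, hm⟩
  intro u v hu hv huv hOu hOv
  by_contra hne
  have hdis : ∀ z ∈ O \ S, z ∈ u → z ∈ v → False := fun z hz h1 h2 => hne ⟨z, hz, h1, h2⟩
  let E : Set M → Set M := fun w => {x | ∃ N : Set M, IsOpen N ∧ x ∈ N ∧ N ⊆ O ∧ N \ S ⊆ w}
  have hE : ∀ w, IsOpen (E w) := by
    intro w
    rw [isOpen_iff_mem_nhds]
    rintro x ⟨N, h1, h2, h3, h4⟩
    filter_upwards [h1.mem_nhds h2] with y hy using ⟨N, h1, hy, h3, h4⟩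
  have hcov : O ⊆ E u ∪ E v := by
    intro x hx
    obtain ⟨N, h1, h2, h3, h4⟩ := loc x hx
    have h5 : N \ S ⊆ u ∪ v := fun z hz => huv ⟨h3 hz.1, hz.2⟩
    by_cases h6 : (N \ S ∩ u).Nonempty
    · left
      refine ⟨N, h1, h2, h3, ?_⟩
      by_contra h7
      rw [Set.not_subset] at h7
      obtain ⟨z, hz, hzu⟩ := h7
      obtain ⟨y, hy, hy2⟩ := h4 u v hu hv h5 h6 ⟨z, hz, (h5 hz).resolve_left hzu⟩
      exact hdis y ⟨h3 hy.1, hy.2⟩ hy2.1 hy2.2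
    · right
      refine ⟨N, h1, h2, h3, fun z hz => (h5 hz).resolve_left fun h => h6 ⟨z, hz, h⟩⟩
  have hsub : ∀ w : Set M, IsOpen w → (O \ S ∩ w).Nonempty → (O ∩ E w).Nonempty := by
    rintro w hw ⟨x, hx, hxw⟩
    exact ⟨x, hx.1, O ∩ w, hO.inter hw, ⟨hx.1, hxw⟩, inter_subset_left, fun z hz => hz.1.2⟩
  obtain ⟨x, _, ⟨N, h1, h2, h3, h4⟩, ⟨N', h1', h2', h3', h4'⟩⟩ :=
    hc _ _ (hE u) (hE v) hcov (hsub u hu hOu) (hsub v hv hOv)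
  obtain ⟨y, hy, hyS⟩ := hM.diff_nonempty htd (h1.inter h1') ⟨x, h2, h2'⟩
  exact hdis y ⟨h3 hy.1, hyS⟩ (h4 ⟨hy.1, hyS⟩) (h4' ⟨hy.2, hyS⟩)

end WDSAux
end

section
namespace WDSAux

/-- products of powers of linear factors not vanishing on X -/
inductive Gen (X : Set ℂ) : (ℂ → ℂ) → Prop
  | one : Gen X (fun _ => 1)
  | step (p : ℂ) (hp : p ∉ X) (m : ℤ) (g : ℂ → ℂ) (hg : Gen X g) : Gen X (fun z => (z - p) ^ m * g z)

theorem Gen.mul {X : Set ℂ} {F G : ℂ → ℂ} (hF : Gen X F) (hG : Gen X G) :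
    Gen X (fun z => F z * G z) := by
  induction hF with
  | one => simpa using hG
  | step p hp m g hg ih =>
    have := Gen.step p hp m _ ih
    simpa [mul_assoc] using this

theorem HasLogOn.zpow {F : ℂ → ℂ} {T : Set ℂ} (h : HasLogOn F T) (m : ℤ) :
    HasLogOn (fun z => F z ^ m) T := by
  obtain ⟨l, h1, h2⟩ := h
  exact ⟨fun z => m * l z, continuousOn_const.mul h1, fun z hz => by
    rw [Complex.exp_int_mul, h2 z hz]⟩

def Tame (X : Set ℂ) (g : ℂ → ℂ) : Prop := ∃ F, Gen X F ∧ HasLogOn (fun z => g z * F z) X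

theorem jump_induction (Z : Set ℝ) (T b ε : ℝ) (hε : 0 < ε) (hT : ∀ z ∈ Z, z ≤ T) (hb : ∀ z ∈ Z, b ≤ z)
    (Q : (ℝ → ℤ) → Prop) (h0 : ∀ n : ℝ → ℤ, (∀ z ∈ Z, n z = 0) → Q n)
    (hstep : ∀ (n : ℝ → ℤ) (t : ℝ) (m : ℤ), t ∉ Z → Q (fun s => n s - if t < s then m else 0) → Q n)
    (n : ℝ → ℤ) (hn : ∀ z ∈ Z, ∀ z' ∈ Z, |z - z'| < ε → n z = n z') : Q n := by
  have key : ∀ N : ℕ, ∀ n : ℝ → ℤ, (∀ z ∈ Z, ∀ z' ∈ Z, |z - z'| < ε → n z = n z') →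
      (∀ z ∈ Z, z ≤ T - N * (ε / 4) → n z = 0) → Q n := by
    intro N
    induction N with
    | zero =>
      intro n _ h
      exact h0 n fun z hz => h z hz (by simpa using hT z hz)
    | succ N ih =>
      intro n hn hz0
      set s := T - (N + 1 : ℕ) * (ε / 4) with hs
      have hs' : T - N * (ε / 4) = s + ε / 4 := by rw [hs]; push_cast; ring
      by_cases hall : ∀ z ∈ Z, z ≤ s + ε / 4 → n z = 0
      · exact ih n hn (by rw [hs']; exact hall)
      push Not at hall
      obtain ⟨z1, hz1, hz1s, hz1n⟩ := hall
      have hz1s' : s < z1 := by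
        by_contra h
        exact hz1n (hz0 z1 hz1 (not_lt.1 h))
      have hsep : ∀ z ∈ Z, z ≤ s → ∀ w ∈ Z, s < w → ε ≤ w - z := by
        intro z hz hzs w hw hws
        have a1 : ε ≤ z1 - z := by
          by_contra h
          exact hz1n ((hn z1 hz1 z hz (by rw [abs_lt]; constructor <;> linarith)).trans (hz0 z hz hzs))
        by_cases hw1 : w ≤ s + ε / 4
        · by_contra h
          have e1 : n w = n z := hn w hw z hz (by rw [abs_lt]; constructor <;> linarith)
          have e2 : n w = n z1 := hn w hw z1 hz1 (by rw [abs_lt]; constructor <;> linarith)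
          exact hz1n (e2.symm.trans (e1.trans (hz0 z hz hzs)))
        · push Not at hw1
          linarith
      have hup : ∀ w ∈ Z, s - ε / 4 < w → s < w := by
        intro w hw h
        by_contra h'
        have := hsep w hw (not_lt.1 h') z1 hz1 hz1s'
        linarith
      refine hstep n (s - ε / 4) (n z1) ?_ (ih _ ?_ ?_)
      · intro h
        have := hsep _ h (by linarith) z1 hz1 hz1s'
        linarith
      · intro z hz z' hz' hzz
        have e := hn z hz z' hz' hzz
        beta_reduce
        rw [e]
        congr 1
        by_cases c1 : s - ε / 4 < z <;> by_cases c2 : s - ε / 4 < z'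
        · simp [c1, c2]
        · have := hsep z' hz' (by linarith) z hz (hup z hz c1)
          rw [abs_lt] at hzz; linarith
        · have := hsep z hz (by linarith) z' hz' (hup z' hz' c2)
          rw [abs_lt] at hzz; linarith
        · simp [c1, c2]
      · intro z hz hzs
        rw [hs'] at hzs
        beta_reduce
        by_cases c1 : s - ε / 4 < z
        · have := hup z hz c1
          have e2 : n z = n z1 := hn z hz z1 hz1 (by rw [abs_lt]; constructor <;> linarith)
          simp [c1, e2]
        · simp only [c1, if_false, sub_zero]
          exact hz0 z hz (by linarith)
  obtain ⟨N, hN⟩ := exists_nat_gt ((T - b) / (ε / 4))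
  refine key (N + 1) n hn fun z hz h => ?_
  exfalso
  rw [div_lt_iff₀ (by linarith)] at hN
  have := hb z hz
  push_cast at h
  linarith

theorem slit_of_re {w : ℂ} (h : 0 ≤ w.re) (h0 : w ≠ 0) : w ∈ Complex.slitPlane := by
  rcases h.lt_or_eq with h | h
  · exact Or.inl h
  · right
    intro hi
    exact h0 (Complex.ext h.symm hi)

/-- the linear factor has a logarithm on a half plane -/
theorem half_log {a : ℂ} (ha : a ≠ 0) {p : ℂ} {T : Set ℂ}
    (h : ∀ z ∈ T, 0 ≤ (a * (z - p)).re ∧ z ≠ p) : HasLogOn (fun z => z - p) T := by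
  have h1 : HasLogOn (fun z => a * (z - p)) T := by
    apply hasLogOn_slit (by fun_prop)
    intro z hz
    exact slit_of_re (h z hz).1 (mul_ne_zero ha (sub_ne_zero.2 (h z hz).2))
  refine ((hasLogOn_const (inv_ne_zero ha)).mul h1).congr fun z _ => ?_
  field_simp

theorem gen_transfer {X : Set ℂ} {a : ℂ} (ha : a ≠ 0) {c : ℝ} {F : ℂ → ℂ}
    (hF : Gen (X ∩ {z | (a * z).re ≤ c}) F) :
    ∃ F', Gen X F' ∧ HasLogOn F' (X ∩ {z | c ≤ (a * z).re}) ∧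
      ∃ E, HasLogOn E (X ∩ {z | (a * z).re ≤ c}) ∧ ∀ z, F z = E z * F' z := by
  induction hF with
  | one => exact ⟨_, Gen.one, hasLogOn_const one_ne_zero, _, hasLogOn_const one_ne_zero, fun z => (mul_one 1).symm⟩
  | step p hp m g hg ih =>
    obtain ⟨F', h1, h2, E, h3, h4⟩ := ih
    by_cases hpc : (a * p).re < c
    · have hpX : p ∉ X := fun h => hp ⟨h, hpc.le⟩
      refine ⟨_, Gen.step p hpX m F' h1, ?_, E, h3, fun z => by show (z - p) ^ m * g z = _; rw [h4]; ring⟩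
      refine HasLogOn.mul (HasLogOn.zpow (half_log ha ?_) m) h2
      rintro z ⟨_, hz⟩
      have hz' : c ≤ (a * z).re := hz
      refine ⟨?_, ?_⟩
      · rw [mul_sub, Complex.sub_re]; linarith
      · rintro rfl; linarith
    · refine ⟨F', h1, h2, _, HasLogOn.mul (HasLogOn.zpow (half_log (neg_ne_zero.2 ha) (p := p) ?_) m) h3,
        fun z => by show (z - p) ^ m * g z = _; rw [h4]; ring⟩
      rintro z ⟨hzX, hz⟩
      have hz' : (a * z).re ≤ c := hz
      refine ⟨?_, ?_⟩
      · rw [neg_mul, Complex.neg_re, mul_sub, Complex.sub_re]; linarith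
      · rintro rfl; exact hp ⟨hzX, hz⟩

theorem log_I_mul_neg {x : ℝ} (hx : x < 0) : Complex.log (x * Complex.I) = Real.log (-x) - Real.pi / 2 * Complex.I := by
  have : ((x : ℂ) * Complex.I) = ((-x : ℝ) : ℂ) * (-Complex.I) := by push_cast; ring
  rw [this, Complex.log_ofReal_mul (by linarith) (by simp), Complex.log_neg_I]
  ring

theorem log_I_mul_pos {x : ℝ} (hx : 0 < x) : Complex.log (x * Complex.I) = Real.log x + Real.pi / 2 * Complex.I := by
  rw [Complex.log_ofReal_mul hx (by simp), Complex.log_I]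

theorem glue_cut {X : Set ℂ} (hX : IsCompact X) {a : ℂ} (ha : a ≠ 0) {c : ℝ} {g : ℂ → ℂ}
    (h1 : HasLogOn g (X ∩ {z | (a * z).re ≤ c})) (h2 : HasLogOn g (X ∩ {z | c ≤ (a * z).re})) :
    Tame X g := by
  classical
  obtain ⟨l1, hl1, he1⟩ := h1
  obtain ⟨l2, hl2, he2⟩ := h2
  have hX1 : IsClosed (X ∩ {z : ℂ | (a * z).re ≤ c}) :=
    hX.isClosed.inter (isClosed_le (by fun_prop) continuous_const)
  have hX2 : IsClosed (X ∩ {z : ℂ | c ≤ (a * z).re}) :=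
    hX.isClosed.inter (isClosed_le continuous_const (by fun_prop))
  set pt : ℝ → ℂ := fun s => (c + s * Complex.I) / a with hpt
  have hptc : Continuous pt := by fun_prop
  have hapt : ∀ s, a * pt s = c + s * Complex.I := fun s => by simp only [hpt]; field_simp
  have hre : ∀ s, (a * pt s).re = c := fun s => by simp [hapt]
  have hptim : ∀ z : ℂ, (a * z).re = c → pt (a * z).im = z := by
    intro z hz
    simp only [hpt]
    rw [div_eq_iff ha, ← hz, Complex.re_add_im, mul_comm]
  set Z : Set ℝ := pt ⁻¹' X with hZ
  have hZc : IsCompact Z := by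
    have : Z ⊆ (fun z : ℂ => (a * z).im) '' X := by
      intro s hs
      exact ⟨pt s, hs, by simp [hapt]⟩
    exact (hX.image (by fun_prop)).of_isClosed_subset (hX.isClosed.preimage hptc) this
  set Q : (ℝ → ℤ) → Prop := fun n => ∀ (g l1 l2 : ℂ → ℂ),
    ContinuousOn l1 (X ∩ {z | (a * z).re ≤ c}) → (∀ z ∈ X ∩ {z | (a * z).re ≤ c}, Complex.exp (l1 z) = g z) →
    ContinuousOn l2 (X ∩ {z | c ≤ (a * z).re}) → (∀ z ∈ X ∩ {z | c ≤ (a * z).re}, Complex.exp (l2 z) = g z) →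
    (∀ s ∈ Z, l1 (pt s) - l2 (pt s) = n s * (2 * Real.pi * Complex.I)) → Tame X g with hQ
  -- integer-valued difference
  have hintg : ∀ s ∈ Z, ∃ n : ℤ, l1 (pt s) = l2 (pt s) + n * (2 * Real.pi * Complex.I) := by
    intro s hs
    rw [← Complex.exp_eq_exp_iff_exists_int, he1 _ ⟨hs, (hre s).le⟩, he2 _ ⟨hs, (hre s).ge⟩]
  choose! n hn using hintg
  have hδ : ContinuousOn (fun s => l1 (pt s) - l2 (pt s)) Z := by
    apply ContinuousOn.sub
    · exact hl1.comp hptc.continuousOn fun s hs => ⟨hs, (hre s).le⟩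
    · exact hl2.comp hptc.continuousOn fun s hs => ⟨hs, (hre s).ge⟩
  have hu := hZc.uniformContinuousOn_of_continuous hδ
  obtain ⟨ε, hε, hεu⟩ := Metric.uniformContinuousOn_iff.1 hu 1 one_pos
  obtain ⟨T, hT⟩ := hZc.bddAbove
  obtain ⟨b, hb⟩ := hZc.bddBelow
  have hQn : Q n := by
    refine jump_induction Z T b ε hε hT hb Q ?_ ?_ n ?_
    · intro n h0 g l1 l2 hl1 he1 hl2 he2 hd
      refine ⟨_, Gen.one, ?_⟩
      refine HasLogOn.congr (F := g) ?_ (fun z _ => (mul_one _).symm)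
      set l : ℂ → ℂ := fun z => if (a * z).re ≤ c then l1 z else l2 z with hl
      have e1 : ∀ z ∈ X ∩ {z | (a * z).re ≤ c}, l z = l1 z := fun z hz => if_pos hz.2
      have e2 : ∀ z ∈ X ∩ {z | c ≤ (a * z).re}, l z = l2 z := by
        intro z hz
        by_cases h : (a * z).re ≤ c
        · have hzc : (a * z).re = c := le_antisymm h hz.2
          rw [hl]; simp only [h, if_true]
          have hs : (a * z).im ∈ Z := by
            change pt _ ∈ X
            rw [hptim z hzc]; exact hz.1
          have := hd _ hs
          rw [h0 _ hs, hptim z hzc] at this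
          simpa [sub_eq_zero] using this
        · exact if_neg h
      have hun : X = (X ∩ {z | (a * z).re ≤ c}) ∪ (X ∩ {z | c ≤ (a * z).re}) := by
        ext z
        constructor
        · intro hz
          rcases le_total (a * z).re c with h | h
          · exact Or.inl ⟨hz, h⟩
          · exact Or.inr ⟨hz, h⟩
        · rintro (h | h)
          · exact h.1
          · exact h.1
      refine ⟨l, ?_, ?_⟩
      · rw [hun]
        exact ContinuousOn.union_of_isClosed (hl1.congr e1) (hl2.congr e2) hX1 hX2
      · intro z hz
        rw [hun] at hz
        rcases hz with hz | hz
        · rw [e1 z hz, he1 z hz]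
        · rw [e2 z hz, he2 z hz]
    · intro n t m ht hQ' g l1 l2 hl1 he1 hl2 he2 hd
      have hne : ∀ z ∈ X, z - pt t ≠ 0 := by
        intro z hz h
        rw [sub_eq_zero] at h; subst h; exact ht hz
      have hsl1 : ∀ z ∈ X ∩ {z | (a * z).re ≤ c}, -(a * (z - pt t)) ∈ Complex.slitPlane := by
        intro z hz
        apply slit_of_re
        · have : (a * z).re ≤ c := hz.2
          rw [mul_sub, Complex.neg_re, Complex.sub_re, hre]; linarith
        · exact neg_ne_zero.2 (mul_ne_zero ha (hne z hz.1))
      have hsl2 : ∀ z ∈ X ∩ {z | c ≤ (a * z).re}, (a * (z - pt t)) ∈ Complex.slitPlane := by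
        intro z hz
        apply slit_of_re
        · have : c ≤ (a * z).re := hz.2
          rw [mul_sub, Complex.sub_re, hre]; linarith
        · exact (mul_ne_zero ha (hne z hz.1))
      obtain ⟨F, hF, hFl⟩ := hQ' (fun z => g z * (z - pt t) ^ m)
        (fun z => l1 z + m * (Complex.log (-(a * (z - pt t))) - Real.pi * Complex.I - Complex.log a))
        (fun z => l2 z + m * (Complex.log (a * (z - pt t)) - Complex.log a))
        (by
          apply hl1.add
          apply continuousOn_const.mul
          refine ContinuousOn.sub (ContinuousOn.sub (ContinuousOn.clog (by fun_prop) hsl1) ?_) ?_ <;> fun_prop)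
        (by
          intro z hz
          rw [Complex.exp_add, he1 z hz, Complex.exp_int_mul]
          congr 2
          rw [Complex.exp_sub, Complex.exp_sub, Complex.exp_log ha, Complex.exp_pi_mul_I,
            Complex.exp_log (Complex.slitPlane_ne_zero (hsl1 z hz))]
          field_simp)
        (by
          apply hl2.add
          apply continuousOn_const.mul
          refine ContinuousOn.sub (ContinuousOn.clog (by fun_prop) hsl2) ?_ ; fun_prop)
        (by
          intro z hz
          rw [Complex.exp_add, he2 z hz, Complex.exp_int_mul]
          congr 2
          rw [Complex.exp_sub, Complex.exp_log ha, 
            Complex.exp_log (Complex.slitPlane_ne_zero (hsl2 z hz))]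
          field_simp)
        (by
          intro s hs
          have e := hd s hs
          have hst : s ≠ t := by rintro rfl; exact ht hs
          have e3 : a * (pt s - pt t) = ((s - t : ℝ) : ℂ) * Complex.I := by
            rw [mul_sub, hapt, hapt]; push_cast; ring
          have e4 : -(a * (pt s - pt t)) = ((t - s : ℝ) : ℂ) * Complex.I := by
            rw [e3]; push_cast; ring
          beta_reduce
          rw [e4, e3]
          rcases lt_or_gt_of_ne hst with h | h
          · rw [log_I_mul_pos (x := t - s) (by linarith), log_I_mul_neg (x := s - t) (by linarith), if_neg (not_lt.2 h.le),
              neg_sub]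
            push_cast
            linear_combination e
          · rw [log_I_mul_neg (x := t - s) (by linarith), log_I_mul_pos (x := s - t) (by linarith), if_pos h, neg_sub]
            push_cast
            linear_combination e)
      refine ⟨_, Gen.step (pt t) ht m F hF, hFl.congr fun z _ => ?_⟩
      simp only [mul_assoc]
    · intro z hz z' hz' hzz
      have h1 := hεu z hz z' hz' (by rwa [Real.dist_eq])
      rw [dist_eq_norm, hn z hz, hn z' hz'] at h1
      have h2 : l2 (pt z) + n z * (2 * Real.pi * Complex.I) - l2 (pt z) -
          (l2 (pt z') + n z' * (2 * Real.pi * Complex.I) - l2 (pt z')) =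
          ((n z - n z' : ℤ) : ℂ) * (2 * Real.pi * Complex.I) := by push_cast; ring
      have h3 : ‖((n z - n z' : ℤ) : ℂ) * (2 * Real.pi * Complex.I)‖ = |((n z - n z' : ℤ) : ℝ)| * (2 * Real.pi) := by
        simp only [norm_mul, Complex.norm_intCast, Complex.norm_I, Complex.norm_ofNat, Complex.norm_real,
          Real.norm_of_nonneg Real.pi_pos.le, mul_one]
      rw [h2, h3] at h1
      by_contra hne
      have : (1 : ℝ) ≤ |((n z - n z' : ℤ) : ℝ)| := by exact_mod_cast Int.one_le_abs (sub_ne_zero.2 hne)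
      nlinarith [Real.pi_gt_three]
  exact hQn g l1 l2 hl1 he1 hl2 he2 fun s hs => by rw [hn s hs]; ring

theorem tame_cut {X : Set ℂ} (hX : IsCompact X) {a : ℂ} (ha : a ≠ 0) {c : ℝ} {g : ℂ → ℂ}
    (h1 : Tame (X ∩ {z | (a * z).re ≤ c}) g) (h2 : Tame (X ∩ {z | c ≤ (a * z).re}) g) :
    Tame X g := by
  obtain ⟨F1, hF1, hl1⟩ := h1
  obtain ⟨F2, hF2, hl2⟩ := h2
  have hs2 : {z : ℂ | c ≤ (a * z).re} = {z : ℂ | (-a * z).re ≤ -c} := by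
    ext z; simp only [mem_ofPred_eq, neg_mul, Complex.neg_re, neg_le_neg_iff]
  have hs1 : {z : ℂ | (a * z).re ≤ c} = {z : ℂ | -c ≤ (-a * z).re} := by
    ext z; simp only [mem_ofPred_eq, neg_mul, Complex.neg_re, neg_le_neg_iff]
  obtain ⟨G1, hG1, hG1l, E1, hE1, hE1e⟩ := gen_transfer ha hF1
  rw [hs2] at hF2
  obtain ⟨G2, hG2, hG2l, E2, hE2, hE2e⟩ := gen_transfer (neg_ne_zero.2 ha) hF2
  rw [← hs1] at hG2l
  rw [← hs2] at hE2
  obtain ⟨F, hF, hFl⟩ := glue_cut (g := fun z => g z * G1 z * G2 z) hX ha (c := c) (by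
      refine ((hl1.div hE1).mul hG2l).congr fun z hz => ?_
      have : E1 z ≠ 0 := by
        obtain ⟨l, _, hl⟩ := hE1
        rw [← hl z hz]; exact Complex.exp_ne_zero _
      simp only [hE1e]
      field_simp) (by
      refine ((hl2.div hE2).mul hG1l).congr fun z hz => ?_
      have : E2 z ≠ 0 := by
        obtain ⟨l, _, hl⟩ := hE2
        rw [← hl z hz]; exact Complex.exp_ne_zero _
      simp only [hE2e]
      field_simp)
  refine ⟨_, (hG1.mul hG2).mul hF, hFl.congr fun z _ => ?_⟩
  ring

theorem tame_of_log {X : Set ℂ} {g : ℂ → ℂ} (h : HasLogOn g X) : Tame X g :=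
  ⟨_, Gen.one, h.congr fun z _ => (mul_one _).symm⟩

end WDSAux
end

section
namespace WDSAux

theorem strip_ind {g : ℂ → ℂ} {a : ℂ} (ha : a ≠ 0) {δ : ℝ} (hδ : 0 < δ) (Cn : Set ℂ → Prop)
    (hmono : ∀ A B, A ⊆ B → Cn B → Cn A)
    (hP : ∀ Y, IsCompact Y → Cn Y → (∃ u, ∀ z ∈ Y, u ≤ (a * z).re ∧ (a * z).re ≤ u + δ) → Tame Y g)
    (Y : Set ℂ) (hY : IsCompact Y) (hC : Cn Y) : Tame Y g := by
  have key : ∀ N : ℕ, ∀ Y, IsCompact Y → Cn Y →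
      (∃ u, ∀ z ∈ Y, u ≤ (a * z).re ∧ (a * z).re ≤ u + (N + 1) * δ) → Tame Y g := by
    intro N
    induction N with
    | zero => intro Y hY hC ⟨u, hu⟩; exact hP Y hY hC ⟨u, by simpa using hu⟩
    | succ N ih =>
      intro Y hY hC ⟨u, hu⟩
      have c1 : IsClosed {z : ℂ | (a * z).re ≤ u + δ} := isClosed_le (by fun_prop) continuous_const
      have c2 : IsClosed {z : ℂ | u + δ ≤ (a * z).re} := isClosed_le continuous_const (by fun_prop)
      apply tame_cut hY ha (c := u + δ)
      · refine hP _ (hY.inter_right c1) (hmono _ _ inter_subset_left hC) ⟨u, fun z hz => ⟨(hu z hz.1).1, hz.2⟩⟩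
      · refine ih _ (hY.inter_right c2) (hmono _ _ inter_subset_left hC) ⟨u + δ, fun z hz => ⟨hz.2, ?_⟩⟩
        have := (hu z hz.1).2
        push_cast at this
        linarith
  have hc : Continuous fun z : ℂ => (a * z).re := by fun_prop
  obtain ⟨T, hT⟩ := (hY.image hc).bddAbove
  obtain ⟨b, hb⟩ := (hY.image hc).bddBelow
  obtain ⟨N, hN⟩ := exists_nat_gt ((T - b) / δ)
  rw [div_lt_iff₀ hδ] at hN
  refine key N Y hY hC ⟨b, fun z hz => ⟨hb ⟨z, hz, rfl⟩, ?_⟩⟩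
  have : (a * z).re ≤ T := hT ⟨z, hz, rfl⟩
  nlinarith

theorem tame_all {X : Set ℂ} (hX : IsCompact X) {g : ℂ → ℂ} (hg : ContinuousOn g X)
    (h0 : ∀ z ∈ X, g z ≠ 0) : Tame X g := by
  rcases X.eq_empty_or_nonempty with rfl | hne
  · exact tame_of_log ⟨fun _ => 0, continuousOn_empty _, fun z hz => hz.elim⟩
  obtain ⟨x0, hx0, hmin⟩ := hX.exists_isMinOn hne hg.norm
  have hm : 0 < ‖g x0‖ := norm_pos_iff.2 (h0 x0 hx0)
  obtain ⟨δ, hδ, hu⟩ := Metric.uniformContinuousOn_iff.1 (hX.uniformContinuousOn_of_continuous hg) _ hm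
  have hI : (-Complex.I) ≠ 0 := by simp
  refine strip_ind (one_ne_zero) (δ := δ / 4) (by linarith) (fun A => A ⊆ X) (fun A B h1 h2 => h1.trans h2)
    ?_ X hX Subset.rfl
  intro Y hY hYX hYu
  refine strip_ind hI (δ := δ / 4) (by linarith) (fun A => A ⊆ Y) (fun A B h1 h2 => h1.trans h2)
    ?_ Y hY Subset.rfl
  intro Z hZ hZY ⟨v, hv⟩
  obtain ⟨u, hu'⟩ := hYu
  rcases Z.eq_empty_or_nonempty with rfl | ⟨w, hw⟩
  · exact tame_of_log ⟨fun _ => 0, continuousOn_empty _, fun z hz => hz.elim⟩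
  have hwX := hYX (hZY hw)
  have hgw := h0 w hwX
  apply tame_of_log
  have h1 : HasLogOn (fun z => g z / g w) Z := by
    apply hasLogOn_slit ((hg.mono (hZY.trans hYX)).div_const _)
    intro z hz
    have hd : dist z w < δ := by
      rw [dist_eq_norm]
      refine (Complex.norm_le_abs_re_add_abs_im _).trans_lt ?_
      have a1 := hu' z (hZY hz)
      have a2 := hu' w (hZY hw)
      have a3 := hv z hz
      have a4 := hv w hw
      simp only [one_mul] at a1 a2
      simp only [neg_mul, Complex.neg_re, Complex.I_mul_re, neg_neg] at a3 a4
      have b1 : |(z - w).re| ≤ δ / 4 := by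
        rw [Complex.sub_re, abs_le]; constructor <;> linarith [a1.1, a1.2, a2.1, a2.2]
      have b2 : |(z - w).im| ≤ δ / 4 := by
        rw [Complex.sub_im, abs_le]; constructor <;> linarith [a3.1, a3.2, a4.1, a4.2]
      linarith
    have := hu z (hYX (hZY hz)) w hwX hd
    rw [dist_eq_norm] at this
    have hle : ‖g x0‖ ≤ ‖g w‖ := hmin hwX
    have e : g z / g w = 1 - (g w - g z) / g w := by field_simp; ring
    rw [e]
    apply slit_one_sub
    rw [norm_div, div_lt_one (norm_pos_iff.2 hgw), norm_sub_rev]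
    linarith
  refine ((hasLogOn_const hgw).mul h1).congr fun z _ => ?_
  field_simp

theorem log_of_compl_conn {X : Set ℂ} (hX : IsCompact X) (hc : IsPreconnected Xᶜ) {g : ℂ → ℂ}
    (hg : ContinuousOn g X) (h0 : ∀ z ∈ X, g z ≠ 0) : HasLogOn g X := by
  obtain ⟨F, hF, hl⟩ := tame_all hX hg h0
  have hFl : HasLogOn F X := by
    clear hl
    induction hF with
    | one => exact hasLogOn_const one_ne_zero
    | step p hp m g hg' ih =>
      refine HasLogOn.mul (HasLogOn.zpow ?_ m) ih
      obtain ⟨R, hR⟩ := hX.isBounded.subset_ball 0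
      set R' := max R 1
      have hR' : X ⊆ Metric.ball 0 R' := hR.trans (Metric.ball_subset_ball (le_max_left _ _))
      have hRp : 0 < R' := lt_of_lt_of_le one_pos (le_max_right _ _)
      have hn : ‖(R' : ℂ)‖ = R' := by simp [abs_of_pos hRp]
      have hq : (R' : ℂ) ∉ X := fun h => by
        have := hR' h
        rw [mem_ball_zero_iff, hn] at this
        exact lt_irrefl _ this
      have h1 := log_quot hX.isClosed.isOpen_compl hc hp hq
      rw [compl_compl] at h1
      have h2 := log_far hR' hn.ge hRp
      refine (h1.mul h2).congr fun z hz => ?_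
      have : z - R' ≠ 0 := sub_ne_zero.2 (fun h => hq (h ▸ hz))
      field_simp
  refine (hl.div hFl).congr fun z hz => ?_
  have : F z ≠ 0 := by
    obtain ⟨l, _, hl⟩ := hFl
    rw [← hl z hz]; exact Complex.exp_ne_zero _
  field_simp

end WDSAux
end

section
namespace WDSAux

theorem td_exp {C : Set ℂ} (hC : IsTotallyDisconnected C) :
    IsTotallyDisconnected (Complex.exp ⁻¹' C) := by
  intro S hS hp x hx y hy
  have h1 : (Complex.exp '' S).Subsingleton :=
    hC _ (by rintro _ ⟨z, hz, rfl⟩; exact hS hz) (hp.image _ Complex.continuous_exp.continuousOn)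
  have := exp_one_const hp (f := fun w => w - x) (by fun_prop) (fun w hw => by
    have : Complex.exp w = Complex.exp x := h1 ⟨w, hw, rfl⟩ ⟨x, hx, rfl⟩
    rw [Complex.exp_sub, this, div_self (Complex.exp_ne_zero _)]) hx hy
  simp only [sub_self] at this
  exact (sub_eq_zero.1 this.symm).symm

theorem comp_closure {K : Set ℂ} {x w : ℂ} (hK : IsClosed K)
    (hw : w ∈ closure (connectedComponentIn Kᶜ x)) (hwK : w ∉ K) : w ∈ connectedComponentIn Kᶜ x := by
  have ho : IsOpen (connectedComponentIn Kᶜ w) := hK.isOpen_compl.connectedComponentIn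
  obtain ⟨u, hu1, hu2⟩ := mem_closure_iff.1 hw _ ho (mem_connectedComponentIn hwK)
  rw [connectedComponentIn_eq hu2, ← connectedComponentIn_eq hu1]
  exact mem_connectedComponentIn hwK

theorem ring_set {C : Set ℂ} (hC : IsCompact C) (htd : IsTotallyDisconnected C) {R : ℝ} (hR : 0 < R) :
    ∃ K : Set ℂ, IsCompact K ∧ IsPreconnected K ∧ K.Nonempty ∧ K ⊆ Metric.ball 0 R ∧ Disjoint C K ∧
      (0:ℂ) ∉ K ∧ ¬ HasLogOn (fun z => z) K := by
  set O : Set ℂ := {w | w.re < Real.log R} with hO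
  have hOo : IsOpen O := isOpen_lt Complex.continuous_re continuous_const
  have hOc : IsPreconnected O := (convex_halfSpace_re_lt _).isPreconnected
  have htd' := td_exp htd
  have hcl : IsClosed (Complex.exp ⁻¹' C) := hC.isClosed.preimage Complex.continuous_exp
  have hpre := surf_complex.diff_preconn hcl htd' hOo hOc
  obtain ⟨y, hy⟩ := surf_complex.diff_nonempty htd' hOo
    ⟨((Real.log R - 1 : ℝ) : ℂ), by simp [hO, -Complex.ofReal_sub]⟩
  have hpath : IsPathConnected (O \ Complex.exp ⁻¹' C) :=
    (hOo.sdiff hcl).isConnected_iff_isPathConnected.1 ⟨⟨y, hy⟩, hpre⟩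
  have hy2 : y + 2 * Real.pi * Complex.I ∈ O \ Complex.exp ⁻¹' C := by
    refine ⟨?_, ?_⟩
    · have : y.re < Real.log R := hy.1
      simpa [hO] using this
    · intro h
      apply hy.2
      change Complex.exp _ ∈ C at h
      rwa [Complex.exp_periodic y] at h
  obtain ⟨γ, hγ⟩ := hpath.joinedIn y hy _ hy2
  have hec : Continuous fun t => Complex.exp (γ t) := Complex.continuous_exp.comp γ.continuous
  refine ⟨range fun t => Complex.exp (γ t), isCompact_range hec, isPreconnected_range hec, range_nonempty _,
    ?_, ?_, ?_, ?_⟩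
  · rintro _ ⟨t, rfl⟩
    rw [mem_ball_zero_iff, Complex.norm_exp]
    have : (γ t).re < Real.log R := (hγ t).1
    calc _ < Real.exp (Real.log R) := Real.exp_lt_exp.2 this
      _ = R := Real.exp_log hR
  · rw [Set.disjoint_left]
    rintro _ h ⟨t, rfl⟩
    exact (hγ t).2 h
  · rintro ⟨t, ht⟩
    exact Complex.exp_ne_zero _ ht
  · rintro ⟨l, hl, he⟩
    have := exp_one_const (isPreconnected_univ (α := unitInterval))
      (f := fun t => l (Complex.exp (γ t)) - γ t)
      (((hl.comp_continuous hec fun t => ⟨t, rfl⟩).sub γ.continuous).continuousOn)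
      (fun t _ => by
        rw [Complex.exp_sub, he _ ⟨t, rfl⟩, div_self (Complex.exp_ne_zero _)]) (mem_univ 0) (mem_univ 1)
    simp only [γ.source, γ.target, Complex.exp_periodic y] at this
    have h2 : (2 * Real.pi * Complex.I : ℂ) = 0 := by linear_combination this
    exact Complex.two_pi_I_ne_zero h2

theorem thick_conn {K : Set ℂ} (hK : IsCompact K) (hp : IsPreconnected K) (hne : K.Nonempty) (x : ℂ)
    {ε : ℝ} (hε : 0 < ε) :
    IsPreconnected ((connectedComponentIn Kᶜ x)ᶜ ∪ Metric.thickening ε K) := by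
  obtain ⟨k0, hk0⟩ := hne
  have hKs : K ⊆ Metric.thickening ε K := Metric.self_subset_thickening hε K
  have hbs : ∀ k ∈ K, Metric.ball k ε ⊆ Metric.thickening ε K := fun k hk =>
    Metric.ball_subset_thickening hk ε
  have hA : ∀ k ∈ K, IsPreconnected (Metric.ball k ε ∪ K) := fun k hk =>
    ((convex_ball k ε).isPreconnected).union k (Metric.mem_ball_self hε) hk hp
  apply isPreconnected_of_forall k0
  intro y hy
  by_cases hyT : y ∈ Metric.thickening ε K
  · obtain ⟨k, hk, hyk⟩ := Metric.mem_thickening_iff.1 hyT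
    exact ⟨Metric.ball k ε ∪ K, (union_subset (hbs k hk) hKs).trans subset_union_right, Or.inr hk0,
      Or.inl hyk, hA k hk⟩
  · have hyU := hy.resolve_right hyT
    have hyK : y ∉ K := fun h => hyT (hKs h)
    set V := connectedComponentIn Kᶜ y with hV
    have hyV : y ∈ V := mem_connectedComponentIn hyK
    have hVo : IsOpen V := hK.isClosed.isOpen_compl.connectedComponentIn
    have hVK : V ⊆ Kᶜ := connectedComponentIn_subset _ _
    have hncl : ¬ IsClosed V := by
      intro h
      rcases isClopen_iff.1 ⟨h, hVo⟩ with h | h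
      · rw [h] at hyV; exact hyV
      · exact hVK (h ▸ mem_univ k0) hk0
    have : ¬ closure V ⊆ V := fun h => hncl (closure_subset_iff_isClosed.1 h)
    obtain ⟨w, hw, hwV⟩ := not_subset.1 this
    have hwK : w ∈ K := by
      by_contra h
      exact hwV (comp_closure hK.isClosed hw h)
    obtain ⟨u, hu1, hu2⟩ := mem_closure_iff.1 hw _ Metric.isOpen_ball (Metric.mem_ball_self hε)
    have hVU : V ⊆ (connectedComponentIn Kᶜ x)ᶜ := by
      intro v hv hvU
      apply hyU
      rw [connectedComponentIn_eq hvU, ← connectedComponentIn_eq hv]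
      exact hyV
    refine ⟨V ∪ (Metric.ball w ε ∪ K), ?_, Or.inr (Or.inr hk0), Or.inl hyV,
      isPreconnected_connectedComponentIn.union u hu2 (Or.inl hu1) (hA w hwK)⟩
    exact union_subset_union hVU (union_subset (hbs w hwK) hKs)

theorem sqrt_limit {U : Set ℂ} (hU : IsOpen U) {g : ℂ → ℂ} (hg : ContinuousOn g U)
    (h0 : ∀ z ∈ U, g z ≠ 0) (s : ℕ → ℂ → ℂ)
    (hs : ∀ z ∈ U, ∃ r > 0, Metric.ball z r ⊆ U ∧ ∀ᶠ n in atTop,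
      ContinuousOn (s n) (Metric.ball z r) ∧ ∀ w ∈ Metric.ball z r, s n w ^ 2 = g w) :
    ∃ t : ℂ → ℂ, ContinuousOn t U ∧ ∀ z ∈ U, t z ^ 2 = g z := by
  classical
  let F : Ultrafilter ℕ := Ultrafilter.of atTop
  have hF : (F : Filter ℕ) ≤ atTop := Ultrafilter.of_le atTop
  choose! r hr hrU hev using hs
  have hsame : ∀ z ∈ U, ∃ b : ℂ → ℂ, ContinuousOn b (Metric.ball z (r z)) ∧
      (∀ w ∈ Metric.ball z (r z), b w ^ 2 = g w) ∧
      ∀ᶠ n in (F : Filter ℕ), ∀ w ∈ Metric.ball z (r z), s n w = b w := by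
    intro z hz
    have h1 := hF (hev z hz)
    obtain ⟨n0, hb1, hb2⟩ := (hev z hz).exists
    set b := s n0
    have h2 : ∀ᶠ n in (F : Filter ℕ), EqOn (s n) b (Metric.ball z (r z)) ∨
        EqOn (s n) (-b) (Metric.ball z (r z)) := by
      filter_upwards [h1] with n hn
      refine (convex_ball z (r z)).isPreconnected.eq_or_eq_neg_of_sq_eq hn.1 hb1 ?_ ?_
      · intro w hw
        simp only [Pi.pow_apply]
        rw [hn.2 w hw, hb2 w hw]
      · intro w hw h
        apply h0 w (hrU z hz hw)
        rw [← hb2 w hw, h]; simp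
    rcases Ultrafilter.eventually_or.1 h2 with h | h
    · exact ⟨b, hb1, hb2, h⟩
    · exact ⟨-b, hb1.neg, fun w hw => by simp [hb2 w hw], h⟩
  choose! b hb1 hb2 hb3 using hsame
  have heq : ∀ z ∈ U, ∀ w ∈ Metric.ball z (r z), b w w = b z w := by
    intro z hz w hw
    have hwU := hrU z hz hw
    obtain ⟨n, h1, h2⟩ := ((hb3 z hz).and (hb3 w hwU)).exists
    rw [← h1 w hw, ← h2 w (Metric.mem_ball_self (hr w hwU))]
  refine ⟨fun z => b z z, ?_, fun z hz => hb2 z hz z (Metric.mem_ball_self (hr z hz))⟩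
  intro z hz
  have hn : Metric.ball z (r z) ∈ 𝓝 z := Metric.ball_mem_nhds z (hr z hz)
  refine ContinuousAt.continuousWithinAt ?_
  refine ((hb1 z hz).continuousAt hn).congr ?_
  filter_upwards [hn] with w hw using (heq z hz w hw).symm

theorem good_planar {C : Set ℂ} (hC : IsCompact C) (htd : IsTotallyDisconnected C) {R : ℝ} (hR : 0 < R) :
    ∃ U : Set ℂ, IsOpen U ∧ IsPreconnected U ∧ (0:ℂ) ∈ U ∧ U ⊆ Metric.ball 0 R ∧ IsCompact (C ∩ U) ∧
      ∀ g : ℂ → ℂ, ContinuousOn g U → (∀ z ∈ U, g z ≠ 0) →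
        ∃ t : ℂ → ℂ, ContinuousOn t U ∧ ∀ z ∈ U, t z ^ 2 = g z := by
  obtain ⟨K, hK, hKp, hKne, hKR, hKC, hK0, hlog⟩ := ring_set hC htd hR
  set U := connectedComponentIn Kᶜ 0 with hU
  have hUo : IsOpen U := hK.isClosed.isOpen_compl.connectedComponentIn
  have hUc : IsPreconnected U := isPreconnected_connectedComponentIn
  have h0U : (0:ℂ) ∈ U := mem_connectedComponentIn hK0
  have hUK : U ⊆ Kᶜ := connectedComponentIn_subset _ _
  have hUR : U ⊆ Metric.ball 0 R := by
    intro q hq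
    by_contra hqR
    rw [mem_ball_zero_iff, not_lt] at hqR
    apply hlog
    have h1 := (log_quot hUo hUc h0U hq).mono (S := K) (fun z hz h => hUK h hz)
    have h2 := log_far hKR hqR hR
    refine (h1.mul h2).congr fun z hz => ?_
    have : z - q ≠ 0 := sub_ne_zero.2 (fun h => hUK hq (h ▸ hz))
    simp only [sub_zero]
    field_simp
  refine ⟨U, hUo, hUc, h0U, hUR, ?_, ?_⟩
  · have : C ∩ U = C ∩ closure U := by
      apply Subset.antisymm (inter_subset_inter_right _ subset_closure)
      rintro z ⟨hz, hzU⟩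
      exact ⟨hz, comp_closure hK.isClosed hzU (fun h => Set.disjoint_left.1 hKC hz h)⟩
    rw [this]
    exact hC.inter_right isClosed_closure
  · intro g hg hg0
    have hX : ∀ ε : ℝ, 0 < ε → HasLogOn g ((Uᶜ ∪ Metric.thickening ε K)ᶜ) := by
      intro ε hε
      have hsub : (Uᶜ ∪ Metric.thickening ε K)ᶜ ⊆ U := by
        intro z hz
        by_contra h
        exact hz (Or.inl h)
      have hcl : IsClosed ((Uᶜ ∪ Metric.thickening ε K)ᶜ) := by
        have : (Uᶜ ∪ Metric.thickening ε K)ᶜ = closure U ∩ (Metric.thickening ε K)ᶜ := by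
          ext z
          constructor
          · intro hz
            exact ⟨subset_closure (hsub hz), fun h => hz (Or.inr h)⟩
          · rintro ⟨h1, h2⟩ (h | h)
            · refine h (comp_closure hK.isClosed h1 fun hk => h2 (Metric.self_subset_thickening hε K hk))
            · exact h2 h
        rw [this]
        exact isClosed_closure.inter Metric.isOpen_thickening.isClosed_compl
      refine log_of_compl_conn (Metric.isCompact_of_isClosed_isBounded hcl
        (Metric.isBounded_ball.subset (hsub.trans hUR))) ?_ (hg.mono hsub) (fun z hz => hg0 z (hsub hz))
      rw [compl_compl]
      exact thick_conn hK hKp hKne 0 hε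
    have hX' : ∀ n : ℕ, HasLogOn g ((Uᶜ ∪ Metric.thickening (1 / (n + 1 : ℝ)) K)ᶜ) := fun n =>
      hX _ (by positivity)
    choose l hl1 hl2 using hX'
    apply sqrt_limit hUo hg hg0 (fun n z => Complex.exp (l n z / 2))
    intro z hz
    obtain ⟨r, hr, hrU⟩ := Metric.isOpen_iff.1 hUo z hz
    refine ⟨r / 2, by linarith, (Metric.ball_subset_ball (by linarith)).trans hrU, ?_⟩
    have hev : ∀ᶠ n : ℕ in atTop, 1 / ((n : ℝ) + 1) < r / 2 :=
      tendsto_one_div_add_atTop_nhds_zero_nat.eventually_lt_const (by linarith)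
    filter_upwards [hev] with n hn
    have hsub : Metric.ball z (r / 2) ⊆ (Uᶜ ∪ Metric.thickening (1 / (n + 1 : ℝ)) K)ᶜ := by
      rintro w hw (h | h)
      · exact h (hrU (Metric.ball_subset_ball (by linarith) hw))
      · obtain ⟨k, hk, hwk⟩ := Metric.mem_thickening_iff.1 h
        refine hUK (hrU ?_) hk
        rw [Metric.mem_ball] at hw ⊢
        have := dist_triangle k w z
        rw [dist_comm k w] at this
        linarith
    refine ⟨Complex.continuous_exp.comp_continuousOn (((hl1 n).mono hsub).div_const 2), fun w hw => ?_⟩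
    rw [← Complex.exp_nat_mul, ← hl2 n w (hsub hw)]
    congr 1
    push_cast; ring

end WDSAux
end

section
namespace WDSAux

theorem montel {U : Set ℂ} (hU : IsOpen U) {f : ℕ → ℂ → ℂ} (hd : ∀ n, DifferentiableOn ℂ (f n) U)
    (hm : ∀ n, MapsTo (f n) U (Metric.closedBall 0 1)) (F : Ultrafilter ℕ) :
    ∃ g : ℂ → ℂ, TendstoLocallyUniformlyOn f g F U ∧ MapsTo g U (Metric.closedBall 0 1) := by
  have hlim : ∀ z ∈ U, ∃ y ∈ Metric.closedBall (0:ℂ) 1, Tendsto (fun n => f n z) F (𝓝 y) := by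
    intro z hz
    have := (isCompact_closedBall (0:ℂ) 1).ultrafilter_le_nhds' (F.map fun n => f n z)
      (Ultrafilter.mem_map.2 (Filter.univ_mem' fun n => hm n hz))
    obtain ⟨y, hy, h⟩ := this
    exact ⟨y, hy, h⟩
  choose! g hg1 hg2 using hlim
  refine ⟨g, ?_, hg1⟩
  rw [Metric.tendstoLocallyUniformlyOn_iff]
  intro ε hε z hz
  obtain ⟨r, hr, hrU⟩ := Metric.isOpen_iff.1 hU z hz
  have hlip : ∀ w ∈ Metric.ball z r, ∀ n, dist (f n w) (f n z) ≤ 2 / r * dist w z := by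
    intro w hw n
    refine Complex.dist_le_div_mul_dist_of_mapsTo_ball ((hd n).mono hrU) ?_ hw
    intro v hv
    have h1 := hm n (hrU hv)
    have h2 := hm n hz
    rw [Metric.mem_closedBall] at h1 h2 ⊢
    have := dist_triangle_right (f n v) (f n z) 0
    linarith
  have hlipg : ∀ w ∈ Metric.ball z r, dist (g w) (g z) ≤ 2 / r * dist w z := by
    intro w hw
    exact le_of_tendsto ((hg2 w (hrU hw)).dist (hg2 z hz)) (Eventually.of_forall fun n => hlip w hw n)
  set δ := min r (ε * r / 8) with hδ
  have hδp : 0 < δ := lt_min hr (by positivity)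
  refine ⟨Metric.ball z δ, mem_nhdsWithin_of_mem_nhds (Metric.ball_mem_nhds z hδp), ?_⟩
  have := (Metric.tendsto_nhds.1 (hg2 z hz)) (ε / 2) (by linarith)
  filter_upwards [this] with n hn w hw
  have hwr : w ∈ Metric.ball z r := Metric.ball_subset_ball (min_le_left _ _) hw
  have hb : 2 / r * dist w z ≤ ε / 4 := by
    have : dist w z ≤ ε * r / 8 := (Metric.mem_ball.1 hw).le.trans (min_le_right _ _)
    calc 2 / r * dist w z ≤ 2 / r * (ε * r / 8) := by gcongr
      _ = ε / 4 := by field_simp; norm_num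
  have a1 := hlip w hwr n
  have a2 := hlipg w hwr
  have t1 := dist_triangle (g w) (g z) (f n w)
  have t2 := dist_triangle (g z) (f n z) (f n w)
  rw [dist_comm (f n z) (f n w)] at t2
  rw [dist_comm] at hn
  linarith

theorem hurwitz {U : Set ℂ} (hU : IsOpen U) (hc : IsPreconnected U) {f : ℕ → ℂ → ℂ}
    (hd : ∀ n, DifferentiableOn ℂ (f n) U) (hi : ∀ n, InjOn (f n) U) {F : Filter ℕ} [F.NeBot] {g : ℂ → ℂ}
    (hg : TendstoLocallyUniformlyOn f g F U) (hgn : ∃ x ∈ U, ∃ y ∈ U, g x ≠ g y) : InjOn g U := by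
  have hgd : DifferentiableOn ℂ g U := hg.differentiableOn (Eventually.of_forall hd) hU
  have hga : AnalyticOnNhd ℂ g U := hgd.analyticOnNhd hU
  intro a ha b hb hab
  by_contra hne
  have hev : ∀ᶠ z in 𝓝[≠] b, g z ≠ g b := by
    rcases (hga b hb).eventually_eq_or_eventually_ne analyticAt_const (g := fun _ => g b) with h | h
    · exfalso
      have := hga.eqOn_of_preconnected_of_eventuallyEq (g := fun _ => g b) analyticOnNhd_const hc hb h
      obtain ⟨x, hx, y, hy, hxy⟩ := hgn
      exact hxy ((this hx).trans (this hy).symm)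
    · exact h
  rw [eventually_nhdsWithin_iff, Metric.eventually_nhds_iff] at hev
  obtain ⟨r1, hr1, h1⟩ := hev
  obtain ⟨r2, hr2, h2⟩ := Metric.isOpen_iff.1 hU b hb
  have hab' : 0 < dist a b := dist_pos.2 hne
  set ρ := min (min r1 r2) (dist a b) / 2 with hρ
  have hm : 0 < min (min r1 r2) (dist a b) := lt_min (lt_min hr1 hr2) hab'
  have hρp : 0 < ρ := by positivity
  have hρ1 : ρ < r1 := by
    have : min (min r1 r2) (dist a b) ≤ r1 := (min_le_left _ _).trans (min_le_left _ _)
    linarith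
  have hρ2 : ρ < r2 := by
    have : min (min r1 r2) (dist a b) ≤ r2 := (min_le_left _ _).trans (min_le_right _ _)
    linarith
  have hρ3 : ρ < dist a b := by
    have : min (min r1 r2) (dist a b) ≤ dist a b := (min_le_right _ _)
    linarith
  have hcU : Metric.closedBall b ρ ⊆ U := (Metric.closedBall_subset_ball hρ2).trans h2
  have hsU : Metric.sphere b ρ ⊆ U := Metric.sphere_subset_closedBall.trans hcU
  obtain ⟨z0, hz0, hmin⟩ := (isCompact_sphere b ρ).exists_isMinOn
    (NormedSpace.sphere_nonempty.2 hρp.le) (f := fun z => ‖g z - g b‖)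
    ((hgd.continuousOn.mono hsU).sub continuousOn_const).norm
  set ε := ‖g z0 - g b‖ with hε
  have hεp : 0 < ε := by
    rw [hε, norm_pos_iff, sub_ne_zero]
    rw [Metric.mem_sphere] at hz0
    apply h1 (by rw [hz0]; exact hρ1)
    rintro rfl
    simp at hz0; linarith
  have hcomp : IsCompact (insert a (Metric.closedBall b ρ)) := (isCompact_closedBall b ρ).insert a
  have hu := (tendstoLocallyUniformlyOn_iff_forall_isCompact hU).1 hg _ (insert_subset ha hcU) hcomp
  obtain ⟨n, hn⟩ := (Metric.tendstoUniformlyOn_iff.1 hu (ε / 8) (by positivity)).exists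
  simp only [dist_eq_norm] at hn
  have hna := hn a (mem_insert _ _)
  have hnb := hn b (mem_insert_of_mem _ (Metric.mem_closedBall_self hρp.le))
  have hsph : ∀ z ∈ Metric.sphere b ρ, 3 * ε / 4 ≤ ‖f n z - f n b‖ := by
    intro z hz
    have h3 := hn z (mem_insert_of_mem _ (Metric.sphere_subset_closedBall hz))
    have h4 : ε ≤ ‖g z - g b‖ := hmin hz
    have h5 : g z - g b = (g z - f n z) + (f n z - f n b) - (g b - f n b) := by ring
    have h6 := norm_sub_le ((g z - f n z) + (f n z - f n b)) (g b - f n b)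
    have h7 := norm_add_le (g z - f n z) (f n z - f n b)
    rw [← h5] at h6
    linarith
  have hdc : DiffContOnCl ℂ (f n) (Metric.ball b ρ) := by
    apply DifferentiableOn.diffContOnCl
    rw [closure_ball _ hρp.ne']
    exact (hd n).mono hcU
  have hfr : ∃ᶠ z in 𝓝 b, f n z ≠ f n b := by
    have h8 : ∀ᶠ z in 𝓝[≠] b, f n z ≠ f n b := by
      rw [eventually_nhdsWithin_iff]
      filter_upwards [hU.mem_nhds hb] with z hz hzb h
      exact hzb (hi n hz hb h)
    exact h8.frequently.filter_mono nhdsWithin_le_nhds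
  have hsub := hdc.ball_subset_image_closedBall hρp hsph hfr
  have hmem : f n a ∈ Metric.ball (f n b) (3 * ε / 4 / 2) := by
    rw [Metric.mem_ball, dist_eq_norm]
    have : f n a - f n b = (g b - f n b) - (g a - f n a) := by rw [hab]; ring
    rw [this]
    have := norm_sub_le (g b - f n b) (g a - f n a)
    linarith
  obtain ⟨z, hz, hza⟩ := hsub hmem
  have := hi n (hcU hz) ha hza
  subst this
  exact absurd (Metric.mem_closedBall.1 hz) (not_le.2 hρ3)

end WDSAux
end

section
open scoped ComplexConjugate
namespace WDSAux

def mob (c w : ℂ) : ℂ := (w - c) / (1 - conj c * w)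

theorem mob_den {c w : ℂ} (hc : ‖c‖ < 1) (hw : ‖w‖ < 1) : 1 - conj c * w ≠ 0 := by
  intro h
  have h1 : conj c * w = 1 := (sub_eq_zero.1 h).symm
  have h2 : ‖conj c * w‖ = 1 := by rw [h1]; simp
  rw [norm_mul, Complex.norm_conj] at h2
  nlinarith [norm_nonneg c, norm_nonneg w]

theorem mob_lt {c w : ℂ} (hc : ‖c‖ < 1) (hw : ‖w‖ < 1) : ‖mob c w‖ < 1 := by
  rw [mob, norm_div, div_lt_one (norm_pos_iff.2 (mob_den hc hw))]
  rw [← sq_lt_sq₀ (norm_nonneg _) (norm_nonneg _), Complex.sq_norm, Complex.sq_norm]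
  have h1 : ‖c‖ ^ 2 < 1 := by nlinarith [norm_nonneg c]
  have h2 : ‖w‖ ^ 2 < 1 := by nlinarith [norm_nonneg w]
  rw [Complex.sq_norm, Complex.normSq_apply] at h1 h2
  rw [Complex.normSq_apply, Complex.normSq_apply]
  simp only [Complex.sub_re, Complex.sub_im, Complex.mul_re, Complex.mul_im, Complex.conj_re,
    Complex.conj_im, Complex.one_re, Complex.one_im]
  nlinarith [mul_pos (sub_pos.2 h1) (sub_pos.2 h2)]

theorem conj_mul_self' (c : ℂ) : conj c * c = ((‖c‖ ^ 2 : ℝ) : ℂ) := by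
  rw [mul_comm, Complex.mul_conj, Complex.sq_norm]

theorem mob_inj {c w v : ℂ} (hc : ‖c‖ < 1) (hw : ‖w‖ < 1) (hv : ‖v‖ < 1) (h : mob c w = mob c v) :
    w = v := by
  rw [mob, mob, div_eq_div_iff (mob_den hc hw) (mob_den hc hv)] at h
  have h1 : (w - v) * (1 - conj c * c) = 0 := by linear_combination h
  rcases mul_eq_zero.1 h1 with h2 | h2
  · exact sub_eq_zero.1 h2
  · exact absurd h2 (mob_den hc hc)

theorem mob_deriv {c w : ℂ} (hc : ‖c‖ < 1) (hw : ‖w‖ < 1) :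
    HasDerivAt (mob c) ((1 - conj c * c) / (1 - conj c * w) ^ 2) w := by
  have h1 : HasDerivAt (fun w => w - c) 1 w := (hasDerivAt_id w).sub_const c
  have h2 : HasDerivAt (fun w => 1 - conj c * w) (-(conj c * 1)) w :=
    ((hasDerivAt_id w).const_mul (conj c)).const_sub 1
  refine (h1.div h2 (mob_den hc hw)).congr_deriv ?_
  congr 1
  ring

structure Fam (U : Set ℂ) (f : ℂ → ℂ) : Prop where
  diff : DifferentiableOn ℂ f U
  inj : InjOn f U
  maps : MapsTo f U (Metric.ball 0 1)
  zero : f 0 = 0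

theorem koebe {U : Set ℂ} (hU : IsOpen U) (h0 : (0:ℂ) ∈ U)
    (hsq : ∀ g : ℂ → ℂ, ContinuousOn g U → (∀ z ∈ U, g z ≠ 0) →
        ∃ t : ℂ → ℂ, ContinuousOn t U ∧ ∀ z ∈ U, t z ^ 2 = g z)
    {f : ℂ → ℂ} (hf : Fam U f) (hd0 : deriv f 0 ≠ 0) {a : ℂ} (ha : ‖a‖ < 1) (haf : a ∉ f '' U) :
    ∃ f2, Fam U f2 ∧ ‖deriv f 0‖ < ‖deriv f2 0‖ := by
  have hfn : ∀ z ∈ U, ‖f z‖ < 1 := fun z hz => mem_ball_zero_iff.1 (hf.maps hz)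
  have hfd : ∀ z ∈ U, HasDerivAt f (deriv f z) z := fun z hz =>
    (hf.diff.differentiableAt (hU.mem_nhds hz)).hasDerivAt
  set p : ℂ → ℂ := fun z => mob a (f z) with hp
  have hpd : ∀ z ∈ U, HasDerivAt p ((1 - conj a * a) / (1 - conj a * f z) ^ 2 * deriv f z) z :=
    fun z hz => (mob_deriv ha (hfn z hz)).comp z (hfd z hz)
  have hp0 : ∀ z ∈ U, p z ≠ 0 := by
    intro z hz h
    rw [hp] at h
    simp only [mob] at h
    rcases div_eq_zero_iff.1 h with h | h
    · exact haf ⟨z, hz, sub_eq_zero.1 h⟩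
    · exact mob_den ha (hfn z hz) h
  obtain ⟨s, hs, hs2⟩ := hsq p (fun z hz => (hpd z hz).continuousAt.continuousWithinAt) hp0
  have hs0 : ∀ z ∈ U, s z ≠ 0 := fun z hz h => hp0 z hz (by rw [← hs2 z hz, h]; simp)
  have hsn : ∀ z ∈ U, ‖s z‖ < 1 := by
    intro z hz
    have := mob_lt ha (hfn z hz)
    change ‖p z‖ < 1 at this
    rw [← hs2 z hz, norm_pow] at this
    by_contra h
    nlinarith
  have hsd : ∀ z ∈ U, HasDerivAt s ((2 * s z)⁻¹ *
      ((1 - conj a * a) / (1 - conj a * f z) ^ 2 * deriv f z)) z := by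
    intro z hz
    -- local inverse of the square at `s z`
    have hst : HasStrictDerivAt (fun w : ℂ => w ^ 2) (2 * s z) (s z) := by
      simpa using hasStrictDerivAt_pow 2 (s z)
    have hne : (2 * s z) ≠ 0 := mul_ne_zero two_ne_zero (hs0 z hz)
    have hL := hst.to_localInverse hne
    have hev : ∀ᶠ w in 𝓝 (s z), hst.localInverse _ _ _ hne (w ^ 2) = w :=
      hst.eventually_left_inverse hne
    have hcomp : HasDerivAt (fun y => hst.localInverse _ _ _ hne (p y)) ((2 * s z)⁻¹ *
      ((1 - conj a * a) / (1 - conj a * f z) ^ 2 * deriv f z)) z := by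
      have h3 := hL.hasDerivAt
      simp only [hs2 z hz] at h3
      exact h3.comp z (hpd z hz)
    refine hcomp.congr_of_eventuallyEq ?_
    have hca : ContinuousAt s z := hs.continuousAt (hU.mem_nhds hz)
    filter_upwards [hca.eventually hev, hU.mem_nhds hz] with y hy hyU
    rw [← hs2 y hyU, hy]
  set b := s 0 with hb
  have hbn : ‖b‖ < 1 := hsn 0 h0
  have hb2 : b ^ 2 = -a := by
    rw [hb, hs2 0 h0, hp]; simp [mob, hf.zero]
  have hf2d : ∀ z ∈ U, HasDerivAt (fun z => mob b (s z)) ((1 - conj b * b) / (1 - conj b * s z) ^ 2 *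
      ((2 * s z)⁻¹ * ((1 - conj a * a) / (1 - conj a * f z) ^ 2 * deriv f z))) z :=
    fun z hz => (mob_deriv hbn (hsn z hz)).comp z (hsd z hz)
  refine ⟨fun z => mob b (s z), ⟨fun z hz => (hf2d z hz).differentiableAt.differentiableWithinAt, ?_, ?_, ?_⟩, ?_⟩
  · intro z hz w hw h
    have h1 := mob_inj hbn (hsn z hz) (hsn w hw) h
    have h2 : p z = p w := by rw [← hs2 z hz, ← hs2 w hw, h1]
    exact hf.inj hz hw (mob_inj ha (hfn z hz) (hfn w hw) h2)
  · intro z hz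
    exact mem_ball_zero_iff.2 (mob_lt hbn (hsn z hz))
  · simp [mob, hb]
  · rw [(hf2d 0 h0).deriv, hf.zero, ← hb]
    have hb0 : b ≠ 0 := hs0 0 h0
    have hden := mob_den hbn hbn
    have haa : conj a * a = (conj b * b) ^ 2 := by
      have : a = - b ^ 2 := by rw [hb2]; ring
      rw [this]; simp; ring
    have e : (1 - conj b * b) / (1 - conj b * b) ^ 2 *
      ((2 * b)⁻¹ * ((1 - conj a * a) / (1 - conj a * 0) ^ 2 * deriv f 0)) =
      (1 + conj b * b) / (2 * b) * deriv f 0 := by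
      rw [haa]; field_simp; ring
    rw [e, norm_mul, norm_div, conj_mul_self']
    have h1 : ‖(1:ℂ) + ((‖b‖ ^ 2 : ℝ) : ℂ)‖ = 1 + ‖b‖ ^ 2 := by
      have : (1:ℂ) + ((‖b‖ ^ 2 : ℝ) : ℂ) = ((1 + ‖b‖ ^ 2 : ℝ) : ℂ) := by push_cast; ring
      rw [this, Complex.norm_real, Real.norm_of_nonneg (by positivity)]
    rw [h1, norm_mul, Complex.norm_ofNat]
    have hbp : 0 < ‖b‖ := norm_pos_iff.2 hb0
    have hdp : 0 < ‖deriv f 0‖ := norm_pos_iff.2 hd0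
    have : 1 < (1 + ‖b‖ ^ 2) / (2 * ‖b‖) := by
      rw [lt_div_iff₀ (by positivity)]
      nlinarith [sq_pos_of_pos (sub_pos.2 hbn)]
    nlinarith

end WDSAux
end

section
namespace WDSAux

theorem nonconst_open {U : Set ℂ} (hU : IsOpen U) (hc : IsPreconnected U) {f : ℂ → ℂ}
    (hd : DifferentiableOn ℂ f U) (hn : ∃ x ∈ U, ∃ y ∈ U, f x ≠ f y) :
    ∀ s ⊆ U, IsOpen s → IsOpen (f '' s) := by
  rcases (hd.analyticOnNhd hU).is_constant_or_isOpen hc with h | h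
  · obtain ⟨w, hw⟩ := h
    obtain ⟨x, hx, y, hy, hxy⟩ := hn
    exact absurd ((hw x hx).trans (hw y hy).symm) hxy
  · exact h

theorem nonconst_of_deriv {U : Set ℂ} (hU : IsOpen U) (h0 : (0:ℂ) ∈ U) {f : ℂ → ℂ} (h : deriv f 0 ≠ 0) :
    ∃ x ∈ U, ∃ y ∈ U, f x ≠ f y := by
  by_contra hcon
  push Not at hcon
  apply h
  have : f =ᶠ[𝓝 0] fun _ => f 0 := by
    filter_upwards [hU.mem_nhds h0] with z hz using hcon z hz 0 h0
  rw [this.deriv_eq]; simp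

theorem rmt_map {U : Set ℂ} (hU : IsOpen U) (hc : IsPreconnected U) (h0 : (0:ℂ) ∈ U) {R : ℝ}
    (hR : 0 < R) (hUR : U ⊆ Metric.ball 0 R)
    (hsq : ∀ g : ℂ → ℂ, ContinuousOn g U → (∀ z ∈ U, g z ≠ 0) →
        ∃ t : ℂ → ℂ, ContinuousOn t U ∧ ∀ z ∈ U, t z ^ 2 = g z) :
    ∃ f : ℂ → ℂ, Fam U f ∧ (deriv f 0 ≠ 0) ∧ f '' U = Metric.ball 0 1 := by
  obtain ⟨r, hr, hrU⟩ := Metric.isOpen_iff.1 hU 0 h0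
  set S : Set ℝ := {x | ∃ f, Fam U f ∧ x = ‖deriv f 0‖} with hS
  have hRc : (R : ℂ) ≠ 0 := by exact_mod_cast hR.ne'
  have hmem : Fam U (fun z => z / R) := by
    refine ⟨by fun_prop, ?_, ?_, by simp⟩
    · intro x _ y _ h
      simpa [hRc] using h
    · intro z hz
      have := hUR hz
      rw [mem_ball_zero_iff] at this ⊢
      rw [norm_div, Complex.norm_real, Real.norm_of_nonneg hR.le, div_lt_one hR]
      exact this
  have hdm : deriv (fun z : ℂ => z / R) 0 = 1 / R := by simp
  have hne : S.Nonempty := ⟨_, _, hmem, rfl⟩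
  have hbd : BddAbove S := by
    refine ⟨1 / r, ?_⟩
    rintro _ ⟨f, hf, rfl⟩
    refine Complex.norm_deriv_le_div_of_mapsTo_ball (hf.diff.mono hrU) ?_ hr
    rw [hf.zero]
    intro z hz
    exact Metric.ball_subset_closedBall (hf.maps (hrU hz))
  obtain ⟨u, -, hu, huS⟩ := exists_seq_tendsto_sSup hne hbd
  choose f hf hfu using huS
  have hpos : 0 < sSup S := by
    have : ‖deriv (fun z : ℂ => z / R) 0‖ ≤ sSup S := le_csSup hbd ⟨_, hmem, rfl⟩
    refine lt_of_lt_of_le ?_ this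
    rw [hdm, norm_pos_iff]
    exact one_div_ne_zero hRc
  let F : Ultrafilter ℕ := Ultrafilter.of atTop
  have hF : (F : Filter ℕ) ≤ atTop := Ultrafilter.of_le atTop
  obtain ⟨g, hg, hgm⟩ := montel hU (fun n => (hf n).diff)
    (fun n z hz => Metric.ball_subset_closedBall ((hf n).maps hz)) F
  have hgd : DifferentiableOn ℂ g U := hg.differentiableOn (Eventually.of_forall fun n => (hf n).diff) hU
  have hder := (hg.deriv (Eventually.of_forall fun n => (hf n).diff) hU).tendsto_at h0
  have hnorm : ‖deriv g 0‖ = sSup S := by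
    refine tendsto_nhds_unique hder.norm ?_
    refine (hu.mono_left hF).congr fun n => ?_
    rw [hfu n]; rfl
  have hd0 : deriv g 0 ≠ 0 := by
    rw [← norm_pos_iff, hnorm]; exact hpos
  have hnc := nonconst_of_deriv hU h0 hd0
  have hinj := hurwitz hU hc (fun n => (hf n).diff) (fun n => (hf n).inj) hg hnc
  have hopen := nonconst_open hU hc hgd hnc
  have hgz : g 0 = 0 := by
    refine tendsto_nhds_unique (hg.tendsto_at h0) ?_
    simp only [(hf _).zero]
    exact tendsto_const_nhds
  have hmaps : MapsTo g U (Metric.ball 0 1) := by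
    have h1 : g '' U ⊆ Metric.closedBall 0 1 := hgm.image_subset
    have h2 := interior_maximal h1 (hopen U Subset.rfl hU)
    rw [interior_closedBall _ one_ne_zero] at h2
    exact fun z hz => h2 ⟨z, hz, rfl⟩
  have hfam : Fam U g := ⟨hgd, hinj, hmaps, hgz⟩
  refine ⟨g, hfam, hd0, Subset.antisymm hmaps.image_subset ?_⟩
  intro a ha
  by_contra hag
  obtain ⟨f2, hf2, hlt⟩ := koebe hU h0 hsq hfam hd0 (mem_ball_zero_iff.1 ha) hag
  have : ‖deriv f2 0‖ ≤ sSup S := le_csSup hbd ⟨_, hf2, rfl⟩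
  linarith

theorem rmt {U : Set ℂ} (hU : IsOpen U) (hc : IsPreconnected U) (h0 : (0:ℂ) ∈ U) {R : ℝ}
    (hR : 0 < R) (hUR : U ⊆ Metric.ball 0 R)
    (hsq : ∀ g : ℂ → ℂ, ContinuousOn g U → (∀ z ∈ U, g z ≠ 0) →
        ∃ t : ℂ → ℂ, ContinuousOn t U ∧ ∀ z ∈ U, t z ^ 2 = g z) :
    ∃ d : ℂ → ℂ, IsOpenEmbedding d ∧ range d = U := by
  obtain ⟨f, hf, hd0, him⟩ := rmt_map hU hc h0 hR hUR hsq
  have hopen := nonconst_open hU hc hf.diff (nonconst_of_deriv hU h0 hd0)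
  set i : U → ℂ := fun z => f z with hi
  have hio : IsOpenEmbedding i := by
    apply IsOpenEmbedding.of_continuous_injective_isOpenMap
    · exact continuousOn_iff_continuous_domRestrict.1 hf.diff.continuousOn
    · intro x y hxy
      exact Subtype.ext (hf.inj x.2 y.2 hxy)
    · intro V hV
      have : i '' V = f '' (Subtype.val '' V) := by rw [image_image]
      rw [this]
      exact hopen _ (by rintro _ ⟨x, _, rfl⟩; exact x.2) (hU.isOpenMap_subtype_val V hV)
  obtain ⟨δ, hδ, hδr, -⟩ := disc_ball 0 1 one_pos
  have hri : range i = range δ := by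
    rw [hδr, ← him]
    ext w; constructor
    · rintro ⟨x, rfl⟩; exact ⟨x, x.2, rfl⟩
    · rintro ⟨x, hx, rfl⟩; exact ⟨⟨x, hx⟩, rfl⟩
  let e : ℂ ≃ₜ U := hδ.toIsEmbedding.toHomeomorph.trans
    ((Homeomorph.setCongr hri.symm).trans hio.toIsEmbedding.toHomeomorph.symm)
  refine ⟨fun z => (e z : ℂ), hU.isOpenEmbedding_subtypeVal.comp e.isOpenEmbedding, ?_⟩
  ext w; constructor
  · rintro ⟨x, rfl⟩; exact (e x).2
  · intro hw; exact ⟨e.symm ⟨w, hw⟩, by simp⟩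

/-- small planar discs whose boundary avoids a totally disconnected compact set -/
theorem good_disc_planar {C : Set ℂ} (hC : IsCompact C) (htd : IsTotallyDisconnected C) {R : ℝ}
    (hR : 0 < R) : ∃ d : ℂ → ℂ, IsOpenEmbedding d ∧ (0:ℂ) ∈ range d ∧ range d ⊆ Metric.ball 0 R ∧
      IsCompact (C ∩ range d) := by
  obtain ⟨U, h1, h2, h3, h4, h5, h6⟩ := good_planar hC htd hR
  obtain ⟨d, hd, hr⟩ := rmt h1 h2 h3 hR h4 h6
  exact ⟨d, hd, hr ▸ h3, hr ▸ h4, hr ▸ h5⟩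

end WDSAux
end

section
namespace WDSAux

theorem good_disc {M : Type*} [TopologicalSpace M] [T2Space M] (hM : Surf M) {C : Set M}
    (hC : IsCompact C) (htd : IsTotallyDisconnected C) (p : M) {W : Set M} (hW : W ∈ 𝓝 p) :
    ∃ d : ℂ → M, IsOpenEmbedding d ∧ p ∈ range d ∧ range d ⊆ W ∧ IsCompact (C ∩ range d) := by
  obtain ⟨d0, h1, h2, h3⟩ := hM p W hW
  set C1 := d0 ⁻¹' C ∩ Metric.closedBall 0 1 with hC1
  have hC1c : IsCompact C1 :=
    (isCompact_closedBall (0:ℂ) 1).inter_left (hC.isClosed.preimage h1.continuous)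
  have hC1t : IsTotallyDisconnected C1 := fun t ht =>
    td_preimage h1.continuous h1.injective htd t (ht.trans inter_subset_left)
  obtain ⟨d1, g1, ⟨z0, hz0⟩, g3, g4⟩ := good_disc_planar hC1c hC1t one_pos
  refine ⟨d0 ∘ d1, h1.comp g1, ⟨z0, by simp [hz0, h3]⟩, (range_comp_subset_range d1 d0).trans h2, ?_⟩
  have : C ∩ range (d0 ∘ d1) = d0 '' (C1 ∩ range d1) := by
    ext m; constructor
    · rintro ⟨hm, ⟨z, rfl⟩⟩
      exact ⟨d1 z, ⟨⟨hm, Metric.ball_subset_closedBall (g3 ⟨z, rfl⟩)⟩, ⟨z, rfl⟩⟩, rfl⟩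
    · rintro ⟨_, ⟨⟨h, -⟩, ⟨z, rfl⟩⟩, rfl⟩
      exact ⟨h, ⟨z, rfl⟩⟩
  rw [this]
  exact g4.image h1.continuous

theorem idoff_symm {M : Type*} [TopologicalSpace M] {O : Set M} {Φ : M ≃ₜ M} (h : ∀ m ∉ O, Φ m = m) :
    ∀ m ∉ O, Φ.symm m = m := fun m hm => by
  rw [Homeomorph.symm_apply_eq, h m hm]

theorem idoff_maps {M : Type*} [TopologicalSpace M] {O : Set M} {Φ : M ≃ₜ M} (h : ∀ m ∉ O, Φ m = m) :
    ∀ m, Φ m ∈ O ↔ m ∈ O := fun m => by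
  constructor
  · intro h1
    by_contra h2
    rw [h m h2] at h1; exact h2 h1
  · intro h1
    by_contra h2
    have := h _ h2
    rw [Φ.injective this] at h2
    exact h2 h1

theorem drag {M : Type*} [TopologicalSpace M] [T2Space M] (hM : Surf M) {O : Set M} (hO : IsOpen O)
    (hc : IsPreconnected O) {x y : M} (hx : x ∈ O) (hy : y ∈ O) :
    ∃ Φ : M ≃ₜ M, (∀ m ∉ O, Φ m = m) ∧ Φ x = y := by
  refine hc.induction₂' (fun x y => ∃ Φ : M ≃ₜ M, (∀ m ∉ O, Φ m = m) ∧ Φ x = y) ?_ ?_ hx hy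
  · intro x hx
    obtain ⟨d, h1, h2, h3⟩ := hM x O (hO.mem_nhds hx)
    have hn : range d ∈ 𝓝 x := h1.isOpen_range.mem_nhds ⟨0, h3⟩
    filter_upwards [mem_nhdsWithin_of_mem_nhds hn] with y hy
    obtain ⟨v, rfl⟩ := hy
    obtain ⟨ψ, hψ1, hψ2⟩ := move (‖v‖ + 1) v (by linarith)
    obtain ⟨Φ, hΦ1, hΦ2⟩ := ext_homeo d h1 ψ _ hψ1
    have hoff : ∀ m ∉ O, Φ m = m := fun m hm => hΦ2 m (fun h => hm (h2 (image_subset_range _ _ h)))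
    have he : Φ x = d v := by rw [← h3, hΦ1, hψ2]
    refine ⟨⟨Φ, hoff, he⟩, ⟨Φ.symm, idoff_symm hoff, ?_⟩⟩
    rw [Homeomorph.symm_apply_eq, he]
  · rintro x y z hx hy hz ⟨Φ, h1, h2⟩ ⟨Ψ, h3, h4⟩
    refine ⟨Φ.trans Ψ, fun m hm => ?_, ?_⟩
    · simp [h1 m hm, h3 m hm]
    · simp [h2, h4]

theorem squeeze_in {M : Type*} [TopologicalSpace M] [T2Space M] {d : ℂ → M} (hd : IsOpenEmbedding d)
    {Q : Set M} (hQ : IsCompact Q) (hQd : Q ⊆ range d) {c : M} (hc : c ∈ range d) {N : Set M} (hN : N ∈ 𝓝 c) :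
    ∃ Φ : M ≃ₜ M, (∀ m ∉ range d, Φ m = m) ∧ ∀ m ∈ Q, Φ m ∈ N := by
  obtain ⟨c0, rfl⟩ := hc
  set d' : ℂ → M := fun z => d (z + c0) with hd'
  have hd1 : IsOpenEmbedding d' := hd.comp (Homeomorph.addRight c0).isOpenEmbedding
  have hr : range d' = range d := (Homeomorph.addRight c0).surjective.range_comp d
  have hpc : IsCompact (d' ⁻¹' Q) := by
    rw [hd1.toIsInducing.isCompact_iff, image_preimage_eq_inter_range, hr, inter_eq_left.2 hQd]
    exact hQ
  obtain ⟨R, hR⟩ := hpc.isBounded.subset_closedBall 0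
  have hNn : d' ⁻¹' N ∈ 𝓝 0 := hd1.continuous.continuousAt (by simpa [hd'] using hN)
  obtain ⟨ρ, hρ, hρN⟩ := Metric.mem_nhds_iff.1 hNn
  obtain ⟨ψ, hψ1, hψ2⟩ := squeeze (max R 1) ρ (lt_of_lt_of_le one_pos (le_max_right _ _)) hρ
  obtain ⟨Φ, hΦ1, hΦ2⟩ := ext_homeo d' hd1 ψ _ hψ1
  refine ⟨Φ, fun m hm => hΦ2 m fun h => hm (hr ▸ image_subset_range _ _ h), ?_⟩
  intro m hm
  have : m ∈ range d' := hr ▸ hQd hm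
  obtain ⟨z, rfl⟩ := this
  rw [hΦ1]
  apply hρN
  rw [mem_ball_zero_iff]
  apply hψ2
  exact (mem_closedBall_zero_iff.1 (hR hm)).trans (le_max_left _ _)

theorem two_disc {M : Type*} [TopologicalSpace M] [T2Space M] [PreconnectedSpace M] (hM : Surf M)
    {d1 d2 : ℂ → M} (h1 : IsOpenEmbedding d1) (h2 : IsOpenEmbedding d2) {C1 C2 : Set M}
    (hC1 : IsCompact C1) (hC2 : IsCompact C2) (ht : IsTotallyDisconnected C2) (hC1d : C1 ⊆ range d1)
    (hC2d : C2 ⊆ range d2) (hdisj : Disjoint C2 (range d1)) :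
    ∃ d : ℂ → M, IsOpenEmbedding d ∧ C1 ∪ C2 ⊆ range d := by
  have hpre := hM.diff_preconn hC2.isClosed ht isOpen_univ isPreconnected_univ
  obtain ⟨y, hy1, hy2⟩ := hM.diff_nonempty ht h2.isOpen_range (range_nonempty d2)
  have hc : d1 0 ∉ C2 := fun h => Set.disjoint_left.1 hdisj h ⟨0, rfl⟩
  obtain ⟨t, ht1, ht2⟩ := drag hM (isOpen_univ.sdiff hC2.isClosed) hpre ⟨mem_univ _, hc⟩ ⟨mem_univ y, hy2⟩
  have hN : t ⁻¹' range d2 ∈ 𝓝 (d1 0) :=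
    t.continuous.continuousAt (h2.isOpen_range.mem_nhds (by rw [ht2]; exact hy1))
  obtain ⟨s, hs1, hs2⟩ := squeeze_in h1 hC1 hC1d ⟨0, rfl⟩ hN
  refine ⟨(s.trans t).symm ∘ d2, (s.trans t).symm.isOpenEmbedding.comp h2, ?_⟩
  have key : ∀ x, t (s x) ∈ range d2 → x ∈ range ((s.trans t).symm ∘ d2) := by
    rintro x ⟨z, hz⟩
    refine ⟨z, ?_⟩
    simp only [Function.comp_apply]
    rw [Homeomorph.symm_apply_eq, hz]; rfl
  rintro x (hx | hx)
  · exact key x (hs2 x hx)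
  · apply key
    rw [hs1 x (Set.disjoint_left.1 hdisj hx), ht1 x (fun h => h.2 hx)]
    exact hC2d hx

theorem engulf {M : Type*} [TopologicalSpace M] [T2Space M] [ConnectedSpace M] (hM : Surf M)
    {C : Set M} (hC : IsCompact C) (ht : IsTotallyDisconnected C) :
    ∃ d : ℂ → M, IsOpenEmbedding d ∧ C ⊆ range d := by
  classical
  choose d hd1 hd2 hd3 hd4 using fun p : M => good_disc hM hC ht p (W := univ) univ_mem
  have key : ∀ s : Finset M, ∀ C : Set M, IsCompact C → IsTotallyDisconnected C →
      C ⊆ ⋃ i ∈ s, range (d i) → (∀ i ∈ s, IsCompact (C ∩ range (d i))) →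
      ∃ d : ℂ → M, IsOpenEmbedding d ∧ C ⊆ range d := by
    intro s
    induction s using Finset.induction_on with
    | empty =>
      intro C _ _ h _
      obtain ⟨m⟩ := (inferInstance : Nonempty M)
      exact ⟨d m, hd1 m, fun x hx => by simpa using h hx⟩
    | insert a s _ ih =>
      intro C hC ht hcov hgood
      have hC2 : IsCompact (C \ range (d a)) := hC.diff (hd1 a).isOpen_range
      have ht2 : IsTotallyDisconnected (C \ range (d a)) := fun t h => ht t (h.trans sdiff_subset)
      obtain ⟨d', h1, h2⟩ := ih _ hC2 ht2 (by
        intro x hx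
        have := hcov hx.1
        simp only [Finset.mem_insert, iUnion_iUnion_eq_or_left, mem_union] at this
        exact this.resolve_left hx.2) (by
        intro i hi
        have : (C \ range (d a)) ∩ range (d i) = (C ∩ range (d i)) \ range (d a) := by
          ext x; constructor
          · rintro ⟨⟨a, b⟩, c⟩; exact ⟨⟨a, c⟩, b⟩
          · rintro ⟨⟨a, b⟩, c⟩; exact ⟨⟨a, c⟩, b⟩
        rw [this]
        exact (hgood i (Finset.mem_insert_of_mem hi)).diff (hd1 a).isOpen_range)
      obtain ⟨e, he, hce⟩ := two_disc hM (hd1 a) h1 (hgood a (Finset.mem_insert_self _ _)) hC2 ht2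
        inter_subset_right h2 (Set.disjoint_left.2 fun x hx => hx.2)
      refine ⟨e, he, fun x hx => hce ?_⟩
      by_cases h : x ∈ range (d a)
      · exact Or.inl ⟨hx, h⟩
      · exact Or.inr ⟨hx, h⟩
  obtain ⟨s, -, hs⟩ := hC.elim_nhds_subcover (fun p => range (d p)) (fun p _ => (hd1 p).isOpen_range.mem_nhds (hd2 p))
  exact key s C hC ht hs fun i _ => hd4 i

theorem engulf_in {M : Type*} [TopologicalSpace M] [T2Space M] (hM : Surf M) {O : Set M} (hO : IsOpen O)
    (hc : IsPreconnected O) (hne : O.Nonempty)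
    {C : Set M} (hC : IsCompact C) (ht : IsTotallyDisconnected C) (hCO : C ⊆ O) :
    ∃ d : ℂ → M, IsOpenEmbedding d ∧ C ⊆ range d ∧ range d ⊆ O := by
  have : ConnectedSpace O := isConnected_iff_connectedSpace.1 ⟨hne, hc⟩
  have hC' : IsCompact (Subtype.val ⁻¹' C : Set O) := by
    rw [Subtype.isCompact_iff, Subtype.image_preimage_coe, inter_eq_right.2 hCO]
    exact hC
  obtain ⟨d, h1, h2⟩ := engulf (hM.subtype hO) hC'
    (td_preimage continuous_subtype_val Subtype.val_injective ht)
  refine ⟨fun z => d z, hO.isOpenEmbedding_subtypeVal.comp h1, ?_, ?_⟩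
  · intro x hx
    obtain ⟨z, hz⟩ := h2 (show (⟨x, hCO hx⟩ : O) ∈ _ from hx)
    exact ⟨z, by simp [hz]⟩
  · rintro _ ⟨z, rfl⟩
    exact (d z).2

theorem drag_finite {M : Type*} [TopologicalSpace M] [T2Space M] (hM : Surf M) {O : Set M} (hO : IsOpen O)
    (hc : IsPreconnected O) {A : Set M} (hA : A.Infinite) (hAO : A ⊆ O) (P : Finset M) (hP : ↑P ⊆ O) :
    ∃ Φ : M ≃ₜ M, (∀ m ∉ O, Φ m = m) ∧ ∀ p ∈ P, Φ p ∈ A := by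
  classical
  induction P using Finset.induction_on with
  | empty => exact ⟨Homeomorph.refl M, fun _ _ => rfl, by simp⟩
  | insert p P hp ih =>
    obtain ⟨Φ, h1, h2⟩ := ih (fun x hx => hP (by simpa using Or.inr hx))
    set S : Set M := Φ '' P with hS
    have hSf : S.Finite := P.finite_toSet.image _
    obtain ⟨a, haA, haS⟩ := (hA.diff hSf).nonempty
    have hpS : Φ p ∉ S := by
      rintro ⟨q, hq, hqp⟩
      exact hp (by rw [← Φ.injective hqp]; exact hq)
    have hpre := hM.diff_preconn hSf.isClosed (fun t hts htp => by
      by_contra h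
      exact (htp.infinite_of_nontrivial (Set.not_subsingleton_iff.1 h)) (hSf.subset hts)) hO hc
    obtain ⟨Ψ, h3, h4⟩ := drag hM (hO.sdiff hSf.isClosed) hpre
      (x := Φ p) (y := a) ⟨(idoff_maps h1 p).2 (hP (by simp)), hpS⟩ ⟨hAO haA, haS⟩
    refine ⟨Φ.trans Ψ, fun m hm => ?_, ?_⟩
    · simp only [Homeomorph.trans_apply, h1 m hm]
      exact h3 m fun h => hm h.1
    · intro q hq
      simp only [Homeomorph.trans_apply]
      rcases Finset.mem_insert.1 hq with rfl | hq
      · rw [h4]; exact haA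
      · rw [h3 _ (fun h => h.2 ⟨q, hq, rfl⟩)]
        exact h2 q hq

end WDSAux
end

section
namespace WDSAux

theorem drag_family {M ι : Type*} [TopologicalSpace M] [T2Space M] (hM : Surf M) {O : ι → Set M}
    (hO : ∀ i, IsOpen (O i)) (hc : ∀ i, IsPreconnected (O i))
    (hdis : ∀ i j m, m ∈ O i → m ∈ O j → i = j) {A : Set M}
    (hA : ∀ i, (A ∩ O i).Infinite) (P : Finset M) (hP : ∀ p ∈ P, ∃ i, p ∈ O i) :
    ∃ Φ : M ≃ₜ M, (∀ m, (∀ i, m ∉ O i) → Φ m = m) ∧ (∀ i m, Φ m ∈ O i ↔ m ∈ O i) ∧ ∀ p ∈ P, Φ p ∈ A := by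
  classical
  induction P using Finset.induction_on with
  | empty => exact ⟨Homeomorph.refl M, fun _ _ => rfl, fun _ _ => Iff.rfl, by simp⟩
  | insert p P hp ih =>
    obtain ⟨Φ, h1, h1', h2⟩ := ih (fun x hx => hP x (Finset.mem_insert_of_mem hx))
    obtain ⟨i, hi⟩ := hP p (Finset.mem_insert_self _ _)
    set S : Set M := Φ '' P with hS
    have hSf : S.Finite := P.finite_toSet.image _
    obtain ⟨a, ⟨haA, haO⟩, haS⟩ := ((hA i).diff hSf).nonempty
    have hpS : Φ p ∉ S := by
      rintro ⟨q, hq, hqp⟩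
      exact hp (by rw [← Φ.injective hqp]; exact hq)
    have hpre := hM.diff_preconn hSf.isClosed (fun t hts htp => by
      by_contra h
      exact (htp.infinite_of_nontrivial (Set.not_subsingleton_iff.1 h)) (hSf.subset hts)) (hO i) (hc i)
    obtain ⟨Ψ, h3, h4⟩ := drag hM ((hO i).sdiff hSf.isClosed) hpre
      (x := Φ p) (y := a) ⟨(h1' i p).2 hi, hpS⟩ ⟨haO, haS⟩
    have h3' : ∀ m ∉ O i, Ψ m = m := fun m hm => h3 m fun h => hm h.1
    have h5 := idoff_maps h3'
    refine ⟨Φ.trans Ψ, fun m hm => ?_, ?_, ?_⟩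
    · simp only [Homeomorph.trans_apply, h1 m hm]
      exact h3' m (hm i)
    · intro j m
      simp only [Homeomorph.trans_apply]
      rw [← h1' j m]
      by_cases hij : Φ m ∈ O i
      · constructor
        · intro h
          have := hdis _ _ _ h ((h5 _).2 hij)
          rw [this]; exact hij
        · intro h
          have := hdis _ _ _ h hij
          rw [this]; exact (h5 _).2 hij
      · rw [h3' _ hij]
    · intro q hq
      simp only [Homeomorph.trans_apply]
      rcases Finset.mem_insert.1 hq with rfl | hq
      · rw [h4]; exact haA
      · rw [h3 _ (fun h => h.2 ⟨q, hq, rfl⟩)]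
        exact h2 q hq

theorem glue_homeos {M : Type*} [TopologicalSpace M] (𝒩 : Finset (Set M))
    (hdis : ∀ N ∈ 𝒩, ∀ N' ∈ 𝒩, N ≠ N' → Disjoint N N') (s : Set M → (M ≃ₜ M))
    (hs : ∀ N ∈ 𝒩, ∀ m ∉ N, s N m = m) :
    ∃ Φ : M ≃ₜ M, (∀ m, (∀ N ∈ 𝒩, m ∉ N) → Φ m = m) ∧ ∀ N ∈ 𝒩, ∀ m ∈ N, Φ m = s N m := by
  classical
  induction 𝒩 using Finset.induction_on with
  | empty => exact ⟨Homeomorph.refl M, fun _ _ => rfl, by simp⟩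
  | insert N 𝒩 hN ih =>
    obtain ⟨Φ, h1, h2⟩ := ih (fun A hA B hB => hdis A (Finset.mem_insert_of_mem hA) B (Finset.mem_insert_of_mem hB))
      (fun A hA => hs A (Finset.mem_insert_of_mem hA))
    refine ⟨Φ.trans (s N), ?_, ?_⟩
    · intro m hm
      simp only [Homeomorph.trans_apply]
      rw [h1 m fun A hA => hm A (Finset.mem_insert_of_mem hA), hs N (Finset.mem_insert_self _ _) m
        (hm N (Finset.mem_insert_self _ _))]
    · intro A hA m hm
      simp only [Homeomorph.trans_apply]
      rcases Finset.mem_insert.1 hA with rfl | hA'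
      · rw [h1 m]
        intro B hB hmB
        have hne : A ≠ B := by rintro rfl; exact hN hB
        exact Set.disjoint_left.1 (hdis A (Finset.mem_insert_self _ _) B (Finset.mem_insert_of_mem hB) hne) hm hmB
      · rw [h2 A hA' m hm]
        apply hs N (Finset.mem_insert_self _ _)
        have hne : A ≠ N := by rintro rfl; exact hN hA'
        exact Set.disjoint_left.1 (hdis A hA N (Finset.mem_insert_self _ _) hne)
          ((idoff_maps (hs A hA) m).2 hm)

theorem small_nbds {Q : Set ℂ} (hQ : IsCompact Q) (ht : IsTotallyDisconnected Q) {ι : Type*} (U : ι → Set ℂ)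
    (hU : ∀ i, IsOpen (U i)) (hcov : ∀ q ∈ Q, ∃ i, q ∈ U i) :
    ∃ 𝒩 : Finset (Set ℂ), (∀ N ∈ 𝒩, IsOpen N ∧ IsPreconnected N ∧ N.Nonempty ∧ ∃ i, N ⊆ U i) ∧
      (∀ N ∈ 𝒩, ∀ N' ∈ 𝒩, N ≠ N' → Disjoint N N') ∧ ∀ q ∈ Q, ∃ N ∈ 𝒩, q ∈ N := by
  classical
  have : CompactSpace Q := isCompact_iff_compactSpace.1 hQ
  have : TotallyDisconnectedSpace Q := (totallyDisconnectedSpace_subtype_iff).2 ht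
  obtain ⟨s, hs, hsU⟩ := td_selector (fun i => (Subtype.val ⁻¹' U i : Set Q))
    (fun i => (hU i).preimage continuous_subtype_val) (fun y => hcov y y.2)
  obtain ⟨η, hη, hleb⟩ := lebesgue_number_lemma_of_metric (s := (univ : Set Q)) isCompact_univ
    (c := fun i => s ⁻¹' {i}) (fun i => hs.isOpen_fiber i) (fun y _ => by simp)
  have hclose : ∀ q q' : Q, dist q q' < η → s q = s q' := by
    intro q q' h
    obtain ⟨i, hi⟩ := hleb q (mem_univ _)
    have h1 : s q = i := hi (Metric.mem_ball_self hη)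
    have h2 : s q' = i := hi (by rwa [Metric.mem_ball, dist_comm])
    rw [h1, h2]
  set G : ι → Set ℂ := fun i => (⋃ q : Q, ⋃ _ : s q = i, Metric.ball (q : ℂ) (η / 2)) ∩ U i with hG
  have hGo : ∀ i, IsOpen (G i) := fun i =>
    (isOpen_iUnion fun q => isOpen_iUnion fun _ => Metric.isOpen_ball).inter (hU i)
  have hGd : ∀ i j x, x ∈ G i → x ∈ G j → i = j := by
    rintro i j x ⟨hi, -⟩ ⟨hj, -⟩
    simp only [mem_iUnion] at hi hj
    obtain ⟨q, rfl, hq⟩ := hi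
    obtain ⟨q', rfl, hq'⟩ := hj
    apply hclose
    rw [Metric.mem_ball] at hq hq'
    have := dist_triangle_left (q : ℂ) q' x
    rw [Subtype.dist_eq]
    linarith
  set N : ℂ → Set ℂ := fun p => connectedComponentIn (⋃ i, G i) p with hN
  have hUo : IsOpen (⋃ i, G i) := isOpen_iUnion hGo
  have hQG : Q ⊆ ⋃ i, G i := by
    intro q hq
    rw [mem_iUnion]
    refine ⟨s ⟨q, hq⟩, ?_, hsU ⟨q, hq⟩⟩
    simp only [mem_iUnion]
    exact ⟨⟨q, hq⟩, rfl, Metric.mem_ball_self (by linarith)⟩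
  obtain ⟨S, hSQ, hScov⟩ := hQ.elim_nhds_subcover N (fun p hp =>
    hUo.connectedComponentIn.mem_nhds (mem_connectedComponentIn (hQG hp)))
  refine ⟨S.image N, ?_, ?_, ?_⟩
  · intro A hA
    obtain ⟨p, hp, rfl⟩ := Finset.mem_image.1 hA
    have hpG := hQG (hSQ p hp)
    have hpN : p ∈ N p := mem_connectedComponentIn hpG
    refine ⟨hUo.connectedComponentIn, isPreconnected_connectedComponentIn, ⟨p, hpN⟩, ?_⟩
    obtain ⟨i, hi⟩ := mem_iUnion.1 hpG
    refine ⟨i, ?_⟩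
    have hsub : N p ⊆ G i := by
      refine isPreconnected_connectedComponentIn.subset_left_of_subset_union (hGo i)
        (v := ⋃ j : ι, ⋃ _ : j ≠ i, G j) (isOpen_iUnion fun j => isOpen_iUnion fun _ => hGo j) ?_ ?_ ⟨p, hpN, hi⟩
      · rw [Set.disjoint_left]
        intro x hx hx'
        simp only [mem_iUnion] at hx'
        obtain ⟨j, hj, hxj⟩ := hx'
        exact hj (hGd _ _ _ hxj hx)
      · intro x hx
        obtain ⟨j, hj⟩ := mem_iUnion.1 (connectedComponentIn_subset _ _ hx)
        by_cases hij : j = i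
        · subst hij; exact Or.inl hj
        · exact Or.inr (by simp only [mem_iUnion]; exact ⟨j, hij, hj⟩)
    exact hsub.trans inter_subset_right
  · intro A hA B hB hAB
    obtain ⟨p, hp, rfl⟩ := Finset.mem_image.1 hA
    obtain ⟨q, hq, rfl⟩ := Finset.mem_image.1 hB
    rw [Set.disjoint_left]
    intro x hx hx'
    exact hAB ((connectedComponentIn_eq hx).trans (connectedComponentIn_eq hx').symm)
  · intro q hq
    obtain ⟨p, hp, hqp⟩ := mem_iUnion₂.1 (hScov hq)
    exact ⟨N p, Finset.mem_image_of_mem _ hp, hqp⟩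

end WDSAux
end

section
namespace WDSAux

structure St (C : Set ℂ) where
  E : ℂ ≃ₜ ℂ
  T : Finset ℝ
  r : ℝ
  hr : 0 < r
  disj : ∀ t ∈ T, ∀ t' ∈ T, ∀ z : ℂ, z ∈ Metric.closedBall (t : ℂ) r → z ∈ Metric.closedBall (t' : ℂ) r → t = t'
  cov : ∀ x ∈ C, ∃ t ∈ T, E.symm x ∈ Metric.ball (t : ℂ) r

structure Step {C : Set ℂ} (S S' : St C) (δ : ℝ) : Prop where
  off : ∀ z : ℂ, (∀ t ∈ S.T, z ∉ Metric.ball (t : ℂ) S.r) → S'.E z = S.E z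
  nest : ∀ t' ∈ S'.T, ∃ t ∈ S.T, Metric.closedBall (t' : ℂ) S'.r ⊆ Metric.ball (t : ℂ) S.r
  half : S'.r ≤ S.r / 2
  small : ∀ t' ∈ S'.T, ∀ x ∈ Metric.closedBall (t' : ℂ) S'.r, ∀ y ∈ Metric.closedBall (t' : ℂ) S'.r,
    dist (S'.E x) (S'.E y) ≤ δ
  pres : ∀ t ∈ S.T, ∀ z ∈ Metric.ball (t : ℂ) S.r, S.E.symm (S'.E z) ∈ Metric.ball (t : ℂ) S.r

theorem exists_unif_r (𝒩 : Finset (Set ℂ)) (V : Set ℂ → Set ℂ) (c : Set ℂ → ℂ)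
    (h : ∀ N ∈ 𝒩, V N ∈ 𝓝 (c N)) {ρ : ℝ} (hρ : 0 < ρ) :
    ∃ r, 0 < r ∧ r ≤ ρ ∧ ∀ N ∈ 𝒩, Metric.closedBall (c N) r ⊆ V N := by
  classical
  induction 𝒩 using Finset.induction_on with
  | empty => exact ⟨ρ, hρ, le_rfl, by simp⟩
  | insert N 𝒩 hN ih =>
    obtain ⟨r, h1, h2, h3⟩ := ih (fun A hA => h A (Finset.mem_insert_of_mem hA))
    obtain ⟨r', h4, h5⟩ := Metric.nhds_basis_closedBall.mem_iff.1 (h N (Finset.mem_insert_self _ _))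
    refine ⟨min r r', lt_min h1 h4, (min_le_left _ _).trans h2, ?_⟩
    intro A hA
    rcases Finset.mem_insert.1 hA with rfl | hA
    · exact (Metric.closedBall_subset_closedBall (min_le_right _ _)).trans h5
    · exact (Metric.closedBall_subset_closedBall (min_le_left _ _)).trans (h3 A hA)

theorem td_homeo {C : Set ℂ} (ht : IsTotallyDisconnected C) (E : ℂ ≃ₜ ℂ) :
    IsTotallyDisconnected (E.symm '' C) := by
  intro t h1 h2 x hx y hy
  have h3 : E '' t ⊆ C := by
    rintro _ ⟨z, hz, rfl⟩
    obtain ⟨w, hw, rfl⟩ := h1 hz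
    simpa using hw
  have := ht _ h3 (h2.image _ E.continuous.continuousOn) ⟨x, hx, rfl⟩ ⟨y, hy, rfl⟩
  exact E.injective this

theorem real_inf (t r : ℝ) (hr : 0 < r) :
    ((range (Complex.ofReal)) ∩ Metric.ball (t : ℂ) r).Infinite := by
  have h1 : (Complex.ofReal '' (Ioo (t - r) (t + r))).Infinite :=
    (Ioo_infinite (by linarith)).image Complex.ofReal_injective.injOn
  refine h1.mono ?_
  rintro _ ⟨x, hx, rfl⟩
  refine ⟨⟨x, rfl⟩, ?_⟩
  rw [Metric.mem_ball, Complex.dist_of_im_eq (by simp)]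
  simp only [Complex.ofReal_re, Real.dist_eq, abs_lt]
  constructor <;> linarith [hx.1, hx.2]

theorem exists_step {C : Set ℂ} (hC : IsCompact C) (ht : IsTotallyDisconnected C) (S : St C) {δ : ℝ} (hδ : 0 < δ) :
    ∃ S' : St C, Step S S' δ := by
  classical
  set Q : Set ℂ := S.E.symm '' C with hQdef
  have hQ : IsCompact Q := hC.image S.E.symm.continuous
  have hQt : IsTotallyDisconnected Q := td_homeo ht S.E
  obtain ⟨𝒩, hN, hNd, hNc⟩ := small_nbds hQ hQt
    (fun i : ℂ × S.T => Metric.ball ((i.2 : ℝ) : ℂ) S.r ∩ S.E ⁻¹' Metric.ball i.1 (δ / 2))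
    (fun i => Metric.isOpen_ball.inter (Metric.isOpen_ball.preimage S.E.continuous))
    (by
      rintro _ ⟨x, hx, rfl⟩
      obtain ⟨t, ht, hb⟩ := S.cov x hx
      refine ⟨(x, ⟨t, ht⟩), hb, ?_⟩
      simp [hδ])
  have hQN : ∀ N ∈ 𝒩, IsCompact (Q ∩ N) := by
    intro N hN1
    have : Q ∩ N = Q \ ⋃ N' ∈ 𝒩.erase N, N' := by
      ext x
      simp only [mem_inter_iff, Set.mem_sdiff, mem_iUnion, not_exists, Finset.mem_erase]
      refine and_congr_right fun hx => ⟨fun h N' h1 h2 => ?_, fun h => ?_⟩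
      · exact disjoint_left.1 (hNd N' h1.2 N hN1 h1.1) h2 h
      · obtain ⟨N', h1, h2⟩ := hNc x hx
        by_cases h3 : N' = N
        · rwa [← h3]
        · exact absurd h2 (h N' ⟨h3, h1⟩)
    rw [this]
    exact hQ.diff (isOpen_biUnion fun N' h => (hN N' (Finset.mem_of_mem_erase h)).1)
  have hd : ∀ N, ∃ d : ℂ → ℂ, N ∈ 𝒩 → IsOpenEmbedding d ∧ Q ∩ N ⊆ range d ∧ range d ⊆ N := by
    intro N
    by_cases h : N ∈ 𝒩
    · obtain ⟨h1, h2, h3, h4⟩ := hN N h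
      obtain ⟨d, h5⟩ := engulf_in surf_complex h1 h2 h3 (hQN N h) (fun t ht => hQt t (ht.trans inter_subset_left)) inter_subset_right
      exact ⟨d, fun _ => h5⟩
    · exact ⟨id, fun h' => absurd h' h⟩
  choose d hd using hd
  have hball : ∀ N ∈ 𝒩, ∃ t ∈ S.T, N ⊆ Metric.ball (t : ℂ) S.r := by
    intro N h
    obtain ⟨_, _, _, i, hi⟩ := hN N h
    exact ⟨i.2, i.2.2, hi.trans inter_subset_left⟩
  have hcN : ∀ N ∈ 𝒩, d N 0 ∈ N := fun N h => (hd N h).2.2 ⟨0, rfl⟩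
  obtain ⟨g, hg1, hg2, hg3⟩ := drag_family surf_complex (O := fun t : S.T => Metric.ball ((t : ℝ) : ℂ) S.r)
    (fun t => Metric.isOpen_ball) (fun t => (convex_ball _ _).isPreconnected)
    (fun t t' m h h' => Subtype.ext (S.disj t t.2 t' t'.2 m (Metric.ball_subset_closedBall h) (Metric.ball_subset_closedBall h')))
    (A := range Complex.ofReal) (fun t => real_inf t S.r S.hr) (𝒩.image fun N => d N 0)
    (by
      intro p hp
      obtain ⟨N, h, rfl⟩ := Finset.mem_image.1 hp
      obtain ⟨t, h1, h2⟩ := hball N h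
      exact ⟨⟨t, h1⟩, h2 (hcN N h)⟩)
  have hτ : ∀ N ∈ 𝒩, (((g (d N 0)).re : ℝ) : ℂ) = g (d N 0) := by
    intro N h
    obtain ⟨x, hx⟩ := hg3 (d N 0) (Finset.mem_image_of_mem _ h)
    rw [← hx]; simp
  set τ : Set ℂ → ℝ := fun N => (g (d N 0)).re with hτd
  obtain ⟨r', hr0, hr1, hr2⟩ := exists_unif_r 𝒩 (fun N => g '' N) (fun N => (τ N : ℂ))
    (by
      intro N h
      simp only [hτd]
      rw [hτ N h]
      exact (g.isOpenMap _ (hN N h).1).mem_nhds ⟨_, hcN N h, rfl⟩) (half_pos S.hr)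
  have hs : ∀ N, ∃ s : ℂ ≃ₜ ℂ, N ∈ 𝒩 → (∀ m ∉ N, s m = m) ∧ ∀ m ∈ Q ∩ N, s m ∈ g ⁻¹' Metric.ball (τ N : ℂ) r' := by
    intro N
    by_cases h : N ∈ 𝒩
    · obtain ⟨h1, h2, h3⟩ := hd N h
      obtain ⟨s, h4, h5⟩ := squeeze_in h1 (hQN N h) h2 (c := d N 0) ⟨0, rfl⟩
        (N := g ⁻¹' Metric.ball (τ N : ℂ) r')
        (by
          refine (Metric.isOpen_ball.preimage g.continuous).mem_nhds ?_
          simp only [hτd, mem_preimage]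
          rw [hτ N h]; simpa using hr0)
      exact ⟨s, fun _ => ⟨fun m hm => h4 m fun h => hm (h3 h), h5⟩⟩
    · exact ⟨Homeomorph.refl _, fun h' => absurd h' h⟩
  choose s0 hs0 using hs
  obtain ⟨s, hs1, hs2⟩ := glue_homeos 𝒩 hNd s0 (fun N h => (hs0 N h).1)
  have hsN : ∀ N ∈ 𝒩, ∀ m, s m ∈ N ↔ m ∈ N := by
    intro N h m
    constructor
    · intro hm
      by_contra hmN
      by_cases h1 : ∃ N' ∈ 𝒩, m ∈ N'
      · obtain ⟨N', h2, h3⟩ := h1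
        have h4 : s m ∈ N' := by rw [hs2 N' h2 m h3]; exact (idoff_maps (hs0 N' h2).1 m).2 h3
        have : N' ≠ N := by rintro rfl; exact hmN h3
        exact disjoint_left.1 (hNd N' h2 N h this) h4 hm
      · push Not at h1
        rw [hs1 m h1] at hm; exact hmN hm
    · intro hm
      rw [hs2 N h m hm]; exact (idoff_maps (hs0 N h).1 m).2 hm
  have hsB : ∀ t ∈ S.T, ∀ m, s m ∈ Metric.ball (t : ℂ) S.r ↔ m ∈ Metric.ball (t : ℂ) S.r := by
    intro t htT m
    by_cases h1 : ∃ N' ∈ 𝒩, m ∈ N'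
    · obtain ⟨N', h2, h3⟩ := h1
      obtain ⟨t', h4, h5⟩ := hball N' h2
      have h6 := h5 h3
      have h7 := h5 ((hsN N' h2 m).2 h3)
      constructor
      · intro h
        obtain rfl := S.disj t htT t' h4 _ (Metric.ball_subset_closedBall h) (Metric.ball_subset_closedBall h7)
        exact h6
      · intro h
        obtain rfl := S.disj t htT t' h4 _ (Metric.ball_subset_closedBall h) (Metric.ball_subset_closedBall h6)
        exact h7
    · push Not at h1
      rw [hs1 m h1]
  refine ⟨⟨(s.trans g).symm.trans S.E, 𝒩.image τ, r', hr0, ?_, ?_⟩, ?_⟩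
  · intro t h t' h' z hz hz'
    obtain ⟨N, h1, rfl⟩ := Finset.mem_image.1 h
    obtain ⟨N', h1', rfl⟩ := Finset.mem_image.1 h'
    obtain ⟨w, hw, rfl⟩ := hr2 N h1 hz
    obtain ⟨w', hw', he⟩ := hr2 N' h1' hz'
    obtain rfl := g.injective he
    by_cases hNN : N = N'
    · rw [hNN]
    · exact absurd hw' (disjoint_left.1 (hNd N h1 N' h1' hNN) hw)
  · intro x hx
    obtain ⟨N, h1, h2⟩ := hNc (S.E.symm x) ⟨x, hx, rfl⟩
    refine ⟨τ N, Finset.mem_image_of_mem _ h1, ?_⟩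
    have := (hs0 N h1).2 _ ⟨⟨x, hx, rfl⟩, h2⟩
    rw [← hs2 N h1 _ h2] at this
    exact this
  · constructor
    · intro z hz
      change S.E (s.symm (g.symm z)) = S.E z
      have h1 : g.symm z = z := by
        rw [Homeomorph.symm_apply_eq, hg1 z (fun t => hz t t.2)]
      have h2 : s.symm z = z := by
        rw [Homeomorph.symm_apply_eq, hs1 z]
        intro N h hzN
        obtain ⟨t, h3, h4⟩ := hball N h
        exact hz t h3 (h4 hzN)
      rw [h1, h2]
    · intro t' ht'
      obtain ⟨N, h1, rfl⟩ := Finset.mem_image.1 ht'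
      obtain ⟨t, h3, h4⟩ := hball N h1
      refine ⟨t, h3, ?_⟩
      intro z hz
      obtain ⟨w, hw, rfl⟩ := hr2 N h1 hz
      exact (hg2 ⟨t, h3⟩ w).2 (h4 hw)
    · exact hr1
    · intro t' ht' x hx y hy
      obtain ⟨N, h1, rfl⟩ := Finset.mem_image.1 ht'
      obtain ⟨w, hw, rfl⟩ := hr2 N h1 hx
      obtain ⟨w', hw', rfl⟩ := hr2 N h1 hy
      change dist (S.E (s.symm (g.symm (g w)))) (S.E (s.symm (g.symm (g w')))) ≤ δ
      rw [g.symm_apply_apply, g.symm_apply_apply]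
      obtain ⟨_, _, _, i, hi⟩ := hN N h1
      have k1 := (hi ((hsN N h1 (s.symm w)).1 (by simpa using hw))).2
      have k2 := (hi ((hsN N h1 (s.symm w')).1 (by simpa using hw'))).2
      rw [mem_preimage, Metric.mem_ball] at k1 k2
      linarith [dist_triangle_right (S.E (s.symm w)) (S.E (s.symm w')) i.1]
    · intro t htT z hz
      change S.E.symm (S.E (s.symm (g.symm z))) ∈ _
      rw [S.E.symm_apply_apply, ← hsB t htT, s.apply_symm_apply]
      exact (hg2 ⟨t, htT⟩ _).1 (by simpa using hz)

end WDSAux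
end

section
namespace WDSAux

theorem exists_seq {C : Set ℂ} (hC : IsCompact C) (ht : IsTotallyDisconnected C) :
    ∃ S : ℕ → St C, (∀ n, Step (S n) (S (n + 1)) ((1 / 2) ^ (n + 1))) ∧
      ∀ n, ∀ t ∈ (S n).T, ∀ x ∈ Metric.closedBall (t : ℂ) (S n).r, ∀ y ∈ Metric.closedBall (t : ℂ) (S n).r,
        dist ((S n).E x) ((S n).E y) ≤ (1 / 2) ^ n := by
  obtain ⟨R, hR0, hR⟩ := hC.isBounded.subset_ball_lt 0 0
  let I : St C := ⟨Homeomorph.refl _, {0}, R, hR0, by simp, by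
    intro x hx
    exact ⟨0, by simp, by simpa using hR hx⟩⟩
  obtain ⟨S0, h0⟩ := exists_step hC ht I one_pos
  choose nxt hn using fun (n : ℕ) (S : St C) => exists_step hC ht S (δ := (1 / 2) ^ (n + 1)) (by positivity)
  let S : ℕ → St C := fun n => Nat.rec S0 (fun n s => nxt n s) n
  have hS : ∀ n, Step (S n) (S (n + 1)) ((1 / 2) ^ (n + 1)) := fun n => hn n (S n)
  refine ⟨S, hS, ?_⟩
  intro n
  cases n with
  | zero => rw [pow_zero]; exact h0.small
  | succ n => exact (hS n).small

theorem flatten {C : Set ℂ} (hC : IsCompact C) (ht : IsTotallyDisconnected C) :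
    ∃ e : ℂ → ℂ, Continuous e ∧ Function.Injective e ∧
      ∃ F : Set ℂ, IsCompact F ∧ F ⊆ range Complex.ofReal ∧ C ⊆ e '' F := by
  obtain ⟨S, hS, hsm⟩ := exists_seq hC ht
  have hdist : ∀ z n, dist ((S n).E z) ((S (n + 1)).E z) ≤ 1 * (1 / 2) ^ n := by
    intro z n
    rw [one_mul]
    by_cases h : ∃ t ∈ (S n).T, z ∈ Metric.ball (t : ℂ) (S n).r
    · obtain ⟨t, h1, h2⟩ := h
      have h3 := (hS n).pres t h1 z h2
      have := hsm n t h1 z (Metric.ball_subset_closedBall h2) _ (Metric.ball_subset_closedBall h3)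
      simpa using this
    · push Not at h
      rw [(hS n).off z h, dist_self]; positivity
  have hlim : ∀ z, ∃ w, Tendsto (fun n => (S n).E z) atTop (𝓝 w) := fun z =>
    cauchySeq_tendsto_of_complete (cauchySeq_of_le_geometric (1 / 2) 1 (by norm_num) (hdist z))
  choose e he using hlim
  have hed : ∀ z n, dist ((S n).E z) (e z) ≤ 2 * (1 / 2) ^ n := by
    intro z n
    have := dist_le_of_le_geometric_of_tendsto (1 / 2) 1 (by norm_num) (hdist z) (he z) n
    convert this using 1
    ring
  have hp0 : Tendsto (fun n : ℕ => (1 / 2 : ℝ) ^ n) atTop (𝓝 0) :=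
    tendsto_pow_atTop_nhds_zero_of_lt_one (by norm_num) (by norm_num)
  have hcont : Continuous e := by
    have hu : TendstoUniformly (fun n z => (S n).E z) e atTop := by
      rw [Metric.tendstoUniformly_iff]
      intro ε hε
      have h2 : Tendsto (fun n : ℕ => 2 * (1 / 2 : ℝ) ^ n) atTop (𝓝 0) := by simpa using hp0.const_mul 2
      filter_upwards [h2.eventually (gt_mem_nhds hε)] with n hn z
      rw [dist_comm]
      exact (hed z n).trans_lt hn
    exact hu.continuous (Frequently.of_forall fun n => (S n).E.continuous)
  have nest : ∀ n k, ∀ t' ∈ (S (n + k)).T, ∃ t ∈ (S n).T,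
      Metric.ball (t' : ℂ) (S (n + k)).r ⊆ Metric.ball (t : ℂ) (S n).r := by
    intro n k
    induction k with
    | zero => exact fun t h => ⟨t, h, subset_rfl⟩
    | succ k ih =>
      intro t' h
      obtain ⟨t1, h1, h2⟩ := (hS (n + k)).nest t' h
      obtain ⟨t, h3, h4⟩ := ih t1 h1
      exact ⟨t, h3, (Metric.ball_subset_closedBall.trans h2).trans h4⟩
  have stay : ∀ n t, t ∈ (S n).T → ∀ k z, z ∈ Metric.ball (t : ℂ) (S n).r →
      (S n).E.symm ((S (n + k)).E z) ∈ Metric.ball (t : ℂ) (S n).r := by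
    intro n t htn k
    induction k with
    | zero => intro z hz; simpa using hz
    | succ k ih =>
      intro z hz
      by_cases h : ∃ t' ∈ (S (n + k)).T, z ∈ Metric.ball (t' : ℂ) (S (n + k)).r
      · obtain ⟨t', h1, h2⟩ := h
        obtain ⟨t2, h3, h4⟩ := nest n k t' h1
        obtain rfl := (S n).disj t htn t2 h3 z (Metric.ball_subset_closedBall hz) (Metric.ball_subset_closedBall (h4 h2))
        have h5 := ih _ (h4 ((hS (n + k)).pres t' h1 z h2))
        rw [Homeomorph.apply_symm_apply] at h5
        exact h5
      · push Not at h
        have := (hS (n + k)).off z h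
        rw [show n + (k + 1) = n + k + 1 from rfl, this]
        exact ih z hz
  have factK : ∀ n t, t ∈ (S n).T → ∀ z ∈ Metric.ball (t : ℂ) (S n).r,
      (S n).E.symm (e z) ∈ Metric.closedBall (t : ℂ) (S n).r := by
    intro n t htn z hz
    have h1 : Tendsto (fun k => (S n).E.symm ((S (k + n)).E z)) atTop (𝓝 ((S n).E.symm (e z))) :=
      ((S n).E.symm.continuous.tendsto _).comp ((tendsto_add_atTop_iff_nat n).2 (he z))
    refine Metric.isClosed_closedBall.mem_of_tendsto h1 (Eventually.of_forall fun k => ?_)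
    rw [add_comm]
    exact Metric.ball_subset_closedBall (stay n t htn k z hz)
  have offnest : ∀ n k z, (∀ t ∈ (S n).T, z ∉ Metric.ball (t : ℂ) (S n).r) →
      ∀ t ∈ (S (n + k)).T, z ∉ Metric.ball (t : ℂ) (S (n + k)).r := by
    intro n k z h t h1 h2
    obtain ⟨t', h3, h4⟩ := nest n k t h1
    exact h t' h3 (h4 h2)
  have factL : ∀ n z, (∀ t ∈ (S n).T, z ∉ Metric.ball (t : ℂ) (S n).r) → e z = (S n).E z := by
    intro n z h
    have h0 : ∀ k, (S (n + k)).E z = (S n).E z := by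
      intro k
      induction k with
      | zero => rfl
      | succ k ih => exact ((hS (n + k)).off z (offnest n k z h)).trans ih
    have h1 := (tendsto_add_atTop_iff_nat n).2 (he z)
    have h2 : (fun k => (S (k + n)).E z) = fun _ => (S n).E z := by
      funext k; rw [add_comm]; exact h0 k
    rw [h2] at h1
    exact tendsto_nhds_unique h1 tendsto_const_nhds
  have hr : ∀ n, (S n).r ≤ (S 0).r * (1 / 2) ^ n := by
    intro n
    induction n with
    | zero => simp
    | succ n ih => have := (hS n).half; rw [pow_succ]; linarith
  have mixed : ∀ n x y, (∀ t ∈ (S n).T, x ∉ Metric.ball (t : ℂ) (S n).r) →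
      e x = e y → x = y := by
    intro n x y hx hxy
    have hx1 := offnest n 1 x hx
    by_cases h : ∃ t' ∈ (S (n + 1)).T, y ∈ Metric.ball (t' : ℂ) (S (n + 1)).r
    · obtain ⟨t', h1, h2⟩ := h
      obtain ⟨t, h3, h4⟩ := (hS n).nest t' h1
      have h5 := h4 (factK (n + 1) t' h1 y h2)
      rw [← hxy, factL (n + 1) x hx1, Homeomorph.symm_apply_apply] at h5
      exact absurd h5 (hx t h3)
    · push Not at h
      rw [factL (n + 1) x hx1, factL (n + 1) y h] at hxy
      exact (S (n + 1)).E.injective hxy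
  refine ⟨e, hcont, ?_, ?_⟩
  · intro x y hxy
    by_contra hne
    have h1 : Tendsto (fun n : ℕ => 2 * ((S 0).r * (1 / 2 : ℝ) ^ n)) atTop (𝓝 0) := by
      simpa using (hp0.const_mul (S 0).r).const_mul 2
    obtain ⟨n, hn⟩ := (h1.eventually (gt_mem_nhds (dist_pos.2 hne))).exists
    by_cases hx : ∃ t ∈ (S n).T, x ∈ Metric.ball (t : ℂ) (S n).r
    · by_cases hy : ∃ t ∈ (S n).T, y ∈ Metric.ball (t : ℂ) (S n).r
      · obtain ⟨t, h2, h3⟩ := hx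
        obtain ⟨t', h4, h5⟩ := hy
        have h6 := factK n t h2 x h3
        have h7 := factK n t' h4 y h5
        rw [← hxy] at h7
        obtain rfl := (S n).disj t h2 t' h4 _ h6 h7
        rw [Metric.mem_ball] at h3 h5
        have := dist_triangle_right x y (t : ℂ)
        linarith [hr n]
      · push Not at hy
        exact hne (mixed n y x hy hxy.symm).symm
    · push Not at hx
      exact hne (mixed n x y hx hxy)
  · set F : Set ℂ := (⋃ t ∈ (S 0).T, Metric.closedBall (t : ℂ) (S 0).r) ∩ range Complex.ofReal with hF
    have hFc : IsCompact F := by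
      refine IsCompact.inter_right ?_ Complex.isometry_ofReal.isClosedEmbedding.isClosed_range
      exact (S 0).T.isCompact_biUnion fun t _ => isCompact_closedBall _ _
    refine ⟨F, hFc, inter_subset_right, ?_⟩
    intro x hx
    have hcl : IsClosed (e '' F) := (hFc.image hcont).isClosed
    have hmem : x ∈ closure (e '' F) := by
      rw [Metric.mem_closure_iff]
      intro ε hε
      have h1 : Tendsto (fun n : ℕ => 3 * (1 / 2 : ℝ) ^ n) atTop (𝓝 0) := by
        simpa using hp0.const_mul 3
      obtain ⟨n, hn⟩ := (h1.eventually (gt_mem_nhds hε)).exists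
      obtain ⟨t, h2, h3⟩ := (S n).cov x hx
      refine ⟨e t, ⟨t, ⟨?_, ⟨t, rfl⟩⟩, rfl⟩, ?_⟩
      · have := nest 0 n
        rw [zero_add] at this
        obtain ⟨t', h4, h5⟩ := this t h2
        exact mem_biUnion h4 (Metric.ball_subset_closedBall (h5 (Metric.mem_ball_self (S n).hr)))
      · have h4 := hsm n t h2 _ (Metric.ball_subset_closedBall h3) t (Metric.mem_closedBall_self (S n).hr.le)
        rw [Homeomorph.apply_symm_apply] at h4
        have := dist_triangle x ((S n).E t) (e t)
        linarith [hed t n]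
    rw [hcl.closure_eq] at hmem
    exact hmem

end WDSAux
end

section
namespace WDSAux

theorem klee {K : Type*} [TopologicalSpace K] [CompactSpace K] {α β : K → ℝ} (hα : Continuous α)
    (hβ : Continuous β) (iα : Function.Injective α) (iβ : Function.Injective β) :
    ∃ Φ : ℂ → ℂ, Continuous Φ ∧ Function.Injective Φ ∧ ∀ k, Φ (α k) = β k := by
  have eα : IsClosedEmbedding α := hα.isClosedEmbedding iα
  have eβ : IsClosedEmbedding β := hβ.isClosedEmbedding iβ
  obtain ⟨φ, hφ⟩ := ContinuousMap.exists_extension eα ⟨β, hβ⟩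
  obtain ⟨ψ, hψ⟩ := ContinuousMap.exists_extension eβ ⟨α, hα⟩
  have hφ' : ∀ k, φ (α k) = β k := fun k => congrArg (fun f => f k) hφ
  have hψ' : ∀ k, ψ (β k) = α k := fun k => congrArg (fun f => f k) hψ
  have hφc := φ.continuous
  have hψc := ψ.continuous
  refine ⟨fun z => ((z.im + φ z.re : ℝ) : ℂ) + ((z.re - ψ (z.im + φ z.re) : ℝ) : ℂ) * Complex.I, by fun_prop, ?_, ?_⟩
  · intro z w h
    have h1 := congrArg Complex.re h
    have h2 := congrArg Complex.im h
    simp only [Complex.add_re, Complex.add_im, Complex.re_ofReal_mul, Complex.im_ofReal_mul, Complex.ofReal_re,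
      Complex.ofReal_im, Complex.I_re, Complex.I_im, mul_zero, add_zero, mul_one, zero_add] at h1 h2
    rw [h1] at h2
    have h3 : z.re = w.re := by linarith
    rw [h3] at h1
    exact Complex.ext h3 (by linarith)
  · intro k
    simp [hφ', hψ']

theorem circle_flat {K : Set UnitAddCircle} (hK : IsCompact K) (hne : K.Nonempty) (hp : K ≠ univ) :
    ∃ c : UnitAddCircle → ℂ, Continuous c ∧ Function.Injective c ∧ ∀ k ∈ K, (c k).im = 0 := by
  obtain ⟨θ', hθ'⟩ := (ne_univ_iff_exists_notMem K).1 hp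
  obtain ⟨θ, rfl⟩ := QuotientAddGroup.mk_surjective θ'
  change (θ : UnitAddCircle) ∉ K at hθ'
  set L : Set ℝ := Icc θ (θ + 1) ∩ {u | (u : UnitAddCircle) ∈ K} with hL
  have hLc : IsCompact L := isCompact_Icc.inter_right (hK.isClosed.preimage (AddCircle.continuous_mk' 1))
  have hrep : ∀ k : UnitAddCircle, ∃ u ∈ Ico θ (θ + 1), (u : UnitAddCircle) = k := by
    intro k
    have : k ∈ ((↑) : ℝ → AddCircle (1:ℝ)) '' Ico θ (θ + 1) := by
      rw [AddCircle.coe_image_Ico_eq]; trivial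
    exact this
  have hLne : L.Nonempty := by
    obtain ⟨k, hk⟩ := hne
    obtain ⟨u, hu, rfl⟩ := hrep k
    exact ⟨u, Ico_subset_Icc_self hu, hk⟩
  obtain ⟨u0, hu0, hmax⟩ := hLc.exists_isMaxOn hLne (f := fun u => |2 * (u - θ) - 1|) (by fun_prop)
  set κ : ℝ := |2 * (u0 - θ) - 1| with hκ
  have hθ1 : ((θ + 1 : ℝ) : UnitAddCircle) = θ := by
    simpa using AddCircle.coe_add_period (1:ℝ) θ
  have hκ1 : κ < 1 := by
    have a1 : u0 ≠ θ := by rintro rfl; exact hθ' hu0.2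
    have a2 : u0 ≠ θ + 1 := by
      rintro rfl
      have := hu0.2
      rw [mem_ofPred_eq, hθ1] at this; exact hθ' this
    have a3 := lt_of_le_of_ne hu0.1.1 a1.symm
    have a4 := lt_of_le_of_ne hu0.1.2 a2
    rw [hκ, abs_lt]; constructor <;> linarith
  set s : ℝ → ℝ := fun u => max (|2 * (u - θ) - 1| - κ) 0 with hs
  set f : ℝ → ℂ := fun u => (((2 * (u - θ) - 1) * (1 - κ - s u) : ℝ) : ℂ) + (s u : ℂ) * Complex.I with hf
  have hfc : Continuous f := by fun_prop
  have e1 : s θ = 1 - κ := by simp [hs, hκ1.le]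
  have e2 : s (θ + 1) = 1 - κ := by
    have : (2 * (θ + 1 - θ) - 1 : ℝ) = 1 := by ring
    change max (|2 * (θ + 1 - θ) - 1| - κ) 0 = 1 - κ
    rw [this, abs_one, max_eq_left (by linarith)]
  have hre : ∀ u, (f u).re = (2 * (u - θ) - 1) * (1 - κ - s u) := by
    intro u
    simp only [hf, Complex.add_re, Complex.re_ofReal_mul, Complex.ofReal_re, Complex.I_re, mul_zero, add_zero]
  have him : ∀ u, (f u).im = s u := by
    intro u
    simp only [hf, Complex.add_im, Complex.im_ofReal_mul, Complex.ofReal_im, Complex.I_im, mul_one, zero_add]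
  have hfθ : f θ = f (θ + 1) := by
    apply Complex.ext
    · rw [hre, hre, e1, e2]; ring
    · rw [him, him, e1, e2]
  refine ⟨AddCircle.liftIco 1 θ f, AddCircle.liftIco_continuous hfθ hfc.continuousOn, ?_, ?_⟩
  · intro x y hxy
    obtain ⟨u, hu, rfl⟩ := hrep x
    obtain ⟨w, hw, rfl⟩ := hrep y
    rw [AddCircle.liftIco_coe_apply hu, AddCircle.liftIco_coe_apply hw] at hxy
    have h1 := congrArg Complex.re hxy
    have h2 := congrArg Complex.im hxy
    rw [hre, hre] at h1
    rw [him, him] at h2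
    rw [h2] at h1
    by_cases h0 : 1 - κ - s w = 0
    · have key : ∀ v ∈ Ico θ (θ + 1), 1 - κ - s v = 0 → v = θ := by
        intro v hv h
        have h3 : 0 < s v := by linarith
        have h4 : s v = |2 * (v - θ) - 1| - κ := by
          rcases max_choice (|2 * (v - θ) - 1| - κ) 0 with h' | h'
          · exact h'
          · exact absurd h' h3.ne'
        have h5 : |2 * (v - θ) - 1| = 1 := by linarith
        rcases eq_or_eq_neg_of_abs_eq h5 with h6 | h6
        · linarith [hv.2]
        · linarith
      rw [key u hu (by rw [h2]; exact h0), key w hw h0]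
    · have := mul_right_cancel₀ h0 h1
      rw [show u = w by linarith]
  · intro k hk
    obtain ⟨u, hu, rfl⟩ := hrep k
    rw [AddCircle.liftIco_coe_apply hu, him]
    have : |2 * (u - θ) - 1| ≤ κ := hmax (show u ∈ L from ⟨Ico_subset_Icc_self hu, hk⟩)
    exact max_eq_right (by linarith)

theorem circle_extend {K : Set UnitAddCircle} (hK : IsCompact K) (hne : K.Nonempty) (hp : K ≠ univ)
    {β : K → ℝ} (hβ : Continuous β) (iβ : Function.Injective β) :
    ∃ c : UnitAddCircle → ℂ, Continuous c ∧ Function.Injective c ∧ ∀ k : K, c k = β k := by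
  obtain ⟨c, h1, h2, h3⟩ := circle_flat hK hne hp
  have : CompactSpace K := isCompact_iff_compactSpace.1 hK
  have hc : ∀ k : K, (((c k).re : ℝ) : ℂ) = c k := fun k => Complex.ext (by simp) (by simp [h3 k k.2])
  obtain ⟨Φ, p1, p2, p3⟩ := klee (α := fun k : K => (c k).re) (β := β)
    (Complex.continuous_re.comp (h1.comp continuous_subtype_val)) hβ
    (by
      intro k l h
      have h' : (c k).re = (c l).re := h
      apply Subtype.ext
      apply h2
      rw [← hc k, ← hc l, h']) iβ
  refine ⟨Φ ∘ c, p1.comp h1, p2.comp h2, fun k => ?_⟩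
  rw [← p3 k, Function.comp_apply, hc k]

end WDSAux
end

section
namespace WDSAux

theorem no_per (D : DenjoySystem) (z : ℝ) (n : ℕ) (hn : 0 < n) (k : ℤ) : D.lift^[n] z ≠ z + k := by
  intro h
  let g : CircleDeg1Lift := ⟨⟨D.lift, D.lift_mono.monotone⟩, D.lift_add⟩
  have h1 : CircleDeg1Lift.translationNumber g = D.rot := g.translationNumber_eq_of_tendsto₀ D.rot_lim
  have h2 : (g ^ n) z = z + k := by
    rw [CircleDeg1Lift.coe_pow]; exact h
  have h3 := g.translationNumber_of_map_pow_eq_add_int h2 hn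
  apply D.rot_irr
  rw [← h1, h3]
  exact ⟨(k : ℚ) / n, by push_cast; rfl⟩

theorem lift_iter_proj (D : DenjoySystem) (n : ℕ) (u : ℝ) :
    ((D.lift^[n] u : ℝ) : UnitAddCircle) = D.h^[n] (u : UnitAddCircle) := by
  have : Function.Semiconj (fun u : ℝ => (u : UnitAddCircle)) D.lift D.h := D.lift_proj
  exact (this.iterate_right n) u

theorem lift_iter_add (D : DenjoySystem) (n : ℕ) (u : ℝ) (k : ℤ) :
    D.lift^[n] (u + k) = D.lift^[n] u + k := by
  let g : CircleDeg1Lift := ⟨⟨D.lift, D.lift_mono.monotone⟩, D.lift_add⟩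
  have := (g ^ n).map_add_int u k
  rw [CircleDeg1Lift.coe_pow] at this
  exact this

theorem coe_add_int (u : ℝ) (k : ℤ) : ((u + k : ℝ) : UnitAddCircle) = u := by
  have h : ((k : ℝ) : UnitAddCircle) = 0 := by
    rw [AddCircle.coe_eq_zero_iff]
    exact ⟨k, by simp⟩
  rw [AddCircle.coe_add, h, add_zero]

theorem no_clopen_inv (D : DenjoySystem) {A B : Set UnitAddCircle} (hA : IsCompact A) (hB : IsCompact B)
    (hAB : Disjoint A B) (hAn : A.Nonempty) (hBn : B.Nonempty) {p : ℕ} (hp : 0 < p)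
    (hgA : ∀ x ∈ A, D.h^[p] x ∈ A) (hgA' : ∀ x, D.h^[p] x ∈ A → x ∈ A) (hgB : ∀ x ∈ B, D.h^[p] x ∈ B) : False := by
  set G : ℝ → ℝ := D.lift^[p] with hG
  have hGm : StrictMono G := D.lift_mono.iterate p
  have hGp : ∀ u : ℝ, ((G u : ℝ) : UnitAddCircle) = D.h^[p] (u : UnitAddCircle) := lift_iter_proj D p
  obtain ⟨c, hc0, hc⟩ := Metric.exists_pos_forall_lt_edist hA hB.isClosed hAB
  have hc' : ∀ u v : ℝ, (u : UnitAddCircle) ∈ A → (v : UnitAddCircle) ∈ B → (c : ℝ) < |v - u| := by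
    intro u v hu hv
    have h1 := hc _ hu _ hv
    rw [edist_nndist, ENNReal.coe_lt_coe, ← NNReal.coe_lt_coe, coe_nndist] at h1
    refine h1.trans_le ?_
    rw [dist_comm, dist_eq_norm]
    exact QuotientAddGroup.norm_mk_le_norm (m := v - u)
  obtain ⟨y', hy'⟩ := hBn
  obtain ⟨y, rfl⟩ := QuotientAddGroup.mk_surjective y'
  change (y : UnitAddCircle) ∈ B at hy'
  obtain ⟨x', hx'⟩ := hAn
  obtain ⟨x, rfl⟩ := QuotientAddGroup.mk_surjective x'
  change (x : UnitAddCircle) ∈ A at hx'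
  set L : Set ℝ := {u | (u : UnitAddCircle) ∈ A} with hL
  have hLc : IsClosed L := hA.isClosed.preimage (AddCircle.continuous_mk' 1)
  have hLne : (L ∩ Iic y).Nonempty := by
    refine ⟨x + (⌊y - x⌋ : ℤ), ?_, ?_⟩
    · rw [hL, mem_ofPred_eq, coe_add_int]; exact hx'
    · rw [mem_Iic]; linarith [Int.floor_le (y - x)]
  have hbdd : BddAbove (L ∩ Iic y) := ⟨y, fun u hu => hu.2⟩
  set a := sSup (L ∩ Iic y) with ha
  have haL : a ∈ L ∩ Iic y := (hLc.inter isClosed_Iic).csSup_mem hLne hbdd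
  have hgap : ∀ u ∈ L, a < u → y < u := by
    intro u hu hau
    by_contra h
    exact absurd (le_csSup hbdd ⟨hu, not_lt.1 h⟩) (not_le.2 hau)
  have hGL : ∀ u, G u ∈ L ↔ u ∈ L := by
    intro u
    rw [hL, mem_ofPred_eq, mem_ofPred_eq, hGp]
    exact ⟨hgA' _, hgA _⟩
  have hGLn : ∀ n u, G^[n] u ∈ L ↔ u ∈ L := by
    intro n
    induction n with
    | zero => exact fun u => Iff.rfl
    | succ n ih => intro u; rw [Function.iterate_succ_apply, ih, hGL]
  have hGB : ∀ n, ((G^[n] y : ℝ) : UnitAddCircle) ∈ B := by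
    intro n
    induction n with
    | zero => exact hy'
    | succ n ih => rw [Function.iterate_succ_apply', hGp]; exact hgB _ ih
  have hsurj : Function.Surjective G := D.lift_bij.surjective.iterate p
  have hsep : ∀ n, ∀ u ∈ L, G^[n] a < u → G^[n] a + c < u := by
    intro n u hu hau
    obtain ⟨w, rfl⟩ := hsurj.iterate n u
    have h1 : a < w := (hGm.iterate n).lt_iff_lt.1 hau
    have h2 : G^[n] y < G^[n] w := hGm.iterate n (hgap w ((hGLn n w).1 hu) h1)
    have h3 := hc' (G^[n] a) (G^[n] y) ((hGLn n a).2 haL.1) (hGB n)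
    rw [abs_of_nonneg (sub_nonneg.2 ((hGm.iterate n).monotone haL.2))] at h3
    linarith
  have hLadd : ∀ u ∈ L, ∀ k : ℤ, u + k ∈ L := by
    intro u hu k
    rw [hL, mem_ofPred_eq, coe_add_int]; exact hu
  have hnp : ∀ n m : ℕ, n < m → ∀ k : ℤ, G^[m] a ≠ G^[n] a + k := by
    intro n m hnm k h
    obtain ⟨q, rfl⟩ := Nat.exists_eq_add_of_lt hnm
    rw [show n + q + 1 = (q + 1) + n by ring, Function.iterate_add_apply, hG, ← Function.iterate_mul] at h
    exact no_per D _ (p * (q + 1)) (by positivity) k h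
  have hfar : ∀ n m : ℕ, n < m → ∀ k : ℤ, (c : ℝ) < |G^[m] a - (G^[n] a + k)| := by
    intro n m hnm k
    rcases lt_or_gt_of_ne (hnp n m hnm k) with h | h
    · have := hsep m _ (hLadd _ ((hGLn n a).2 haL.1) k) h
      rw [abs_of_neg (by linarith)]; linarith
    · have h1 : G^[n] a < G^[m] a + (-k : ℤ) := by push_cast; linarith
      have := hsep n _ (hLadd _ ((hGLn m a).2 haL.1) (-k)) h1
      push_cast at this
      rw [abs_of_pos (by linarith)]; linarith
  obtain ⟨w, _, φ, hφ, hlim⟩ := isCompact_Icc.tendsto_subseq (s := Icc (0:ℝ) 1) (x := fun n => Int.fract (G^[n] a))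
    (fun n => ⟨Int.fract_nonneg _, (Int.fract_lt_one _).le⟩)
  have hcau := hlim.cauchySeq
  rw [Metric.cauchySeq_iff'] at hcau
  obtain ⟨N, hN⟩ := hcau c hc0
  have h1 := hN (N + 1) (by omega)
  have h2 := hfar (φ N) (φ (N + 1)) (hφ (by omega)) (⌊G^[φ (N + 1)] a⌋ - ⌊G^[φ N] a⌋)
  simp only [Function.comp_apply, Real.dist_eq, Int.fract] at h1
  push_cast at h2
  rw [show G^[φ (N + 1)] a - (G^[φ N] a + ((⌊G^[φ (N + 1)] a⌋ : ℝ) - ⌊G^[φ N] a⌋)) =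
    G^[φ (N + 1)] a - ⌊G^[φ (N + 1)] a⌋ - (G^[φ N] a - ⌊G^[φ N] a⌋) by ring] at h2
  exact lt_asymm h1 h2

theorem locconst (D : DenjoySystem) {ι : Type*} (κ : D.K → ι) (hκ : IsLocallyConstant κ) (F : ι → ι)
    (hF : Function.Injective F) (heq : ∀ x y : D.K, D.h x = y → κ y = F (κ x)) (x0 y0 : D.K) : κ x0 = κ y0 := by
  by_contra hne
  have : CompactSpace D.K := isCompact_iff_compactSpace.1 D.K_cpt
  have hfin : (range κ).Finite := hκ.range_finite
  have hinv : ∀ x ∈ D.K, D.h x ∈ D.K := fun x hx => D.K_inv ▸ mem_image_of_mem _ hx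
  have hinv' : ∀ x, D.h x ∈ D.K → x ∈ D.K := by
    intro x hx
    rw [← D.K_inv] at hx
    obtain ⟨z, hz, he⟩ := hx
    exact D.h.injective he ▸ hz
  have hit : ∀ n (x : D.K), ∃ y : D.K, (y : UnitAddCircle) = D.h^[n] x ∧ κ y = F^[n] (κ x) := by
    intro n x
    induction n with
    | zero => exact ⟨x, rfl, rfl⟩
    | succ n ih =>
      obtain ⟨y, h1, h2⟩ := ih
      refine ⟨⟨D.h y, hinv y y.2⟩, ?_, ?_⟩
      · rw [Function.iterate_succ_apply', ← h1]
      · rw [Function.iterate_succ_apply', ← h2]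
        exact heq y _ rfl
  have hit' : ∀ n x, D.h^[n] x ∈ D.K → x ∈ D.K := by
    intro n
    induction n with
    | zero => exact fun x h => h
    | succ n ih => intro x h; rw [Function.iterate_succ_apply] at h; exact hinv' _ (ih _ h)
  have hper : ∃ p, 0 < p ∧ F^[p] (κ x0) = κ x0 := by
    have : Finite (range κ) := hfin
    obtain ⟨n, m, hnm, he⟩ := Finite.exists_ne_map_eq_of_infinite
      (fun n : ℕ => (⟨F^[n] (κ x0), by obtain ⟨y, _, h⟩ := hit n x0; exact ⟨y, h⟩⟩ : range κ))
    have he' : F^[n] (κ x0) = F^[m] (κ x0) := congrArg Subtype.val he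
    have key : ∀ n m : ℕ, n < m → F^[n] (κ x0) = F^[m] (κ x0) → ∃ p, 0 < p ∧ F^[p] (κ x0) = κ x0 := by
      intro n m hnm h
      obtain ⟨q, rfl⟩ := Nat.exists_eq_add_of_lt hnm
      rw [show n + q + 1 = n + (q + 1) by ring, Function.iterate_add_apply] at h
      exact ⟨q + 1, by omega, (hF.iterate n h).symm⟩
    rcases lt_or_gt_of_ne hnm with h | h
    · exact key n m h he'
    · exact key m n h he'.symm
  obtain ⟨p, hp, hpe⟩ := hper
  have hiff : ∀ x y : D.K, (y : UnitAddCircle) = D.h^[p] x → (κ y = κ x0 ↔ κ x = κ x0) := by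
    intro x y h
    obtain ⟨y', h1, h2⟩ := hit p x
    have : y' = y := Subtype.ext (h1.trans h.symm)
    subst this
    rw [h2]
    constructor
    · intro h3
      rw [← hpe] at h3
      exact hF.iterate p h3
    · intro h3; rw [h3, hpe]
  refine no_clopen_inv D (A := Subtype.val '' {x : D.K | κ x = κ x0}) (B := Subtype.val '' {x : D.K | κ x ≠ κ x0})
    ((hκ.isClosed_fiber (κ x0)).isCompact.image continuous_subtype_val)
    ((hκ.isOpen_fiber (κ x0)).isClosed_compl.isCompact.image continuous_subtype_val)
    ?_ ⟨x0, x0, rfl, rfl⟩ ⟨y0, y0, fun h => hne h.symm, rfl⟩ hp ?_ ?_ ?_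
  · rw [disjoint_left]
    rintro _ ⟨x, hx, rfl⟩ ⟨y, hy, h⟩
    rw [Subtype.ext h] at hy
    exact hy hx
  · rintro _ ⟨x, hx, rfl⟩
    obtain ⟨y, h1, h2⟩ := hit p x
    exact ⟨y, (hiff x y h1).2 hx, h1⟩
  · rintro x ⟨y, hy, h⟩
    have hx := hit' p x (h ▸ y.2)
    exact ⟨⟨x, hx⟩, (hiff ⟨x, hx⟩ y h).1 hy, rfl⟩
  · rintro _ ⟨x, hx, rfl⟩
    obtain ⟨y, h1, h2⟩ := hit p x
    exact ⟨y, fun h => hx ((hiff x y h1).1 h), h1⟩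

end WDSAux
end

namespace WDSAux

theorem comp_open {M : Type*} [TopologicalSpace M] (hM : Surf M) (m : M) : IsOpen (connectedComponent m) := by
  rw [isOpen_iff_mem_nhds]
  intro y hy
  obtain ⟨d, h1, _, h3⟩ := hM y univ univ_mem
  rw [connectedComponent_eq hy]
  refine Filter.mem_of_superset (h1.isOpen_range.mem_nhds ⟨0, h3⟩) ?_
  exact (isPreconnected_range h1.continuous).subset_connectedComponent ⟨0, h3⟩

theorem comp_image {M : Type*} [TopologicalSpace M] {f : M → M} (hf : IsHomeomorph f) (m : M) :
    f '' connectedComponent m = connectedComponent (f m) := by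
  have := (hf.homeomorph f).image_connectedComponentIn (mem_univ m)
  rw [connectedComponentIn_univ, image_univ, (hf.homeomorph f).surjective.range_eq, connectedComponentIn_univ] at this
  exact this

theorem main_aux {M : Type*} [TopologicalSpace M] [T2Space M] (hM : Surf M)
    (f : M → M) (hf : IsHomeomorph f) (W : WDS M f) :
    ∃ γ : UnitAddCircle → M, Continuous γ ∧ Function.Injective γ ∧
      (∀ x : W.K, γ (x : UnitAddCircle) = W.j x) := by
  have : CompactSpace W.K := isCompact_iff_compactSpace.1 W.K_cpt
  obtain ⟨x', hx'⟩ := W.K_ne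
  set x0 : W.K := ⟨x', hx'⟩
  have hcomp := locconst W.toDenjoySystem (fun x => connectedComponent (W.j x))
    (by
      rw [IsLocallyConstant.iff_eventually_eq]
      intro x
      have h1 : W.j ⁻¹' connectedComponent (W.j x) ∈ 𝓝 x :=
        ((comp_open hM _).preimage W.j_emb.continuous).mem_nhds mem_connectedComponent
      filter_upwards [h1] with y hy
      exact (connectedComponent_eq hy).symm)
    (fun s => f '' s) hf.injective.image_injective
    (by
      intro x y h
      beta_reduce
      rw [W.equivar x y h, comp_image hf])
  set C : Set M := range W.j with hC
  have hCc : IsCompact C := isCompact_range W.j_emb.continuous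
  have hCt : IsTotallyDisconnected C := by
    intro t h1 h2 x hx y hy
    have h3 : W.j '' (W.j ⁻¹' t) = t := image_preimage_eq_of_subset h1
    have h4 : IsPreconnected (W.j ⁻¹' t) := by
      rw [← W.j_emb.toIsInducing.isPreconnected_image, h3]; exact h2
    have h5 := h4.image _ (continuous_subtype_val (p := fun z => z ∈ W.K)).continuousOn
    have h6 := W.K_td _ (by rintro _ ⟨z, _, rfl⟩; exact z.2) h5
    obtain ⟨a, rfl⟩ := h1 hx
    obtain ⟨b, rfl⟩ := h1 hy
    rw [Subtype.ext (h6 ⟨a, hx, rfl⟩ ⟨b, hy, rfl⟩)]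
  obtain ⟨d, hd1, hd2, _⟩ := engulf_in hM (comp_open hM (W.j x0)) isPreconnected_connectedComponent
    ⟨_, mem_connectedComponent⟩ hCc hCt (by
      rintro _ ⟨x, rfl⟩
      have : connectedComponent (W.j x0) = connectedComponent (W.j x) := hcomp x0 x
      rw [this]
      exact mem_connectedComponent)
  have hCc' : IsCompact (d ⁻¹' C) := by
    rw [hd1.toIsInducing.isCompact_iff, image_preimage_eq_inter_range, inter_eq_left.2 hd2]
    exact hCc
  have hCt' : IsTotallyDisconnected (d ⁻¹' C) := td_preimage hd1.continuous hd1.injective hCt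
  obtain ⟨e, he1, he2, F, hF1, hF2, hF3⟩ := flatten hCc' hCt'
  have hb : ∀ k : W.K, ∃ b : F, d (e b) = W.j k := by
    intro k
    obtain ⟨z, hz⟩ := hd2 ⟨k, rfl⟩
    obtain ⟨b, hb, hbe⟩ := hF3 (show z ∈ d ⁻¹' C from ⟨k, hz.symm⟩)
    exact ⟨⟨b, hb⟩, by rw [← hz, ← hbe]⟩
  choose b hb using hb
  have : CompactSpace F := isCompact_iff_compactSpace.1 hF1
  have hg : IsClosedEmbedding (fun z : F => d (e z)) :=
    (hd1.continuous.comp (he1.comp continuous_subtype_val)).isClosedEmbedding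
      (hd1.injective.comp (he2.comp Subtype.val_injective))
  have hbc : Continuous b := by
    rw [hg.toIsInducing.continuous_iff]
    have : (fun z : F => d (e z)) ∘ b = W.j := funext hb
    rw [this]; exact W.j_emb.continuous
  have hre : ∀ k, (((b k : ℂ).re : ℝ) : ℂ) = b k := by
    intro k
    obtain ⟨x, hx⟩ := hF2 (b k).2
    rw [← hx]; simp
  obtain ⟨c, c1, c2, c3⟩ := circle_extend W.K_cpt W.K_ne W.K_proper (β := fun k : W.K => (b k : ℂ).re)
    (Complex.continuous_re.comp (continuous_subtype_val.comp hbc))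
    (by
      intro k l h
      have h' : (b k : ℂ).re = (b l : ℂ).re := h
      apply W.j_emb.injective
      rw [← hb k, ← hb l, ← hre k, ← hre l, h'])
  refine ⟨fun x => d (e (c x)), hd1.continuous.comp (he1.comp c1), hd1.injective.comp (he2.comp c2), ?_⟩
  intro k
  beta_reduce
  rw [c3 k, hre k, hb k]

end WDSAux

/-- On a topological surface, every weak Denjoy sub-system extends to a `C⁰` Denjoy
sub-system: the embedding of the Cantor set extends to a continuous injective map of the
whole circle. -/
theorem WDS_extends_to_Denjoy_subsystem_on_surface
    {M : Type*} [TopologicalSpace M] [T2Space M]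
    (hsurf : ∀ m : M, ∃ U : Set M, IsOpen U ∧ m ∈ U ∧
      ∃ V : Set (ℝ × ℝ), IsOpen V ∧ Nonempty (U ≃ₜ V))
    (f : M → M) (hf : IsHomeomorph f) (W : WDS M f) :
    ∃ γ : UnitAddCircle → M, Continuous γ ∧ Function.Injective γ ∧
      (∀ x : W.K, γ (x : UnitAddCircle) = W.j x) ∧
      f '' (γ '' W.K) = γ '' W.K ∧
      (∀ x ∈ W.K, γ (W.h x) = f (γ x)) := by
  obtain ⟨γ, h1, h2, h3⟩ := WDSAux.main_aux (WDSAux.surf_of_charts hsurf) f hf W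
  have himg : γ '' W.K = range W.j := by
    ext m
    constructor
    · rintro ⟨x, hx, rfl⟩; exact ⟨⟨x, hx⟩, (h3 ⟨x, hx⟩).symm⟩
    · rintro ⟨x, rfl⟩; exact ⟨x, x.2, h3 x⟩
  refine ⟨γ, h1, h2, h3, ?_, ?_⟩
  · rw [himg, W.range_inv]
  · intro x hx
    have hx' : W.h x ∈ W.K := by
      have := mem_image_of_mem W.h hx
      rwa [W.K_inv] at this
    have := W.equivar ⟨x, hx⟩ ⟨_, hx'⟩ rfl
    rw [← h3, ← h3] at this
    exact this
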